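/- The only pairs (b, w) ∈ ℚ × ℚ satisfying b·w² − (b⁴ − 2b³ + b² + b − 1)w + b⁴ − 2b³ + 2b² − b = 0 are (b, w) = (0, 0) and (b, w) = (1, 0). -/

import Mathlib

section
open Polynomial

namespace N3

section basics

variable (k : Type*) [CommRing k]

/-- The polynomial `R`. -/
noncomputable def Rp : k[X] := X ^ 3 + X ^ 2 - 2 * X + 1

/-- The polynomial `h`. -/
noncomputable def hp : k[X] := X ^ 4 * (X - 1) ^ 3

/-- The coordinate ring of the curve `y² + R y = h`. -/
abbrev S := QuadraticAlgebra k[X] (hp k) (-(Rp k))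

end basics

section maps
variable {k l : Type*} [CommRing k] [CommRing l]

lemma Rp_map (φ : k →+* l) : (Rp k).map φ = Rp l := by simp [Rp]
lemma hp_map (φ : k →+* l) : (hp k).map φ = hp l := by simp [hp]

/-- Base change. -/
noncomputable def mp (φ : k →+* l) : S k →+* S l where
  toFun z := ⟨z.re.map φ, z.im.map φ⟩
  map_one' := by ext1 <;> simp [QuadraticAlgebra.re_one, QuadraticAlgebra.im_one]
  map_zero' := by ext1 <;> simp
  map_add' x y := by ext1 <;> simp
  map_mul' x y := by ext1 <;> simp [Rp_map, hp_map]

@[simp] lemma mp_re (φ : k →+* l) (z : S k) : (mp φ z).re = z.re.map φ := rfl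
@[simp] lemma mp_im (φ : k →+* l) (z : S k) : (mp φ z).im = z.im.map φ := rfl

/-- Embedding of polynomials. -/
noncomputable def cc : k[X] →+* S k := algebraMap k[X] (S k)
@[simp] lemma cc_re (p : k[X]) : (cc p).re = p := rfl
@[simp] lemma cc_im (p : k[X]) : (cc p).im = 0 := rfl
lemma cc_inj {p q : k[X]} : cc p = cc q ↔ p = q :=
  ⟨fun h => congrArg QuadraticAlgebra.re h, fun h => by rw [h]⟩

/-- The norm. -/
noncomputable def nm : S k →* k[X] := QuadraticAlgebra.norm
lemma nm_def (z : S k) : nm z = z.re ^ 2 - Rp k * z.re * z.im - hp k * z.im ^ 2 := by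
  simp [nm, QuadraticAlgebra.norm_def]; ring
@[simp] lemma st_re (z : S k) : (star z).re = z.re - Rp k * z.im := by
  simp [QuadraticAlgebra.re_star]; ring
@[simp] lemma st_im (z : S k) : (star z).im = - z.im := by simp
lemma mul_st (z : S k) : z * star z = cc (nm z) :=
  (QuadraticAlgebra.algebraMap_norm_eq_mul_star z).symm
lemma st_cc (p : k[X]) : star (cc p : S k) = cc p := by ext1 <;> simp
lemma nm_cc (p : k[X]) : nm (cc p : S k) = p ^ 2 := by simp [nm_def]
lemma nm_st (z : S k) : nm (star z) = nm z := QuadraticAlgebra.norm_star z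
lemma nm_zero : nm (0 : S k) = 0 := QuadraticAlgebra.norm_zero
lemma mp_cc (φ : k →+* l) (p : k[X]) : mp φ (cc p) = cc (p.map φ) := by ext1 <;> simp
lemma mp_st (φ : k →+* l) (z : S k) : mp φ (star z) = star (mp φ z) := by
  ext1 <;> simp [Rp_map]
lemma nm_mp (φ : k →+* l) (z : S k) : nm (mp φ z) = (nm z).map φ := by
  simp [nm_def, Rp_map, hp_map]
lemma mp_surj (φ : k →+* l) (h : Function.Surjective φ) : Function.Surjective (mp φ) := by
  intro z
  obtain ⟨a, ha⟩ := Polynomial.map_surjective φ h z.re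
  obtain ⟨b, hb⟩ := Polynomial.map_surjective φ h z.im
  exact ⟨⟨a, b⟩, by ext1 <;> simp [ha, hb]⟩
lemma mp_inj (φ : k →+* l) (h : Function.Injective φ) : Function.Injective (mp φ) := by
  intro z w hzw
  ext1
  · exact Polynomial.map_injective φ h (congrArg QuadraticAlgebra.re hzw)
  · exact Polynomial.map_injective φ h (congrArg QuadraticAlgebra.im hzw)

lemma cc_dvd {p : k[X]} {z : S k} : cc p ∣ z ↔ p ∣ z.re ∧ p ∣ z.im :=
  QuadraticAlgebra.algebraMap_dvd_iff

end maps

section degree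
variable {k : Type*} [CommRing k]

/-- `pl n z`: pole order at infinity at most `n`. -/
def pl (n : ℕ) (z : S k) : Prop :=
  (∀ i, n < 2 * i → z.re.coeff i = 0) ∧ (∀ i, n < 2 * i + 7 → z.im.coeff i = 0)

lemma Rp_deg : (Rp k).natDegree ≤ 3 := by unfold Rp; compute_degree
lemma hp_deg : (hp k).natDegree ≤ 7 := by
  unfold hp
  refine natDegree_mul_le.trans ?_
  have h1 : (X ^ 4 : k[X]).natDegree ≤ 4 := natDegree_X_pow_le 4
  have h2 : ((X - 1 : k[X]) ^ 3).natDegree ≤ 3 := by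
    refine natDegree_pow_le.trans ?_
    have : (X - 1 : k[X]).natDegree ≤ 1 := by compute_degree
    omega
  omega
lemma hp_monic : (hp k).Monic := by
  unfold hp
  have h : (X - 1 : k[X]).Monic := by simpa using monic_X_sub_C (1:k)
  exact (monic_X_pow 4).mul (h.pow 3)
lemma hp_natDegree [Nontrivial k] : (hp k).natDegree = 7 := by
  unfold hp
  have h : (X - 1 : k[X]).Monic := by simpa using monic_X_sub_C (1:k)
  rw [Monic.natDegree_mul (monic_X_pow 4) (h.pow 3), h.natDegree_pow]
  have : (X - 1 : k[X]).natDegree = 1 := by simpa using natDegree_X_sub_C (1:k)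
  simp [this]

lemma natDegree_mul3_le (p q r : k[X]) :
    (p * q * r).natDegree ≤ p.natDegree + q.natDegree + r.natDegree :=
  natDegree_mul_le.trans (by gcongr; exact natDegree_mul_le)

lemma pl_deg {n : ℕ} {z : S k} (h : pl n z) :
    (2 * z.re.natDegree ≤ n) ∧ (z.im = 0 ∨ 2 * z.im.natDegree + 7 ≤ n) := by
  constructor
  · by_contra hc
    by_cases h0 : z.re = 0
    · simp [h0] at hc
    · exact h0 (leadingCoeff_eq_zero.mp (h.1 _ (by omega)))
  · by_contra! hc
    exact hc.1 (leadingCoeff_eq_zero.mp (h.2 _ (by omega)))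

lemma pl_of_deg {n : ℕ} {z : S k} (h1 : 2 * z.re.natDegree ≤ n)
    (h2 : z.im = 0 ∨ 2 * z.im.natDegree + 7 ≤ n) : pl n z := by
  constructor
  · intro i hi; exact coeff_eq_zero_of_natDegree_lt (by omega)
  · intro i hi
    rcases h2 with h2 | h2
    · simp [h2]
    · exact coeff_eq_zero_of_natDegree_lt (by omega)

lemma pl_nm {n : ℕ} {z : S k} (h : pl n z) : (nm z).natDegree ≤ n := by
  obtain ⟨h1, h2⟩ := pl_deg h
  rw [nm_def]
  have a1 : (z.re ^ 2).natDegree ≤ n := natDegree_pow_le.trans h1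
  rcases h2 with h2 | h2
  · simpa [h2] using a1
  have a2 : (Rp k * z.re * z.im).natDegree ≤ n := by
    refine (natDegree_mul3_le _ _ _).trans ?_
    have := Rp_deg (k := k); omega
  have a3 : (hp k * z.im ^ 2).natDegree ≤ n := by
    refine natDegree_mul_le.trans ?_
    have := hp_deg (k := k)
    have := natDegree_pow_le (p := z.im) (n := 2); omega
  exact (natDegree_sub_le_of_le (natDegree_sub_le_of_le a1 a2) a3).trans (by simp)

lemma pl_mono {n m : ℕ} (hnm : n ≤ m) {z : S k} (h : pl n z) : pl m z :=
  ⟨fun i hi => h.1 i (by omega), fun i hi => h.2 i (by omega)⟩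

variable [IsDomain k]

lemma nm_pl {z : S k} (hz : z ≠ 0) : nm z ≠ 0 ∧ pl (nm z).natDegree z := by
  rw [nm_def]
  by_cases hi : z.im = 0
  · have hr : z.re ≠ 0 := fun h => hz (by ext1 <;> simp [h, hi])
    refine ⟨by simp [hi, hr], pl_of_deg ?_ (Or.inl hi)⟩
    simp [hi]
  have d3 : (hp k * z.im ^ 2).natDegree = 2 * z.im.natDegree + 7 := by
    rw [natDegree_mul hp_monic.ne_zero (pow_ne_zero _ hi), hp_natDegree]; simp; ring
  have n3 : hp k * z.im ^ 2 ≠ 0 := mul_ne_zero hp_monic.ne_zero (pow_ne_zero _ hi)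
  have d1 : (z.re ^ 2).natDegree = 2 * z.re.natDegree := by simp
  have d2 := (natDegree_mul3_le (Rp k) z.re z.im)
  have := Rp_deg (k := k)
  rcases lt_or_gt_of_ne (show 2 * z.re.natDegree ≠ 2 * z.im.natDegree + 7 by omega) with h | h
  · have e : (z.re ^ 2 - Rp k * z.re * z.im).natDegree < (hp k * z.im ^ 2).natDegree := by
      refine lt_of_le_of_lt (natDegree_sub_le _ _) ?_
      rw [max_lt_iff]; omega
    have e2 : (z.re ^ 2 - Rp k * z.re * z.im - hp k * z.im ^ 2).natDegree
        = 2 * z.im.natDegree + 7 := by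
      rw [natDegree_sub_eq_right_of_natDegree_lt e, d3]
    refine ⟨fun h0 => by rw [h0] at e2; simp at e2, pl_of_deg (by omega) (Or.inr (by omega))⟩
  · have e : (Rp k * z.re * z.im + hp k * z.im ^ 2).natDegree < (z.re ^ 2).natDegree := by
      refine lt_of_le_of_lt (natDegree_add_le _ _) ?_
      rw [max_lt_iff]; omega
    have e2 : (z.re ^ 2 - Rp k * z.re * z.im - hp k * z.im ^ 2).natDegree
        = 2 * z.re.natDegree := by
      rw [sub_sub, natDegree_sub_eq_left_of_natDegree_lt e, d1]
    refine ⟨fun h0 => by rw [h0] at e2; simp at e2; omega,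
      pl_of_deg (by omega) (Or.inr (by omega))⟩

lemma nm_eq_zero {z : S k} : nm z = 0 ↔ z = 0 :=
  ⟨fun h => by_contra fun hz => (nm_pl hz).1 h, fun h => by rw [h, nm_zero]⟩

instance : NoZeroDivisors (S k) where
  eq_zero_or_eq_zero_of_mul_eq_zero {a b} h := by
    have : nm a * nm b = 0 := by rw [← map_mul, h, nm_zero]
    simpa [nm_eq_zero] using this
instance : IsDomain (S k) := NoZeroDivisors.to_isDomain _

end degree

end N3
end

section
open Polynomial
namespace N3

section reg
variable (k : Type*) [CommRing k]

/-- derivative with respect to y -/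
noncomputable def g1 : S k := ⟨Rp k, 2⟩
/-- minus derivative with respect to x -/
noncomputable def g2 : S k := ⟨-derivative (hp k), derivative (Rp k)⟩

lemma C_three : (C 3 : k[X]) = 3 := rfl
lemma C_four : (C 4 : k[X]) = 4 := rfl
lemma C_two : (C 2 : k[X]) = 2 := rfl
lemma Rp_der : derivative (Rp k) = 3 * X ^ 2 + 2 * X - 2 := by
  simp [Rp, C_two]; ring
lemma hp_der : derivative (hp k) = X ^ 3 * (X - 1) ^ 2 * (7 * X - 4) := by
  simp [hp, derivative_pow, C_three, C_four]; ring

lemma certC : (cc (-5911) : S k) = ⟨-5911 - 11822 * X - 17733 * X ^ 2 - 78717 * X ^ 3 - 131461 * X ^ 4 + 737341 * X ^ 5 - 623567 * X ^ 6 + 125959 * X ^ 7,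
        -51442 - 103900 * X + 367066 * X ^ 2 - 379200 * X ^ 3 - 1013876 * X ^ 4 + 1283189 * X ^ 5 - 923650 * X ^ 6⟩ * g1 k +
      ⟨15246 + 34629 * X - 157119 * X ^ 2 + 103915 * X ^ 3 - 8921 * X ^ 4 - 327671 * X ^ 5 + 487804 * X ^ 6 - 263900 * X ^ 7,
        -4564 + 17005 * X + 122689 * X ^ 2 + 18850 * X ^ 3⟩ * g2 k := by
  ext1
  · simp only [cc_re, QuadraticAlgebra.re_add, QuadraticAlgebra.re_mul, g1, g2, Rp_der, hp_der]
    simp only [Rp, hp]; ring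
  · simp only [cc_im, QuadraticAlgebra.im_add, QuadraticAlgebra.im_mul, g1, g2, Rp_der, hp_der]
    simp only [Rp, hp]; ring

lemma certX : (cc (X - 4064) : S k) = ⟨-4064 - 8127 * X - 12190 * X ^ 2 - 54309 * X ^ 3 - 89823 * X ^ 4 + 506735 * X ^ 5 - 429236 * X ^ 6 + 86951 * X ^ 7,
        -35300 - 71322 * X + 252028 * X ^ 2 - 260978 * X ^ 3 - 696581 * X ^ 4 + 881758 * X ^ 5 - 634795 * X ^ 6⟩ * g1 k +
      ⟨10530 + 23746 * X - 108038 * X ^ 2 + 71527 * X ^ 3 - 6144 * X ^ 4 - 225116 * X ^ 5 + 335213 * X ^ 6 - 181370 * X ^ 7,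
        -3056 + 11814 * X + 84323 * X ^ 2 + 12955 * X ^ 3⟩ * g2 k := by
  ext1
  · simp only [cc_re, QuadraticAlgebra.re_add, QuadraticAlgebra.re_mul, g1, g2, Rp_der, hp_der]
    simp only [Rp, hp]; ring
  · simp only [cc_im, QuadraticAlgebra.im_add, QuadraticAlgebra.im_mul, g1, g2, Rp_der, hp_der]
    simp only [Rp, hp]; ring

variable {k}

lemma reg_aux (M : Ideal (S k)) [M.IsPrime] (A B z m : k[X]) (hA : cc A ∈ M) (hB : cc B ∈ M)
    (hz : (⟨z, m⟩ : S k) ∈ M) (hz' : star (⟨z, m⟩ : S k) ∈ M) (hn : nm (⟨z, m⟩ : S k) = A * B)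
    (hm : cc m ∉ M) : g1 k ∈ M ∧ g2 k ∈ M := by
  have e1 : cc m * g1 k ∈ M := by
    have : cc m * g1 k = (⟨z, m⟩ : S k) - star (⟨z, m⟩ : S k) := by
      ext1 <;> simp [g1] <;> ring
    rw [this]; exact M.sub_mem hz hz'
  have e1' : g1 k ∈ M := ((Ideal.IsPrime.mem_or_mem ‹_› e1).resolve_left hm)
  refine ⟨e1', ?_⟩
  have hd := congrArg derivative hn
  rw [nm_def] at hd
  simp only [derivative_mul, derivative_sub, derivative_pow] at hd
  have e2 : cc (m * m) * g2 k ∈ M := by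
    have key : cc (m * m) * g2 k = cc (derivative A) * cc B + cc (derivative B) * cc A
      - (⟨derivative z, derivative m⟩ : S k) * star (⟨z, m⟩ : S k)
      - (⟨derivative z - derivative m * Rp k - m * derivative (Rp k), -derivative m⟩ : S k)
        * (⟨z, m⟩ : S k) := by
      ext1
      · simp [g2]
        simp [C_two] at hd
        linear_combination hd
      · simp [g2]
        ring
    rw [key]
    refine M.sub_mem (M.sub_mem (M.add_mem ?_ ?_) ?_) ?_
    · exact M.mul_mem_left _ hB
    · exact M.mul_mem_left _ hA
    · exact M.mul_mem_left _ hz'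
    · exact M.mul_mem_left _ hz
  rcases Ideal.IsPrime.mem_or_mem ‹_› e2 with h | h
  · rw [map_mul] at h
    rcases Ideal.IsPrime.mem_or_mem ‹_› h with h | h <;> exact absurd h hm
  · exact h

lemma reg_C (M : Ideal (S k)) (h1 : g1 k ∈ M) (h2 : g2 k ∈ M) : (cc (-5911) : S k) ∈ M := by
  rw [certC]; exact M.add_mem (M.mul_mem_left _ h1) (M.mul_mem_left _ h2)
lemma reg_X (M : Ideal (S k)) (h1 : g1 k ∈ M) (h2 : g2 k ∈ M) : (cc (X - 4064) : S k) ∈ M := by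
  rw [certX]; exact M.add_mem (M.mul_mem_left _ h1) (M.mul_mem_left _ h2)
end reg
end N3
end

section
open Polynomial
namespace N3

section conj
variable {k l : Type*} [CommRing k] [CommRing l]

lemma sre (x : S k) : starRingEnd (S k) x = star x := rfl

/-- Conjugate ideal. -/
noncomputable def cj (I : Ideal (S k)) : Ideal (S k) := I.map (starRingEnd (S k))

lemma mem_cj {I : Ideal (S k)} {x : S k} : x ∈ cj I ↔ star x ∈ I := by
  constructor
  · intro h
    have : cj I ≤ I.comap (starRingEnd (S k)) := by
      refine Ideal.map_le_iff_le_comap.mpr ?_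
      intro y hy
      simpa [Ideal.mem_comap] using hy
    exact this h
  · intro h
    have := Ideal.mem_map_of_mem (starRingEnd (S k)) h
    simpa [cj, sre] using this

lemma cj_mul (I J : Ideal (S k)) : cj (I * J) = cj I * cj J := Ideal.map_mul _ _ _
lemma cj_pow (I : Ideal (S k)) (n : ℕ) : cj (I ^ n) = cj I ^ n := Ideal.map_pow _ _ _
lemma cj_cj (I : Ideal (S k)) : cj (cj I) = I := by
  ext x; simp [mem_cj]
lemma cj_sup (I J : Ideal (S k)) : cj (I ⊔ J) = cj I ⊔ cj J := Ideal.map_sup _ _ _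
lemma cj_span (a : S k) : cj (Ideal.span {a}) = Ideal.span {star a} := by
  simp [cj, Ideal.map_span, sre]
lemma cj_map (φ : k →+* l) (I : Ideal (S k)) : cj (I.map (mp φ)) = (cj I).map (mp φ) := by
  unfold cj
  rw [Ideal.map_map, Ideal.map_map]
  congr 1
  ext1 x
  simp [mp_st, sre]

/-- `I` has norm `U`. -/
def HasN (I : Ideal (S k)) (U : k[X]) : Prop := I * cj I = Ideal.span {cc U}

lemma HasN.mul {I J : Ideal (S k)} {U V : k[X]} (h1 : HasN I U) (h2 : HasN J V) :
    HasN (I * J) (U * V) := by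
  unfold HasN at *
  rw [cj_mul, mul_mul_mul_comm, h1, h2, Ideal.span_singleton_mul_span_singleton, map_mul]

lemma HasN.cj {I : Ideal (S k)} {U : k[X]} (h1 : HasN I U) : HasN (N3.cj I) U := by
  unfold HasN at *
  rw [cj_cj, mul_comm, h1]

lemma HasN.map {I : Ideal (S k)} {U : k[X]} (h1 : HasN I U) (φ : k →+* l) :
    HasN (I.map (mp φ)) (U.map φ) := by
  unfold HasN at *
  rw [cj_map, ← Ideal.map_mul, h1, Ideal.map_span]; simp [mp_cc]

lemma hasN_span (a : S k) : HasN (Ideal.span {a}) (nm a) := by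
  unfold HasN
  rw [cj_span, Ideal.span_singleton_mul_span_singleton, mul_st]

lemma hasN_one : HasN (1 : Ideal (S k)) 1 := by
  have := hasN_span (1 : S k)
  simpa [Ideal.one_eq_top] using this

lemma HasN.mul_dvd {I : Ideal (S k)} {U : k[X]} (h : HasN I U) {a b : S k} (ha : a ∈ I)
    (hb : b ∈ N3.cj I) : cc U ∣ a * b := by
  rw [← Ideal.mem_span_singleton, ← h]; exact Ideal.mul_mem_mul ha hb

lemma HasN.nm_dvd {I : Ideal (S k)} {U : k[X]} (h : HasN I U) {a : S k} (ha : a ∈ I) :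
    U ∣ nm a := by
  have := h.mul_dvd ha (b := star a) (by simpa [mem_cj] using ha)
  rw [mul_st, cc_dvd] at this
  exact this.1

lemma HasN.cc_mem {I : Ideal (S k)} {U : k[X]} (h : HasN I U) : cc U ∈ I :=
  Ideal.mul_le_left (I := I) (J := N3.cj I) (by rw [h]; exact Ideal.mem_span_singleton_self _)

variable [IsDomain k]

/-- cancellation -/
lemma HasN.cancel {I J K : Ideal (S k)} {U : k[X]} (h : HasN I U) (hU : U ≠ 0)
    (e : I * J = I * K) : J = K := by
  have e2 : Ideal.span {cc U} * J = Ideal.span {cc U} * K := by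
    rw [← h, mul_comm I, mul_assoc, e, ← mul_assoc]
  have hc : (cc U : S k) ≠ 0 := by
    intro h0; apply hU; simpa using congrArg QuadraticAlgebra.re h0
  exact (Ideal.span_singleton_mul_right_inj hc).mp e2

/-- membership test -/
lemma HasN.mem_iff {I : Ideal (S k)} {U : k[X]} (h : HasN I U) (hU : U ≠ 0) {x : S k} :
    x ∈ I ↔ ∀ b ∈ N3.cj I, cc U ∣ x * b := by
  have hc : (cc U : S k) ≠ 0 := by
    intro h0; apply hU; simpa using congrArg QuadraticAlgebra.re h0
  refine ⟨fun hx b hb => h.mul_dvd hx hb, fun H => ?_⟩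
  have : Ideal.span {x} * N3.cj I ≤ Ideal.span {cc U} := by
    rw [Ideal.span_singleton_mul_le_iff]
    intro b hb; exact Ideal.mem_span_singleton.mpr (H b hb)
  have h2 : Ideal.span {cc U} * Ideal.span {x} ≤ Ideal.span {cc U} * I := by
    calc Ideal.span {cc U} * Ideal.span {x} = I * (Ideal.span {x} * N3.cj I) := by
          rw [← h]; ring
      _ ≤ I * Ideal.span {cc U} := Ideal.mul_mono_right this
      _ = _ := mul_comm _ _
  rw [Ideal.span_singleton_mul_right_mono hc] at h2
  exact h2 (Ideal.mem_span_singleton_self x)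

end conj

section field
variable {k : Type*} [Field k]

lemma structure_thm (I : Ideal (S k)) (hI : I ≠ ⊥) : ∃ z u v : k[X], z ≠ 0 ∧ u ≠ 0 ∧
    u ∣ nm (⟨-v, 1⟩ : S k) ∧ ∀ x : S k, x ∈ I ↔ z ∣ x.im ∧ z * u ∣ x.re + v * x.im := by
  obtain ⟨x0, hx0, hx0n⟩ := Submodule.exists_mem_ne_zero_of_ne_bot hI
  let J : Ideal k[X] := (I.restrictScalars k[X]).map (QuadraticAlgebra.imₗ (hp k) (-(Rp k)))
  have hJ : ∀ p, p ∈ J ↔ ∃ x ∈ I, x.im = p := by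
    intro p; simp [J]
  obtain ⟨z, hz⟩ := (IsPrincipalIdealRing.principal J).principal
  have hz' : ∀ p, p ∈ J ↔ z ∣ p := by
    intro p; rw [hz]; exact Ideal.mem_span_singleton
  obtain ⟨h0, hh0, hh0z⟩ := (hJ z).mp ((hz' z).mpr dvd_rfl)
  let J2 : Ideal k[X] := I.comap cc
  obtain ⟨t, ht⟩ := (IsPrincipalIdealRing.principal J2).principal
  have ht' : ∀ p, cc p ∈ I ↔ t ∣ p := by
    intro p
    rw [← Ideal.mem_span_singleton]
    exact (show cc p ∈ I ↔ p ∈ J2 from Iff.rfl).trans (by rw [ht])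
  let y : S k := ⟨0, 1⟩
  have hy : ∀ x ∈ I, z ∣ x.re - Rp k * x.im := by
    intro x hx
    rw [← hz', hJ]
    refine ⟨y * x, I.mul_mem_left _ hx, ?_⟩
    simp [y]; ring
  have him : ∀ x ∈ I, z ∣ x.im := fun x hx => (hz' _).mp ((hJ _).mpr ⟨x, hx, rfl⟩)
  have hre : ∀ x ∈ I, z ∣ x.re := by
    intro x hx
    have := dvd_add (hy x hx) ((him x hx).mul_left (Rp k))
    simpa using this
  obtain ⟨v', hv'⟩ := hre h0 hh0
  obtain ⟨u, hu⟩ := hre (cc t) ((ht' t).mpr dvd_rfl)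
  simp at hu
  have hz0 : z ≠ 0 := by
    rintro rfl
    apply hx0n
    ext1
    · simpa using hre x0 hx0
    · simpa using him x0 hx0
  have ht0 : t ≠ 0 := by
    rintro rfl
    have : cc (nm x0) ∈ I := by rw [← mul_st]; exact I.mul_mem_right _ hx0
    rw [ht'] at this
    exact (nm_pl hx0n).1 (by simpa using this)
  have hu0 : u ≠ 0 := by rintro rfl; simp at hu; exact ht0 hu
  have hh : h0 = cc z * ⟨v', 1⟩ := by
    ext1
    · simp [hv']
    · simp [hh0z]
  refine ⟨z, u, -v', hz0, hu0, ?_, ?_⟩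
  · rw [neg_neg]
    have : cc (z * nm (⟨v', 1⟩ : S k)) ∈ I := by
      rw [map_mul, ← mul_st, ← mul_assoc, ← hh]; exact I.mul_mem_right _ hh0
    rw [ht', hu] at this
    exact (mul_dvd_mul_iff_left hz0).mp this
  · intro x
    rw [← hu]
    have key : ∀ q, x.im = z * q → (x ∈ I ↔ t ∣ x.re + -v' * x.im) := by
      intro q hq
      rw [← ht']
      have : cc (x.re + -v' * x.im) = x - h0 * cc q := by
        ext1
        · simp [hv', hq, hh0z]; ring
        · simp [hq, hh0z]
      rw [this]
      exact ⟨fun h => I.sub_mem h (I.mul_mem_right _ hh0),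
        fun h => (I.sub_mem_iff_left (I.mul_mem_right _ hh0)).mp h⟩
    constructor
    · intro hx
      obtain ⟨q, hq⟩ := him x hx
      exact ⟨⟨q, hq⟩, (key q hq).mp hx⟩
    · rintro ⟨⟨q, hq⟩, h⟩
      exact (key q hq).mpr h

/-- every element is a combination -/
lemma structure_comb {I : Ideal (S k)} {z u v : k[X]}
    (h : ∀ x : S k, x ∈ I ↔ z ∣ x.im ∧ z * u ∣ x.re + v * x.im) :
    cc (z * u) ∈ I ∧ cc z * ⟨-v, 1⟩ ∈ I ∧
    ∀ x ∈ I, ∃ a b : k[X], x = cc a * cc (z * u) + cc b * (cc z * ⟨-v, 1⟩) := by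
  refine ⟨by rw [h]; simp, by rw [h]; simp [mul_comm], fun x hx => ?_⟩
  obtain ⟨⟨q, hq⟩, ⟨a, ha⟩⟩ := (h x).mp hx
  refine ⟨a, q, ?_⟩
  ext1
  · simp; linear_combination ha - v * hq
  · simp [hq]; ring

lemma structure_hasN (h59 : (5911 : k) ≠ 0) {I : Ideal (S k)} {z u v : k[X]}
    (hd : u ∣ nm (⟨-v, 1⟩ : S k))
    (h : ∀ x : S k, x ∈ I ↔ z ∣ x.im ∧ z * u ∣ x.re + v * x.im) : HasN I (z ^ 2 * u) := by
  obtain ⟨h1, h2, h3⟩ := structure_comb h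
  obtain ⟨w, hw⟩ := hd
  have hIs : I = Ideal.span {cc (z * u), cc z * ⟨-v, 1⟩} := by
    apply le_antisymm
    · intro x hx
      obtain ⟨a, b, rfl⟩ := h3 x hx
      exact Ideal.mem_span_pair.mpr ⟨cc a, cc b, rfl⟩
    · rw [Ideal.span_le]
      rintro x (rfl | rfl)
      · exact h1
      · exact h2
  set τ : S k := ⟨-v, 1⟩ with hτ
  have hIm : I = Ideal.span {cc z} * Ideal.span {cc u, τ} := by
    rw [hIs, Ideal.span_mul_span']; congr 1; ext x; simp [eq_comm]
  set N : Ideal (S k) := Ideal.span {cc u, τ, star τ, cc w}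
  have hT : Ideal.span {cc u, τ} * Ideal.span {cc u, star τ} = Ideal.span {cc u} * N := by
    have hm : τ * star τ = cc u * cc w := by rw [mul_st, hw, map_mul]
    rw [Ideal.span_mul_span', Ideal.span_mul_span']
    apply le_antisymm
    · rw [Ideal.span_le]
      rintro x ⟨a, (rfl | rfl), b, (rfl | rfl), rfl⟩
      · exact Ideal.subset_span ⟨_, rfl, cc u, by simp, rfl⟩
      · exact Ideal.subset_span ⟨_, rfl, star τ, by simp, rfl⟩
      · exact Ideal.subset_span ⟨_, rfl, τ, by simp, mul_comm _ _⟩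
      · exact Ideal.subset_span ⟨_, rfl, cc w, by simp, hm.symm⟩
    · rw [Ideal.span_le]
      rintro x ⟨a, rfl, b, (rfl | rfl | rfl | rfl), rfl⟩
      · exact Ideal.subset_span ⟨cc u, by simp, cc u, by simp, rfl⟩
      · exact Ideal.subset_span ⟨τ, by simp, cc u, by simp, mul_comm _ _⟩
      · exact Ideal.subset_span ⟨cc u, by simp, star τ, by simp, rfl⟩
      · exact Ideal.subset_span ⟨τ, by simp, star τ, by simp, hm⟩
  have hN : N = ⊤ := by
    by_contra hne
    obtain ⟨M, hM, hNM⟩ := Ideal.exists_le_maximal N hne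
    have := hM.isPrime
    have hmem : ∀ x ∈ ({cc u, τ, star τ, cc w} : Set (S k)), x ∈ M :=
      fun x hx => hNM (Ideal.subset_span hx)
    obtain ⟨r1, r2⟩ := reg_aux M u w (-v) 1 (hmem _ (by simp)) (hmem _ (by simp))
      (hmem _ (by simp [hτ])) (hmem _ (by simp [hτ])) hw (by
        rw [map_one]; exact fun h => hM.ne_top ((Ideal.eq_top_iff_one _).mpr h))
    have r3 := reg_C M r1 r2
    apply hM.ne_top
    refine Ideal.eq_top_of_isUnit_mem _ r3 ?_
    refine IsUnit.map cc ?_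
    have : (-5911 : k[X]) = C (-5911 : k) := by simp; rfl
    rw [this]
    exact isUnit_C.mpr (isUnit_iff_ne_zero.mpr (by simpa using h59))
  have hcj : cj (Ideal.span {cc u, τ}) = Ideal.span {cc u, star τ} := by
    unfold cj; rw [Ideal.map_span]; congr 1
    ext x; simp [st_cc, Set.image_pair, sre]
  unfold HasN
  rw [hIm, cj_mul, cj_span, st_cc, hcj, mul_mul_mul_comm, hT, hN, Ideal.mul_top,
    Ideal.span_singleton_mul_span_singleton, Ideal.span_singleton_mul_span_singleton]
  simp [pow_two]

end field
end N3
end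

section
open Polynomial
namespace N3

/-- inclusion in the rational ring -/
noncomputable abbrev iQ : S ℤ →+* S ℚ := mp (Int.castRingHom ℚ)
/-- reduction -/
noncomputable abbrev iP (p : ℕ) : S ℤ →+* S (ZMod p) := mp (Int.castRingHom (ZMod p))

lemma iQ_inj : Function.Injective iQ := mp_inj _ (RingHom.injective_int _)
lemma iP_surj (p : ℕ) : Function.Surjective (iP p) := mp_surj _ (ZMod.intCast_surjective)

lemma poly_clear (x : ℚ[X]) : ∃ n : ℤ, n ≠ 0 ∧ ∃ w : ℤ[X], w.map (Int.castRingHom ℚ) = (n : ℚ[X]) * x := by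
  obtain ⟨b, hbM, hb⟩ := IsLocalization.integerNormalization_spec (nonZeroDivisors ℤ) x
  refine ⟨b, nonZeroDivisors.ne_zero hbM, _, hb.trans ?_⟩
  rw [zsmul_eq_mul]

lemma S_clear (x : S ℚ) : ∃ n : ℤ, n ≠ 0 ∧ ∃ w : S ℤ, iQ w = (n : S ℚ) * x := by
  obtain ⟨n, hn, w, hw⟩ := poly_clear x.re
  obtain ⟨m, hm, v, hv⟩ := poly_clear x.im
  refine ⟨n * m, mul_ne_zero hn hm, ⟨m * w, n * v⟩, ?_⟩
  ext1
  · simp [hw]; ring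
  · simp [hv]; ring

lemma map_mem_clear {J : Ideal (S ℤ)} {x : S ℚ} (hx : x ∈ J.map iQ) :
    ∃ n : ℤ, n ≠ 0 ∧ ∃ w ∈ J, iQ w = (n : S ℚ) * x := by
  refine Submodule.span_induction (p := fun x _ => ∃ n : ℤ, n ≠ 0 ∧ ∃ w ∈ J, iQ w = (n : S ℚ) * x)
    ?_ ?_ ?_ ?_ hx
  · rintro _ ⟨w, hw, rfl⟩; exact ⟨1, one_ne_zero, w, hw, by simp⟩
  · exact ⟨1, one_ne_zero, 0, J.zero_mem, by simp⟩
  · rintro x y _ _ ⟨n, hn, w, hw, e⟩ ⟨m, hm, v, hv, e'⟩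
    refine ⟨n * m, mul_ne_zero hn hm, m * w + n * v,
      J.add_mem (J.mul_mem_left _ hw) (J.mul_mem_left _ hv), ?_⟩
    rw [map_add, map_mul, map_mul, e, e']; simp; ring
  · rintro a x _ ⟨n, hn, w, hw, e⟩
    obtain ⟨m, hm, v, e'⟩ := S_clear a
    refine ⟨m * n, mul_ne_zero hm hn, v * w, J.mul_mem_left _ hw, ?_⟩
    rw [map_mul, e, e']; simp; ring

lemma poly_ker (p : ℕ) (w : ℤ[X]) : w.map (Int.castRingHom (ZMod p)) = 0 ↔ (p : ℤ[X]) ∣ w := by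
  have : (p : ℤ[X]) = C (p : ℤ) := by simp
  rw [this, C_dvd_iff_dvd_coeff, Polynomial.ext_iff]
  refine forall_congr' fun i => ?_
  simp [ZMod.intCast_zmod_eq_zero_iff_dvd]

lemma nat_cc {k : Type*} [CommRing k] (p : ℕ) : (p : S k) = cc (p : k[X]) := by simp
lemma int_cc {k : Type*} [CommRing k] (p : ℤ) : (p : S k) = cc (p : k[X]) := by simp

lemma iP_ker (p : ℕ) (w : S ℤ) : iP p w = 0 ↔ (p : S ℤ) ∣ w := by
  rw [nat_cc, cc_dvd, ← poly_ker, ← poly_ker]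
  constructor
  · intro h; exact ⟨congrArg QuadraticAlgebra.re h, congrArg QuadraticAlgebra.im h⟩
  · rintro ⟨h1, h2⟩; ext1 <;> assumption

/-- primitive element -/
def Prim (w : S ℤ) : Prop := ∀ p : ℕ, p.Prime → iP p w ≠ 0

lemma exists_prim {w : S ℤ} (hw : w ≠ 0) : ∃ d : ℤ, d ≠ 0 ∧ ∃ w' : S ℤ, w = d * w' ∧ Prim w' := by
  set d := gcd w.re.content w.im.content with hd
  have hd0 : d ≠ 0 := by
    intro h
    rw [hd, gcd_eq_zero_iff, content_eq_zero_iff, content_eq_zero_iff] at h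
    exact hw (by ext1 <;> simp [h.1, h.2])
  have hdv : cc (C d) ∣ w := by
    rw [cc_dvd]
    exact ⟨(C_dvd_iff_dvd_coeff _ _).mpr fun i => (gcd_dvd_left _ _).trans (content_dvd_coeff _),
      (C_dvd_iff_dvd_coeff _ _).mpr fun i => (gcd_dvd_right _ _).trans (content_dvd_coeff _)⟩
  obtain ⟨w', hw'⟩ := hdv
  refine ⟨d, hd0, w', by rw [hw', int_cc]; simp, ?_⟩
  intro p hp h0
  rw [iP_ker] at h0
  obtain ⟨w'', rfl⟩ := h0
  have e : w = cc (C (d * p)) * w'' := by rw [hw', nat_cc, ← mul_assoc, ← map_mul]; simp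
  have h1 : d * p ∣ d := by
    refine dvd_gcd ?_ ?_
    · rw [dvd_content_iff_C_dvd, e]; simp
    · rw [dvd_content_iff_C_dvd, e]; simp
  have : (p : ℤ) ∣ 1 := by
    have h2 : d * p ∣ d * 1 := by simpa using h1
    exact (mul_dvd_mul_iff_left hd0).mp h2
  have := Int.natCast_dvd_natCast.mp (by simpa using this : (p : ℤ) ∣ ((1 : ℕ) : ℤ))
  exact hp.one_lt.ne' (Nat.dvd_one.mp this)

lemma exists_primPoly {q : ℚ[X]} (hq : q ≠ 0) : ∃ U : ℤ[X], U.IsPrimitive ∧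
    Associated (U.map (Int.castRingHom ℚ)) q := by
  obtain ⟨n, hn, w, hw⟩ := poly_clear q
  have hw0 : w ≠ 0 := by
    rintro rfl
    simp at hw
    rcases hw with h | h
    · exact hn (by exact_mod_cast h)
    · exact hq h
  refine ⟨w.primPart, isPrimitive_primPart w, ?_⟩
  have u1 : IsUnit ((C (n : ℚ)) : ℚ[X]) := isUnit_C.mpr (isUnit_iff_ne_zero.mpr (by exact_mod_cast hn))
  have u2 : IsUnit ((C (w.content : ℚ)) : ℚ[X]) := isUnit_C.mpr (isUnit_iff_ne_zero.mpr (by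
    exact_mod_cast (content_eq_zero_iff.not.mpr hw0)))
  have e : C (w.content : ℚ) * (w.primPart).map (Int.castRingHom ℚ) = C (n : ℚ) * q := by
    conv_lhs => rw [show (C (w.content : ℚ)) = (C w.content).map (Int.castRingHom ℚ) by simp,
      ← Polynomial.map_mul, ← eq_C_content_mul_primPart, hw]
    simp
  have a1 : Associated (C (w.content : ℚ) * (w.primPart).map (Int.castRingHom ℚ)) ((w.primPart).map (Int.castRingHom ℚ)) :=
    (associated_unit_mul_left _ _ u2)
  have a2 : Associated (C (n : ℚ) * q) q := (associated_unit_mul_left _ _ u1)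
  rw [e] at a1
  exact a1.symm.trans a2

lemma prim_dvd {U : ℤ[X]} (hU : U.IsPrimitive) {w : S ℤ}
    (h : cc (U.map (Int.castRingHom ℚ)) ∣ iQ w) : cc U ∣ w := by
  rw [cc_dvd] at *
  exact ⟨(IsPrimitive.Int.dvd_iff_map_cast_dvd_map_cast _ _ hU).mpr h.1,
    (IsPrimitive.Int.dvd_iff_map_cast_dvd_map_cast _ _ hU).mpr h.2⟩

/-- saturated -/
def Sat (I : Ideal (S ℤ)) : Prop := ∀ n : ℤ, n ≠ 0 → ∀ x : S ℤ, (n : S ℤ) * x ∈ I → x ∈ I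

lemma sat_comap (Q : Ideal (S ℚ)) : Sat (Q.comap iQ) := by
  intro n hn x hx
  rw [Ideal.mem_comap] at *
  have u : IsUnit (n : S ℚ) := by
    rw [int_cc]
    refine IsUnit.map cc ?_
    have : (n : ℚ[X]) = C (n : ℚ) := by simp
    rw [this]
    exact isUnit_C.mpr (isUnit_iff_ne_zero.mpr (by exact_mod_cast hn))
  rw [map_mul, map_intCast] at hx
  exact (Ideal.unit_mul_mem_iff_mem Q u).mp hx

end N3
end

section
open Polynomial
namespace N3

lemma cc_mul_im {k : Type*} [CommRing k] (a : k[X]) (z : S k) : (cc a * z).im = a * z.im := by simp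
lemma cc_mul_re {k : Type*} [CommRing k] (a : k[X]) (z : S k) : (cc a * z).re = a * z.re := by simp
lemma cc_dvd_cc {k : Type*} [CommRing k] (a b : k[X]) : (cc a : S k) ∣ cc b ↔ a ∣ b := by
  rw [cc_dvd]; simp

lemma map_comap_iQ (Q : Ideal (S ℚ)) : (Q.comap iQ).map iQ = Q := by
  apply le_antisymm Ideal.map_comap_le
  intro x hx
  obtain ⟨n, hn, w, hw⟩ := S_clear x
  have u : IsUnit (n : S ℚ) := by
    rw [int_cc]
    refine IsUnit.map cc ?_
    have : (n : ℚ[X]) = C (n : ℚ) := by simp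
    rw [this]
    exact isUnit_C.mpr (isUnit_iff_ne_zero.mpr (by exact_mod_cast hn))
  have : iQ w ∈ (Q.comap iQ).map iQ :=
    Ideal.mem_map_of_mem _ (by rw [Ideal.mem_comap, hw]; exact Q.mul_mem_left _ hx)
  rw [hw] at this
  exact (Ideal.unit_mul_mem_iff_mem _ u).mp this

lemma hasN_assoc {k : Type*} [CommRing k] [IsDomain k] {I : Ideal (S k)} {U V : k[X]} (h : HasN I U)
    (ha : Associated U V) : HasN I V := by
  unfold HasN at *
  rw [h]
  exact Ideal.span_singleton_eq_span_singleton.mpr (ha.map cc)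

/-- Every rational ideal has a norm. -/
lemma hasN_rat (Q : Ideal (S ℚ)) (hQ : Q ≠ ⊥) : ∃ U : ℤ[X], U.IsPrimitive ∧
    HasN Q (U.map (Int.castRingHom ℚ)) := by
  obtain ⟨z, u, v, hz, hu, hd, h⟩ := structure_thm Q hQ
  have hN := structure_hasN (by norm_num) hd h
  obtain ⟨U, hU, ha⟩ := exists_primPoly (mul_ne_zero (pow_ne_zero 2 hz) hu)
  exact ⟨U, hU, hasN_assoc hN ha.symm⟩

lemma eval_mem (M : Ideal (S ℤ)) (r : ℤ) (hr : (cc (X - C r) : S ℤ) ∈ M) (P : ℤ[X])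
    (hP : cc P ∈ M) : ((P.eval r : ℤ) : S ℤ) ∈ M := by
  obtain ⟨q, hq⟩ := X_sub_C_dvd_sub_C_eval (a := r) (p := P)
  have : ((P.eval r : ℤ) : S ℤ) = cc P - cc (X - C r) * cc q := by
    rw [← map_mul, ← hq, int_cc, map_sub]; simp
  rw [this]
  exact M.sub_mem hP (M.mul_mem_right _ hr)

lemma int_mem (M : Ideal (S ℤ)) (hM : M ≠ ⊤) (p : ℕ) (hp : p.Prime) (hpM : (p : S ℤ) ∈ M) (a : ℤ)
    (ha : (a : S ℤ) ∈ M) : (p : ℤ) ∣ a := by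
  by_contra hc
  have : IsCoprime (p : ℤ) a := (Prime.coprime_iff_not_dvd (Nat.prime_iff_prime_int.mp hp)).mpr hc
  obtain ⟨x, y, hxy⟩ := this
  apply hM
  rw [Ideal.eq_top_iff_one]
  have e : (1 : S ℤ) = (x : S ℤ) * (p : S ℤ) + (y : S ℤ) * (a : S ℤ) := by
    exact_mod_cast congrArg (Int.cast : ℤ → S ℤ) hxy.symm
  rw [e]
  exact M.add_mem (M.mul_mem_left _ hpM) (M.mul_mem_left _ ha)

/-- The regularity statement over the integers. -/
lemma reg_int (M : Ideal (S ℤ)) [hMm : M.IsMaximal] (p : ℕ) (hp : p.Prime) (hpM : (p : S ℤ) ∈ M)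
    (A B z m : ℤ[X]) (hA : cc A ∈ M) (hB : cc B ∈ M)
    (hz : (⟨z, m⟩ : S ℤ) ∈ M) (hz' : star (⟨z, m⟩ : S ℤ) ∈ M) (hn : nm (⟨z, m⟩ : S ℤ) = A * B) :
    cc m ∈ M := by
  by_contra hm
  have hMp := hMm.isPrime
  obtain ⟨r1, r2⟩ := reg_aux M A B z m hA hB hz hz' hn hm
  have h59 := reg_C M r1 r2
  have hX := reg_X M r1 r2
  have hX' : (cc (X - C 4064) : S ℤ) ∈ M := hX
  have hpd : (p : ℤ) ∣ 5911 := by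
    refine int_mem M hMm.ne_top p hp hpM _ ?_
    have : (((5911 : ℤ)) : S ℤ) = - cc (-5911) := by rw [int_cc, ← map_neg]; simp
    rw [this]; exact M.neg_mem h59
  have hI : ∀ P : ℤ[X], cc P ∈ M → (p : ℤ) ∣ P.eval 4064 := fun P hP =>
    int_mem M hMm.ne_top p hp hpM _ (eval_mem M _ hX' P hP)
  have hmr : ¬ (p : ℤ) ∣ m.eval 4064 := by
    rintro ⟨t, ht⟩
    apply hm
    obtain ⟨q, hq⟩ := X_sub_C_dvd_sub_C_eval (a := (4064 : ℤ)) (p := m)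
    have : cc m = cc (X - C 4064) * cc q + (p : S ℤ) * (t : S ℤ) := by
      rw [← map_mul, ← hq, nat_cc, int_cc, ← map_mul, ← map_add, ht]; simp
    rw [this]
    exact M.add_mem (M.mul_mem_right _ hX') (M.mul_mem_right _ hpM)
  have h2 : cc (2 * z - m * Rp ℤ) ∈ M := by
    have : cc (2 * z - m * Rp ℤ) = cc 2 * (⟨z, m⟩ : S ℤ) - cc m * g1 ℤ := by
      ext1 <;> simp [g1]; ring
    rw [this]
    exact M.sub_mem (M.mul_mem_left _ hz) (M.mul_mem_left _ r1)
  have e : 4 * (A * B) = (2 * z - m * Rp ℤ) ^ 2 - m ^ 2 * (Rp ℤ ^ 2 + 4 * N3.hp ℤ) := by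
    rw [← hn, nm_def]; ring
  have e' := congrArg (Polynomial.eval 4064) e
  obtain ⟨a, ha⟩ := hI A hA
  obtain ⟨b, hb⟩ := hI B hB
  obtain ⟨c, hc⟩ := hI _ h2
  have hf : (Rp ℤ ^ 2 + 4 * N3.hp ℤ).eval 4064 =  (4064^3+4064^2-2*4064+1)^2+4*(4064^4*(4064-1)^3) := by
    simp [Rp, N3.hp]
  rw [eval_sub, eval_pow, hc, eval_mul (p := m ^ 2), hf, eval_mul, eval_mul, ha, hb, eval_pow] at e'
  have e4 : (4 : ℤ[X]).eval 4064 = 4 := by simp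
  rw [e4] at e'
  have d1 : (p : ℤ) ^ 2 ∣ (m.eval 4064) ^ 2 * ((4064^3+4064^2-2*4064+1)^2+4*(4064^4*(4064-1)^3)) :=
    ⟨c ^ 2 - 4 * (a * b), by linear_combination e'⟩
  have d2 : IsCoprime ((p : ℤ) ^ 2) ((m.eval 4064) ^ 2) :=
    ((Prime.coprime_iff_not_dvd (Nat.prime_iff_prime_int.mp hp)).mpr hmr).pow
  have d3 := d2.dvd_of_dvd_mul_left d1
  have hpn : p ∣ 5911 := by exact_mod_cast hpd
  have hp' : p = 23 ∨ p = 257 := by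
    have h : p ∣ 23 * 257 := hpn
    rcases (Nat.Prime.dvd_mul hp).mp h with h | h
    · left; exact (Nat.prime_dvd_prime_iff_eq hp (by norm_num)).mp h
    · right; exact (Nat.prime_dvd_prime_iff_eq hp (by norm_num)).mp h
  rcases hp' with rfl | rfl
  · norm_num at d3
  · norm_num at d3

lemma key_expand {I : Ideal (S ℤ)} {p : ℕ} {g h : S ℤ}
    (H : ∀ x ∈ I, ∃ a b : ℤ[X], ∃ x' ∈ I, x = cc a * g + cc b * h + (p : S ℤ) * x') (j : ℕ) :
    ∀ x ∈ I, ∃ a b : ℤ[X], ∃ x' ∈ I, x = cc a * g + cc b * h + (p : S ℤ) ^ j * x' := by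
  induction j with
  | zero => intro x hx; exact ⟨0, 0, x, hx, by simp⟩
  | succ j ih =>
    intro x hx
    obtain ⟨a, b, x', hx', e⟩ := ih x hx
    obtain ⟨a', b', x'', hx'', e'⟩ := H x' hx'
    refine ⟨a + (p : ℤ[X]) ^ j * a', b + (p : ℤ[X]) ^ j * b', x'', hx'', ?_⟩
    rw [e, e', nat_cc]; simp only [map_add, map_mul, map_pow]; ring

lemma prime_poly {p : ℕ} (hp : p.Prime) : Prime (p : ℤ[X]) := by
  have : (p : ℤ[X]) = C (p : ℤ) := by simp
  rw [this, prime_C_iff]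
  exact Nat.prime_iff_prime_int.mp hp

/-- The closure of a rational ideal is invertible. -/
theorem closure_hasN (Q : Ideal (S ℚ)) (hQ : Q ≠ ⊥) : ∃ U : ℤ[X], U.IsPrimitive ∧
    HasN (Q.comap iQ) U := by
  obtain ⟨U, hU, hN⟩ := hasN_rat Q hQ
  refine ⟨U, hU, ?_⟩
  set I := Q.comap iQ with hI
  have hU0 : U ≠ 0 := hU.ne_zero
  have hcU : (cc U : S ℤ) ≠ 0 := fun h0 => hU0 (by simpa using congrArg QuadraticAlgebra.re h0)
  have hmap : I.map iQ = Q := map_comap_iQ Q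
  have hdv : ∀ g ∈ I, ∀ h ∈ I, cc U ∣ g * star h := by
    intro g hg h hh
    apply prim_dvd hU
    rw [map_mul, mp_st]
    exact hN.mul_dvd hg (by rw [mem_cj, star_star]; exact hh)
  have hsat := sat_comap Q
  -- the ideal of quotients
  let N : Ideal (S ℤ) := Submodule.comap (LinearMap.mulLeft (S ℤ) (cc U)) (I * cj I)
  have hNm : ∀ q, q ∈ N ↔ cc U * q ∈ I * cj I := fun q => Iff.rfl
  have hst : ∀ g ∈ I, star g ∈ cj I := fun g hg => by rw [mem_cj, star_star]; exact hg
  have hle : I * cj I ≤ Ideal.span {cc U} := by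
    rw [Ideal.mul_le]
    intro g hg h hh
    rw [Ideal.mem_span_singleton]
    have := hdv g hg (star h) (mem_cj.mp hh)
    rwa [star_star] at this
  suffices hNt : N = ⊤ by
    refine le_antisymm hle ?_
    rw [Ideal.span_singleton_le_iff_mem]
    have := (hNm 1).mp (by rw [hNt]; trivial)
    simpa using this
  by_contra hne
  obtain ⟨M, hM, hNM⟩ := Ideal.exists_le_maximal N hne
  have hMp := hM.isPrime
  -- a nonzero integer in N
  obtain ⟨n0, hn0, hn0N⟩ : ∃ n : ℤ, n ≠ 0 ∧ (n : S ℤ) ∈ N := by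
    have : iQ (cc U) ∈ (I * cj I).map iQ := by
      rw [Ideal.map_mul, ← cj_map, hmap, hN, mp_cc]; exact Ideal.mem_span_singleton_self _
    obtain ⟨n, hn, w, hw, e⟩ := map_mem_clear this
    refine ⟨n, hn, ?_⟩
    rw [hNm]
    have e2 : w = cc U * n := iQ_inj (by rw [e, map_mul, map_intCast]; ring)
    rw [← e2]; exact hw
  obtain ⟨p, hp, hpM⟩ : ∃ p : ℕ, p.Prime ∧ (p : S ℤ) ∈ M := by
    have hnat : ((n0.natAbs : ℕ) : S ℤ) ∈ M := by
      have h1 := hNM hn0N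
      rw [← Int.cast_natCast]
      rcases Int.natAbs_eq n0 with h | h
      · rwa [h] at h1
      · rw [h, Int.cast_neg] at h1; exact neg_mem_iff.mp h1
    have gen : ∀ n : ℕ, n ≠ 0 → (n : S ℤ) ∈ M → ∃ p : ℕ, p.Prime ∧ (p : S ℤ) ∈ M := by
      intro n
      induction n using Nat.recOnMul with
      | zero => intro h; exact absurd rfl h
      | one => intro _ h; exact absurd ((Ideal.eq_top_iff_one _).mpr (by simpa using h)) hM.ne_top
      | prime p hp => intro _ h; exact ⟨p, hp, h⟩
      | mul a b iha ihb =>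
        intro h0 h
        push_cast at h
        rcases hMp.mem_or_mem h with h | h
        · exact iha (by rintro rfl; simp at h0) h
        · exact ihb (by rintro rfl; simp at h0) h
    exact gen _ (by simpa using hn0) hnat
  have : Fact p.Prime := ⟨hp⟩
  -- reduction
  set J := I.map (iP p) with hJ
  have hJm : ∀ x, x ∈ J ↔ ∃ w ∈ I, iP p w = x := fun x =>
    Ideal.mem_map_iff_of_surjective _ (iP_surj p)
  have hIne : ∃ x ∈ I, x ≠ 0 := by
    obtain ⟨x0, hx0, hx0n⟩ := Submodule.exists_mem_ne_zero_of_ne_bot hQ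
    obtain ⟨n, hn, w, hw⟩ := S_clear x0
    refine ⟨w, by rw [hI, Ideal.mem_comap, hw]; exact Q.mul_mem_left _ hx0, ?_⟩
    rintro rfl
    rw [map_zero, eq_comm, mul_eq_zero] at hw
    rcases hw with hw | hw
    · rw [int_cc] at hw
      exact hn (by simpa using congrArg QuadraticAlgebra.re hw)
    · exact hx0n hw
  have hJne : J ≠ ⊥ := by
    obtain ⟨x, hx, hx0⟩ := hIne
    obtain ⟨d, hd, w', hw', hpr⟩ := exists_prim hx0
    intro hb
    have hw'I : w' ∈ I := hsat d hd w' (hw' ▸ hx)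
    have : iP p w' ∈ J := Ideal.mem_map_of_mem _ hw'I
    rw [hb] at this
    exact hpr p hp this
  obtain ⟨z, u, v, hz, hu, hd, hs⟩ := structure_thm J hJne
  obtain ⟨m1, m2, m3⟩ := structure_comb hs
  obtain ⟨g, hg, eg⟩ := (hJm _).mp m1
  obtain ⟨h, hh, eh⟩ := (hJm _).mp m2
  have hex : ∀ x ∈ I, ∃ a b : ℤ[X], ∃ x' ∈ I, x = cc a * g + cc b * h + (p : S ℤ) * x' := by
    intro x hx
    obtain ⟨a', b', e⟩ := m3 _ (Ideal.mem_map_of_mem _ hx)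
    obtain ⟨a, rfl⟩ := Polynomial.map_surjective (Int.castRingHom (ZMod p)) ZMod.intCast_surjective a'
    obtain ⟨b, rfl⟩ := Polynomial.map_surjective (Int.castRingHom (ZMod p)) ZMod.intCast_surjective b'
    have : iP p (x - (cc a * g + cc b * h)) = 0 := by
      rw [map_sub, e, map_add, map_mul (iP p), map_mul (iP p), eg, eh, mp_cc, mp_cc, sub_self]
    rw [iP_ker] at this
    obtain ⟨x', hx'⟩ := this
    refine ⟨a, b, x', ?_, by rw [← hx']; ring⟩
    apply hsat p (by exact_mod_cast hp.ne_zero)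
    rw [Int.cast_natCast, ← hx']
    exact I.sub_mem hx (I.add_mem (I.mul_mem_left _ hg) (I.mul_mem_left _ hh))
  obtain ⟨q, hq⟩ := hdv g hg h hh
  obtain ⟨qA, hqA⟩ := hN.nm_dvd (a := iQ g) hg
  have hA : U ∣ nm g := by
    have := hdv g hg g hg
    rw [mul_st, cc_dvd] at this; exact this.1
  have hB : U ∣ nm h := by
    have := hdv h hh h hh
    rw [mul_st, cc_dvd] at this; exact this.1
  obtain ⟨A, hA⟩ := hA
  obtain ⟨B, hB⟩ := hB
  have hAM : cc A ∈ M := hNM (by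
    rw [hNm, ← map_mul, ← hA, ← mul_st]; exact Ideal.mul_mem_mul hg (hst _ hg))
  have hBM : cc B ∈ M := hNM (by
    rw [hNm, ← map_mul, ← hB, ← mul_st]; exact Ideal.mul_mem_mul hh (hst _ hh))
  have hqM : q ∈ M := hNM (by rw [hNm, ← hq]; exact Ideal.mul_mem_mul hg (hst _ hh))
  have hqM' : star q ∈ M := hNM (by
    rw [hNm]
    have : cc U * star q = h * star g := by
      have := congrArg star hq
      rw [star_mul, star_mul, star_star, st_cc] at this
      rw [this]; ring
    rw [this]; exact Ideal.mul_mem_mul hh (hst _ hg))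
  have hnq : nm q = A * B := by
    have := congrArg nm hq
    rw [map_mul, map_mul, nm_st, nm_cc, hA, hB] at this
    have hU2 : U ^ 2 ≠ 0 := pow_ne_zero 2 hU0
    apply mul_left_cancel₀ hU2
    rw [← this]; ring
  have hmM : cc q.im ∈ M := reg_int M p hp hpM A B q.re q.im hAM hBM hqM hqM' hnq
  -- now show `q.im` is a unit modulo `p`
  have hpm : ¬ (p : ℤ[X]) ∣ q.im := by
    rintro ⟨t, ht⟩
    have h1 : (iP p (g * star h)).im = 0 := by
      rw [hq]; simp [ht]
    rw [map_mul, mp_st, eg, eh] at h1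
    simp at h1
    rcases h1 with (h1 | h1) | h1
    · exact hz h1
    · exact hu h1
    · exact hz h1
  -- two elements with determinant n * U
  obtain ⟨x1, hx1, x2, hx2, n, hn, hnU⟩ : ∃ x1 ∈ I, ∃ x2 ∈ I, ∃ n : ℤ, n ≠ 0 ∧
      (x1 * star x2).im = n * U := by
    obtain ⟨z, u, v, hz, hu, hd, hs⟩ := structure_thm Q hQ
    have hN' := structure_hasN (by norm_num) hd hs
    obtain ⟨m1, m2, m3⟩ := structure_comb hs
    obtain ⟨n1, hn1, w1, hw1⟩ := S_clear (cc (z * u))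
    obtain ⟨n2, hn2, w2, hw2⟩ := S_clear (cc z * ⟨-v, 1⟩)
    have i1 : w1 ∈ I := by rw [hI, Ideal.mem_comap, hw1]; exact Q.mul_mem_left _ m1
    have i2 : w2 ∈ I := by rw [hI, Ideal.mem_comap, hw2]; exact Q.mul_mem_left _ m2
    obtain ⟨q', hq'⟩ := hdv w1 i1 w2 i2
    have hass : Associated (z ^ 2 * u) (U.map (Int.castRingHom ℚ)) := by
      have h1 : Ideal.span {(cc (z ^ 2 * u) : S ℚ)} = Ideal.span {cc (U.map (Int.castRingHom ℚ))} := by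
        rw [← hN', ← hN]
      have h2 := Ideal.span_singleton_eq_span_singleton.mp h1
      apply associated_of_dvd_dvd
      · exact (cc_dvd_cc _ _).mp h2.dvd
      · exact (cc_dvd_cc _ _).mp h2.symm.dvd
    obtain ⟨c, hc⟩ := hass
    have him : (iQ (w1 * star w2)).im = -(n1 * n2 : ℚ[X]) * (z ^ 2 * u) := by
      rw [map_mul, mp_st, hw1, hw2]
      simp; ring
    rw [hq'] at him
    simp at him
    obtain ⟨cu, hcu, hcu'⟩ := Polynomial.isUnit_iff.mp c.isUnit
    have hzu : z ^ 2 * u ≠ 0 := mul_ne_zero (pow_ne_zero 2 hz) hu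
    have e1 : C cu * (q'.im).map (Int.castRingHom ℚ) = -(n1 * n2 : ℚ[X]) := by
      apply mul_right_cancel₀ hzu
      rw [neg_mul, ← him, ← hc, ← hcu']; ring
    have hd0 : (q'.im).natDegree = 0 := by
      have h1 := congrArg natDegree e1
      rw [natDegree_C_mul hcu.ne_zero, natDegree_neg,
        show (n1 * n2 : ℚ[X]) = C ((n1 * n2 : ℤ) : ℚ) by simp, natDegree_C,
        natDegree_map_eq_of_injective (RingHom.injective_int _)] at h1
      exact h1
    obtain ⟨n, hn⟩ := natDegree_eq_zero.mp hd0
    refine ⟨w1, i1, w2, i2, n, ?_, ?_⟩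
    · rintro rfl
      rw [← hn] at e1
      simp at e1
      exact e1.elim hn1 hn2
    · rw [hq']; simp [← hn]; ring
  -- write n = p ^ a * n'
  obtain ⟨a, n', hn', rfl⟩ : ∃ (a : ℕ) (n' : ℤ), ¬ (p : ℤ) ∣ n' ∧ n = (p : ℤ) ^ a * n' := by
    obtain ⟨a, n', h1, h2⟩ := (Int.finiteMultiplicity_iff (a := (p : ℤ)) (b := n)|>.mpr
      ⟨by simpa using hp.one_lt.ne', hn⟩).exists_eq_pow_mul_and_not_dvd |> fun ⟨c, h1, h2⟩ =>
        (⟨_, c, h2, h1⟩ : ∃ (a : ℕ) (n' : ℤ), ¬ (p : ℤ) ∣ n' ∧ n = (p : ℤ) ^ a * n')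
    exact ⟨a, n', h1, h2⟩
  obtain ⟨a1, b1, y1, hy1, e1⟩ := key_expand hex (a + 1) x1 hx1
  obtain ⟨a2, b2, y2, hy2, e2⟩ := key_expand hex (a + 1) x2 hx2
  obtain ⟨c1, hc1⟩ := hdv x1 hx1 y2 hy2
  obtain ⟨c2, hc2⟩ := hdv y1 hy1 (cc a2 * g + cc b2 * h)
    (I.add_mem (I.mul_mem_left _ hg) (I.mul_mem_left _ hh))
  have hfin : (p : ℤ[X]) ^ a * (n' : ℤ[X]) =
      q.im * (a1 * b2 - b1 * a2) + (p : ℤ[X]) ^ (a + 1) * (c1.im + c2.im) := by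
    apply mul_right_cancel₀ hU0
    have h1 : (x1 * star x2).im = ((cc a1 * g + cc b1 * h) * star (cc a2 * g + cc b2 * h)).im
        + (p : ℤ[X]) ^ (a + 1) * ((x1 * star y2).im + (y1 * star (cc a2 * g + cc b2 * h)).im) := by
      have : x1 * star x2 = (cc a1 * g + cc b1 * h) * star (cc a2 * g + cc b2 * h)
          + cc ((p : ℤ[X]) ^ (a + 1)) * (x1 * star y2 + (y1 * star (cc a2 * g + cc b2 * h))) := by
        have e2' : star x2 = star (cc a2 * g + cc b2 * h) + cc ((p : ℤ[X]) ^ (a + 1)) * star y2 := by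
          rw [e2, star_add, nat_cc, ← map_pow, star_mul, st_cc]; ring
        rw [e2']
        conv_lhs => rw [mul_add]
        have e1' : x1 = cc a1 * g + cc b1 * h + cc ((p : ℤ[X]) ^ (a + 1)) * y1 := by
          rw [map_pow, ← nat_cc]; exact e1
        conv_lhs => 
          congr
          · rw [e1']
        ring
      rw [this, QuadraticAlgebra.im_add, cc_mul_im, QuadraticAlgebra.im_add]
    have h2 : ((cc a1 * g + cc b1 * h) * star (cc a2 * g + cc b2 * h)).im
        = (a1 * b2 - b1 * a2) * (g * star h).im := by
      simp; ring
    rw [hnU, h2, hq, hc1, hc2] at h1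
    simp at h1
    linear_combination h1
  have hpow : (p : ℤ[X]) ^ a ∣ q.im * (a1 * b2 - b1 * a2) :=
    ⟨n' - p * (c1.im + c2.im), by linear_combination -hfin⟩
  have hpt : (p : ℤ[X]) ^ a ∣ (a1 * b2 - b1 * a2) :=
    (prime_poly hp).pow_dvd_of_dvd_mul_left a hpm hpow
  obtain ⟨t, ht⟩ := hpt
  have hfin2 : (n' : ℤ[X]) = q.im * t + p * (c1.im + c2.im) := by
    apply mul_left_cancel₀ (pow_ne_zero a (prime_poly hp).ne_zero)
    rw [hfin, ht]; ring
  apply hn'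
  refine int_mem M hM.ne_top p hp hpM _ ?_
  rw [int_cc, hfin2, map_add, map_mul, map_mul, ← nat_cc]
  exact M.add_mem (M.mul_mem_right _ hmM) (M.mul_mem_right _ hpM)

end N3
end

section
open Polynomial
namespace N3

section cl
variable (k : Type*) [CommRing k] [IsDomain k] [NormalizedGCDMonoid k]

/-- Ideals with a primitive norm. -/
def GM : Submonoid (Ideal (S k)) where
  carrier := {I | ∃ U : k[X], U.IsPrimitive ∧ HasN I U}
  one_mem' := ⟨1, isPrimitive_one, hasN_one⟩
  mul_mem' := by
    rintro I J ⟨U, hU, h⟩ ⟨V, hV, h'⟩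
    exact ⟨U * V, hU.mul hV, h.mul h'⟩

variable {k}
lemma GM_cj {I : Ideal (S k)} (h : I ∈ GM k) : cj I ∈ GM k := by
  obtain ⟨U, hU, h⟩ := h
  exact ⟨U, hU, h.cj⟩

lemma span_ne {a : S k} (ha : a ≠ 0) {I J : Ideal (S k)}
    (e : Ideal.span {a} * I = Ideal.span {a} * J) : I = J :=
  (Ideal.span_singleton_mul_right_inj ha).mp e

variable (k)
/-- Equivalence of ideals. -/
def cn : Con (GM k) where
  r I J := ∃ a b : S k, a ≠ 0 ∧ b ≠ 0 ∧ Ideal.span {a} * I.1 = Ideal.span {b} * J.1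
  iseqv := by
    refine ⟨fun I => ⟨1, 1, one_ne_zero, one_ne_zero, rfl⟩, ?_, ?_⟩
    · rintro I J ⟨a, b, ha, hb, e⟩
      exact ⟨b, a, hb, ha, e.symm⟩
    · rintro I J K ⟨a, b, ha, hb, e⟩ ⟨c, d, hc, hd, e'⟩
      refine ⟨c * a, b * d, mul_ne_zero hc ha, mul_ne_zero hb hd, ?_⟩
      rw [← Ideal.span_singleton_mul_span_singleton, ← Ideal.span_singleton_mul_span_singleton,
        mul_assoc, e, mul_assoc, ← e', mul_left_comm]
  mul' := by
    rintro I J K M ⟨a, b, ha, hb, e⟩ ⟨c, d, hc, hd, e'⟩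
    refine ⟨a * c, b * d, mul_ne_zero ha hc, mul_ne_zero hb hd, ?_⟩
    rw [← Ideal.span_singleton_mul_span_singleton, ← Ideal.span_singleton_mul_span_singleton]
    simp only [Submonoid.coe_mul]
    rw [mul_mul_mul_comm, e, e', mul_mul_mul_comm]

/-- The class group. -/
def Cl := (cn k).Quotient

noncomputable instance : CommMonoid (Cl k) := inferInstanceAs (CommMonoid (cn k).Quotient)

variable {k}
/-- The class of an ideal -/
noncomputable def cls (I : Ideal (S k)) (h : I ∈ GM k) : Cl k := ((⟨I, h⟩ : GM k) : (cn k).Quotient)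

lemma cls_eq {I J : Ideal (S k)} {h : I ∈ GM k} {h' : J ∈ GM k} : cls I h = cls J h' ↔
    ∃ a b : S k, a ≠ 0 ∧ b ≠ 0 ∧ Ideal.span {a} * I = Ideal.span {b} * J := (cn k).eq

lemma cls_surj (D : Cl k) : ∃ (I : Ideal (S k)) (h : I ∈ GM k), D = cls I h := by
  induction D using Con.induction_on with
  | H x => exact ⟨x.1, x.2, rfl⟩

lemma cls_mul {I J : Ideal (S k)} (h : I ∈ GM k) (h' : J ∈ GM k) :
    cls I h * cls J h' = cls (I * J) ((GM k).mul_mem h h') := rfl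

lemma cls_one : cls (1 : Ideal (S k)) (GM k).one_mem = 1 := rfl

lemma cls_pow {I : Ideal (S k)} (h : I ∈ GM k) (n : ℕ) :
    cls I h ^ n = cls (I ^ n) ((GM k).pow_mem h n) := by
  induction n with
  | zero => simp only [pow_zero]; rfl
  | succ n ih => simp only [pow_succ, ih, cls_mul]

lemma cls_eq_one {I : Ideal (S k)} {h : I ∈ GM k} : cls I h = 1 ↔ ∃ x : S k, x ≠ 0 ∧ I = Ideal.span {x} := by
  rw [← cls_one, cls_eq]
  constructor
  · rintro ⟨a, b, ha, hb, e⟩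
    rw [mul_one] at e
    have hb' : b ∈ Ideal.span {a} * I := e ▸ Ideal.mem_span_singleton_self b
    rw [Ideal.mem_span_singleton_mul] at hb'
    obtain ⟨x, hx, rfl⟩ := hb'
    refine ⟨x, right_ne_zero_of_mul hb, ?_⟩
    apply span_ne ha
    rw [e, Ideal.span_singleton_mul_span_singleton]
  · rintro ⟨x, hx, rfl⟩
    exact ⟨1, x, one_ne_zero, hx, by simp⟩

lemma cls_inv (D : Cl k) : ∃ E : Cl k, E * D = 1 := by
  obtain ⟨I, h, rfl⟩ := cls_surj D
  refine ⟨cls (cj I) (GM_cj h), ?_⟩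
  rw [mul_comm, cls_mul, cls_eq_one]
  obtain ⟨U, hU, hN⟩ := h
  exact ⟨cc U, fun h0 => hU.ne_zero (by simpa using congrArg QuadraticAlgebra.re h0), hN⟩

noncomputable instance : CommGroup (Cl k) :=
  { (inferInstance : CommMonoid (Cl k)) with
    inv := fun D => (cls_inv D).choose
    inv_mul_cancel := fun D => (cls_inv D).choose_spec }

lemma cls_cj {I : Ideal (S k)} (h : I ∈ GM k) : cls (cj I) (GM_cj h) = (cls I h)⁻¹ := by
  rw [eq_inv_iff_mul_eq_one, mul_comm, cls_mul, cls_eq_one]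
  obtain ⟨U, hU, hN⟩ := h
  exact ⟨cc U, fun h0 => hU.ne_zero (by simpa using congrArg QuadraticAlgebra.re h0), hN⟩

end cl

lemma prim_iff {U : ℤ[X]} : U.IsPrimitive ↔ ∀ p : ℕ, p.Prime → U.map (Int.castRingHom (ZMod p)) ≠ 0 := by
  constructor
  · intro h p hp h0
    rw [poly_ker] at h0
    have := h p (by simpa using h0)
    rw [Int.isUnit_iff_natAbs_eq] at this
    exact hp.one_lt.ne' (by simpa using this)
  · intro h r hr
    rw [Int.isUnit_iff_natAbs_eq]
    by_contra hc
    obtain ⟨p, hp, hd⟩ := Nat.exists_prime_and_dvd hc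
    apply h p hp
    rw [poly_ker]
    refine dvd_trans ?_ hr
    have : (p : ℤ[X]) = C (p : ℤ) := by simp
    rw [this]
    exact map_dvd C (Int.natCast_dvd.mpr hd)

lemma prim_nm {w : S ℤ} (hw : Prim w) : (nm w).IsPrimitive := by
  rw [prim_iff]
  intro p hp
  have : Fact p.Prime := ⟨hp⟩
  rw [← nm_mp, Ne, nm_eq_zero]
  exact hw p hp

lemma span_GM {w : S ℤ} (hw : Prim w) : Ideal.span {w} ∈ GM ℤ := ⟨_, prim_nm hw, hasN_span w⟩

lemma isUnit_int {n : ℤ} (hn : n ≠ 0) : IsUnit (n : S ℚ) := by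
  rw [int_cc]
  refine IsUnit.map cc ?_
  have : (n : ℚ[X]) = C (n : ℚ) := by simp
  rw [this]
  exact isUnit_C.mpr (isUnit_iff_ne_zero.mpr (by exact_mod_cast hn))

lemma prim_dvd_int {U : ℤ[X]} (hU : U.IsPrimitive) {n : ℤ} (hn : n ≠ 0) {w : S ℤ}
    (h : cc U ∣ (n : S ℤ) * w) : cc U ∣ w := by
  apply prim_dvd hU
  have := map_dvd iQ h
  rw [map_mul, map_intCast, mp_cc] at this
  exact (isUnit_int hn).dvd_mul_left.mp this

lemma GM_sat {I : Ideal (S ℤ)} (h : I ∈ GM ℤ) : Sat I := by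
  obtain ⟨U, hU, hN⟩ := h
  intro n hn x hx
  rw [hN.mem_iff hU.ne_zero] at hx ⊢
  intro b hb
  have := hx b hb
  rw [mul_assoc] at this
  exact prim_dvd_int hU hn this

/-- An ideal that becomes principal over the rationals is principal. -/
lemma principal_of_rat {I : Ideal (S ℤ)} (h : I ∈ GM ℤ) {γ : S ℚ} (hγ : γ ≠ 0)
    (e : I.map iQ = Ideal.span {γ}) : cls I h = 1 := by
  rw [cls_eq_one]
  obtain ⟨n, hn, w, hw⟩ := S_clear γ
  have hw0 : w ≠ 0 := by
    rintro rfl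
    rw [map_zero, eq_comm, mul_eq_zero] at hw
    exact hw.elim (isUnit_int hn).ne_zero hγ
  obtain ⟨d, hd, x, rfl, hx⟩ := exists_prim hw0
  have hx0 : x ≠ 0 := right_ne_zero_of_mul hw0
  have ass : Associated (iQ x) γ := by
    rw [map_mul, map_intCast] at hw
    have h1 : Associated ((d : S ℚ) * iQ x) (iQ x) := (associated_unit_mul_left _ _ (isUnit_int hd))
    have h2 : Associated ((n : S ℚ) * γ) γ := (associated_unit_mul_left _ _ (isUnit_int hn))
    exact h1.symm.trans (hw ▸ h2)
  rw [← Ideal.span_singleton_eq_span_singleton.mpr ass] at e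
  refine ⟨x, hx0, ?_⟩
  have sat := GM_sat h
  have sat2 := GM_sat (span_GM hx)
  have e' : I.map iQ = (Ideal.span {x}).map iQ := by rw [e, Ideal.map_span]; simp
  have key : ∀ J K : Ideal (S ℤ), Sat K → J.map iQ = K.map iQ → J ≤ K := by
    intro J K hK e y hy
    have := Ideal.mem_map_of_mem iQ hy
    rw [e] at this
    obtain ⟨m, hm, w, hw, hwe⟩ := map_mem_clear this
    apply hK m hm
    have : w = m * y := iQ_inj (by rw [hwe, map_mul, map_intCast])
    rwa [← this]
  exact le_antisymm (key _ _ sat2 e') (key _ _ sat e'.symm)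

lemma red_GM {I : Ideal (S ℤ)} (h : I ∈ GM ℤ) : I.map (iP 2) ∈ GM (ZMod 2) := by
  obtain ⟨U, hU, hN⟩ := h
  refine ⟨_, ?_, hN.map _⟩
  have h0 := prim_iff.mp hU 2 Nat.prime_two
  intro r hr
  refine isUnit_iff_ne_zero.mpr ?_
  rintro rfl
  simp at hr; exact h0 hr

lemma sat_le {J K : Ideal (S ℤ)} {d d' : ℤ} (hK : K ∈ GM ℤ) (hd : d ≠ 0)
    (e : Ideal.span {(d : S ℤ)} * J = Ideal.span {(d' : S ℤ)} * K) : J ≤ K := by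
  intro x hx
  apply GM_sat hK d hd
  have : (d : S ℤ) * x ∈ Ideal.span {(d' : S ℤ)} * K := by
    rw [← e]; exact Ideal.mul_mem_mul (Ideal.mem_span_singleton_self _) hx
  exact Ideal.mul_le_right this

lemma red_wd {I J : Ideal (S ℤ)} (hI : I ∈ GM ℤ) (hJ : J ∈ GM ℤ) {a b : S ℤ} (ha : a ≠ 0)
    (hb : b ≠ 0) (e : Ideal.span {a} * I = Ideal.span {b} * J) :
    cls (I.map (iP 2)) (red_GM hI) = cls (J.map (iP 2)) (red_GM hJ) := by
  rw [cls_eq]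
  obtain ⟨d, hd, a', rfl, pa⟩ := exists_prim ha
  obtain ⟨d', hd', b', rfl, pb⟩ := exists_prim hb
  rw [← Ideal.span_singleton_mul_span_singleton, ← Ideal.span_singleton_mul_span_singleton,
        mul_assoc, mul_assoc] at e
  have e2 : Ideal.span {a'} * I = Ideal.span {b'} * J :=
    le_antisymm (sat_le ((GM ℤ).mul_mem (span_GM pb) hJ) hd e)
        (sat_le ((GM ℤ).mul_mem (span_GM pa) hI) hd' e.symm)
  refine ⟨iP 2 a', iP 2 b', pa 2 Nat.prime_two, pb 2 Nat.prime_two, ?_⟩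
  have := congrArg (Ideal.map (iP 2)) e2
  rw [Ideal.map_mul, Ideal.map_mul, Ideal.map_span, Ideal.map_span, Set.image_singleton,
    Set.image_singleton] at this
  exact this

/-- Reduction modulo two on classes. -/
noncomputable def red : Cl ℤ →* Cl (ZMod 2) :=
  Con.lift (cn ℤ)
    { toFun := fun I => cls (I.1.map (iP 2)) (red_GM I.2)
      map_one' := by
        rw [cls_eq_one]; exact ⟨1, one_ne_zero, by
          rw [OneMemClass.coe_one, Ideal.one_eq_top, Ideal.map_top]; simp⟩
      map_mul' := fun I J => by
        rw [cls_mul]; congr 1; exact Ideal.map_mul _ _ _ } (by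
    rintro I J ⟨a, b, ha, hb, e⟩
    exact red_wd I.2 J.2 ha hb e)

lemma red_cls {I : Ideal (S ℤ)} (h : I ∈ GM ℤ) : red (cls I h) = cls (I.map (iP 2)) (red_GM h) := rfl

end N3
end

section
open Polynomial
namespace N3

section pls
variable (k : Type*) [CommRing k]

/-- Elements with bounded pole order -/
def PL (n : ℕ) : Submodule k (S k) where
  carrier := {z | pl n z}
  add_mem' := by
    rintro a b ⟨h1, h2⟩ ⟨h3, h4⟩
    exact ⟨fun i hi => by simp [h1 i hi, h3 i hi], fun i hi => by simp [h2 i hi, h4 i hi]⟩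
  zero_mem' := ⟨fun i hi => by simp, fun i hi => by simp⟩
  smul_mem' := by
    rintro c a ⟨h1, h2⟩
    exact ⟨fun i hi => by simp [h1 i hi], fun i hi => by simp [h2 i hi]⟩

variable {k}
lemma mem_PL {n : ℕ} {z : S k} : z ∈ PL k n ↔ pl n z := Iff.rfl

lemma mem_PL' {n : ℕ} {z : S k} : z ∈ PL k n ↔
    z.re ∈ degreeLT k (n / 2 + 1) ∧ z.im ∈ degreeLT k ((n - 5) / 2) := by
  rw [mem_PL, mem_degreeLT, mem_degreeLT, degree_lt_iff_coeff_zero, degree_lt_iff_coeff_zero, pl]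
  refine and_congr (forall_congr' fun i => ?_) (forall_congr' fun i => ?_)
  · rw [show n < 2 * i ↔ n / 2 + 1 ≤ i by omega]
  · rw [show n < 2 * i + 7 ↔ (n - 5) / 2 ≤ i by omega]

variable (k)
/-- parametrisation -/
def PLe (n : ℕ) : PL k n ≃ₗ[k] degreeLT k (n / 2 + 1) × degreeLT k ((n - 5) / 2) where
  toFun z := (⟨z.1.re, (mem_PL'.mp z.2).1⟩, ⟨z.1.im, (mem_PL'.mp z.2).2⟩)
  invFun w := ⟨⟨w.1.1, w.2.1⟩, mem_PL'.mpr ⟨w.1.2, w.2.2⟩⟩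
  map_add' x y := rfl
  map_smul' c x := rfl
  left_inv x := rfl
  right_inv x := rfl

lemma PL_finite (n : ℕ) : Module.Finite k (PL k n) := by
  have : ∀ m, Module.Finite k (degreeLT k m) := fun m =>
    Module.Finite.equiv (degreeLTEquiv k m).symm
  exact Module.Finite.equiv (PLe k n).symm

lemma PL_rank [Nontrivial k] (n : ℕ) : Module.finrank k (PL k n) = n / 2 + 1 + (n - 5) / 2 := by
  have h : ∀ m, Module.Finite k (degreeLT k m) := fun m =>
    Module.Finite.equiv (degreeLTEquiv k m).symm
  have h' : ∀ m, Module.Free k (degreeLT k m) := fun m =>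
    Module.Free.of_equiv (degreeLTEquiv k m).symm
  have e : ∀ m, Module.finrank k (degreeLT k m) = m := fun m => by
    rw [(degreeLTEquiv k m).finrank_eq]; simp
  rw [(PLe k n).finrank_eq, Module.finrank_prod, e, e]

variable {k}
lemma exists_PL (z : S k) : ∃ n, z ∈ PL k n := by
  refine ⟨2 * z.re.natDegree + 2 * z.im.natDegree + 7, ?_⟩
  exact pl_of_deg (by omega) (Or.inr (by omega))

lemma PL_mono {m n : ℕ} (h : m ≤ n) : PL k m ≤ PL k n := fun _ hz => pl_mono h hz

end pls

section fld
variable {k : Type*} [Field k]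

lemma ne_bot_of_hasN {I : Ideal (S k)} {U : k[X]} (h : HasN I U) (hU : U ≠ 0) : I ≠ ⊥ := by
  rintro rfl
  have := h.cc_mem
  rw [Ideal.mem_bot] at this
  exact hU (by simpa using congrArg QuadraticAlgebra.re this)

lemma hasN_unique {I : Ideal (S k)} {U V : k[X]} (h : HasN I U) (h' : HasN I V) :
    Associated U V := by
  have h1 : Ideal.span {(cc U : S k)} = Ideal.span {cc V} := by rw [← h, ← h']
  have h2 := Ideal.span_singleton_eq_span_singleton.mp h1
  exact associated_of_dvd_dvd ((cc_dvd_cc _ _).mp h2.dvd) ((cc_dvd_cc _ _).mp h2.symm.dvd)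

lemma codim (h59 : (5911 : k) ≠ 0) {I : Ideal (S k)} {U : k[X]} (h : HasN I U) (hU : U ≠ 0) :
    Module.Finite k (S k ⧸ I.restrictScalars k) ∧
      Module.finrank k (S k ⧸ I.restrictScalars k) = U.natDegree := by
  obtain ⟨z, u, v, hz, hu, hd, hs⟩ := structure_thm I (ne_bot_of_hasN h hU)
  have hass := hasN_unique h (structure_hasN h59 hd hs)
  have hzu := mul_ne_zero hz hu
  let τ : S k →ₗ[k] (k[X] ⧸ Ideal.span {z}) × (k[X] ⧸ Ideal.span {z * u}) :=
    { toFun := fun x => (Ideal.Quotient.mk _ x.im, Ideal.Quotient.mk _ (x.re + v * x.im))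
      map_add' := fun x y => by
        simp only [QuadraticAlgebra.im_add, QuadraticAlgebra.re_add, mul_add, map_add, Prod.mk_add_mk]
        ring_nf
      map_smul' := fun c x => by
        simp only [QuadraticAlgebra.im_smul, QuadraticAlgebra.re_smul, mul_smul_comm, ← smul_add]
        rfl }
  have hk : LinearMap.ker τ = I.restrictScalars k := by
    ext x
    rw [LinearMap.mem_ker, Submodule.restrictScalars_mem, hs]
    simp only [τ, LinearMap.coe_mk, AddHom.coe_mk, Prod.mk_eq_zero, Ideal.Quotient.eq_zero_iff_mem,
      Ideal.mem_span_singleton]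
  have hsurj : Function.Surjective τ := by
    rintro ⟨a, b⟩
    obtain ⟨a, rfl⟩ := Ideal.Quotient.mk_surjective a
    obtain ⟨b, rfl⟩ := Ideal.Quotient.mk_surjective b
    exact ⟨⟨b - v * a, a⟩, by simp [τ]⟩
  have e := LinearMap.quotKerEquivOfSurjective τ hsurj
  rw [hk] at e
  have f1 : ∀ p : k[X], p ≠ 0 → Module.Finite k (k[X] ⧸ Ideal.span {p}) := fun p hp =>
    (AdjoinRoot.powerBasis hp).finite
  have := f1 z hz
  have := f1 _ hzu
  refine ⟨Module.Finite.equiv e.symm, ?_⟩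
  rw [e.finrank_eq, Module.finrank_prod, finrank_quotient_span_eq_natDegree,
    finrank_quotient_span_eq_natDegree, natDegree_eq_of_degree_eq (degree_eq_degree_of_associated hass),
    natDegree_mul hz hu, natDegree_mul (pow_ne_zero 2 hz) hu, natDegree_pow]
  ring

lemma inter_rank (h59 : (5911 : k) ≠ 0) {I : Ideal (S k)} {U : k[X]} (h : HasN I U) (hU : U ≠ 0)
    (n : ℕ) : n / 2 + 1 + (n - 5) / 2 ≤
      Module.finrank k (PL k n ⊓ I.restrictScalars k : Submodule k (S k)) + U.natDegree := by
  obtain ⟨hf, hr⟩ := codim h59 h hU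
  have := PL_finite k n
  let g := (I.restrictScalars k).mkQ.comp (PL k n).subtype
  have h1 := LinearMap.finrank_range_add_finrank_ker g
  have h2 : Module.finrank k (LinearMap.range g) ≤ U.natDegree := hr ▸ Submodule.finrank_le _
  have h3 : Module.finrank k (LinearMap.ker g) =
      Module.finrank k (PL k n ⊓ I.restrictScalars k : Submodule k (S k)) := by
    have : LinearMap.ker g = (I.restrictScalars k).comap (PL k n).subtype := by
      rw [LinearMap.ker_comp, Submodule.ker_mkQ]
    rw [this, ← Submodule.map_comap_subtype]
    exact (LinearEquiv.finrank_eq (Submodule.equivSubtypeMap _ _))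
  rw [PL_rank, h3] at h1
  omega

lemma inter_rank_eq (h59 : (5911 : k) ≠ 0) {I : Ideal (S k)} {U : k[X]} (h : HasN I U) (hU : U ≠ 0) :
    ∃ n0, ∀ n ≥ n0, n / 2 + 1 + (n - 5) / 2 =
      Module.finrank k (PL k n ⊓ I.restrictScalars k : Submodule k (S k)) + U.natDegree := by
  obtain ⟨hf, hr⟩ := codim h59 h hU
  obtain ⟨s, hs⟩ := hf
  have hb : ∃ n0, ∀ q ∈ s, ∃ z ∈ PL k n0, (I.restrictScalars k).mkQ z = q := by
    clear hs
    classical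
    induction s using Finset.induction_on with
    | empty => exact ⟨0, by simp⟩
    | insert a s _ ih =>
      obtain ⟨n0, hn0⟩ := ih
      obtain ⟨z, rfl⟩ := Submodule.mkQ_surjective _ a
      obtain ⟨m, hm⟩ := exists_PL z
      refine ⟨max n0 m, fun q hq => ?_⟩
      rw [Finset.mem_insert] at hq
      rcases hq with rfl | hq
      · exact ⟨z, PL_mono (le_max_right _ _) hm, rfl⟩
      · obtain ⟨w, hw, e⟩ := hn0 q hq
        exact ⟨w, PL_mono (le_max_left _ _) hw, e⟩
  obtain ⟨n0, hn0⟩ := hb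
  refine ⟨n0, fun n hn => ?_⟩
  have := PL_finite k n
  let g := (I.restrictScalars k).mkQ.comp (PL k n).subtype
  have h1 := LinearMap.finrank_range_add_finrank_ker g
  have h2 : Module.finrank k (LinearMap.range g) = U.natDegree := by
    have : LinearMap.range g = ⊤ := by
      rw [eq_top_iff, ← hs, Submodule.span_le]
      intro q hq
      obtain ⟨z, hz, e⟩ := hn0 q hq
      exact ⟨⟨z, PL_mono hn hz⟩, e⟩
    rw [this, finrank_top, hr]
  have h3 : Module.finrank k (LinearMap.ker g) =
      Module.finrank k (PL k n ⊓ I.restrictScalars k : Submodule k (S k)) := by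
    have : LinearMap.ker g = (I.restrictScalars k).comap (PL k n).subtype := by
      rw [LinearMap.ker_comp, Submodule.ker_mkQ]
    rw [this, ← Submodule.map_comap_subtype]
    exact (LinearEquiv.finrank_eq (Submodule.equivSubtypeMap _ _))
  rw [PL_rank, h3] at h1
  omega

end fld
end N3
end

section
open Polynomial
namespace N3

section lat
variable {I : Ideal (S ℤ)} {U : ℤ[X]}

lemma smul_int (c : ℤ) (x : S ℤ) : c • x = (c : S ℤ) * x := zsmul_eq_mul x c

lemma pl_iQ {n : ℕ} {w : S ℤ} : pl n (iQ w) ↔ pl n w := by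
  unfold pl; simp

lemma pl_int {n : ℕ} {c : ℤ} (hc : c ≠ 0) {w : S ℤ} : pl n ((c : S ℤ) * w) ↔ pl n w := by
  rw [← smul_int]
  unfold pl; simp [hc]

lemma pl_rat {n : ℕ} {c : ℤ} (hc : c ≠ 0) {w : S ℚ} : pl n ((c : S ℚ) * w) ↔ pl n w := by
  rw [← zsmul_eq_mul]
  unfold pl; simp [hc]

/-- reductions of elements have smaller poles -/
lemma pl_red (hU : U.IsPrimitive) (hN : HasN I U) {m n : ℕ}
    (hm : n + (U.map (Int.castRingHom (ZMod 2))).natDegree ≤ m + U.natDegree) {x : S ℤ}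
    (hx : x ∈ I) (hp : pl n x) : pl m (iP 2 x) := by
  by_cases h0 : iP 2 x = 0
  · rw [h0]; exact (PL (ZMod 2) m).zero_mem
  have hx0 : x ≠ 0 := by rintro rfl; simp at h0
  obtain ⟨e, he⟩ := hN.nm_dvd hx
  have h1 := nm_pl h0
  have h2 := pl_nm hp
  have hU2 := prim_iff.mp hU 2 Nat.prime_two
  have hn0 : nm x ≠ 0 := (nm_pl hx0).1
  have he0 : e ≠ 0 := by rintro rfl; simp at he; exact hn0 he
  rw [he, natDegree_mul hU.ne_zero he0] at h2
  refine pl_mono ?_ h1.2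
  rw [nm_mp, he, Polynomial.map_mul]
  have h3 := natDegree_mul_le (p := U.map (Int.castRingHom (ZMod 2))) (q := e.map (Int.castRingHom (ZMod 2)))
  have h4 := natDegree_map_le (f := Int.castRingHom (ZMod 2)) (p := e)
  omega

/-- Lifting elements with controlled poles. -/
lemma move_lift (hU : U.IsPrimitive) (hN : HasN I U) : ∃ m1, ∀ m ≥ m1,
    ∀ x ∈ I.map (iP 2), pl m x → ∃ w ∈ I, iP 2 w = x ∧ ∀ n,
      n + (U.map (Int.castRingHom (ZMod 2))).natDegree = m + U.natDegree → pl n w := by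
  have hU2 := prim_iff.mp hU 2 Nat.prime_two
  have hNb : HasN (I.map (iP 2)) (U.map (Int.castRingHom (ZMod 2))) := hN.map _
  have hNQ : HasN (I.map iQ) (U.map (Int.castRingHom ℚ)) := hN.map _
  have hUQ : U.map (Int.castRingHom ℚ) ≠ 0 := by
    rw [Ne, Polynomial.map_eq_zero_iff (RingHom.injective_int _)]; exact hU.ne_zero
  obtain ⟨m1, hm1⟩ := inter_rank_eq (by decide) hNb hU2
  refine ⟨m1 + 5, fun m hm x hx hpx => ?_⟩
  have hdd : (U.map (Int.castRingHom (ZMod 2))).natDegree ≤ U.natDegree := natDegree_map_le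
  obtain ⟨n, hn⟩ : ∃ n, n + (U.map (Int.castRingHom (ZMod 2))).natDegree = m + U.natDegree :=
    ⟨m + U.natDegree - (U.map (Int.castRingHom (ZMod 2))).natDegree, by omega⟩
  have e1 := hm1 m (by omega)
  have e2 := inter_rank (by norm_num) hNQ hUQ n
  rw [natDegree_map_eq_of_injective (RingHom.injective_int _)] at e2
  let V : Submodule ℤ (S ℤ) := PL ℤ n ⊓ I.restrictScalars ℤ
  have : Module.Finite ℤ (PL ℤ n) := PL_finite ℤ n
  have hVf : Module.Finite ℤ V :=
    Module.Finite.of_injective (Submodule.inclusion (inf_le_left : V ≤ PL ℤ n))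
      (Submodule.inclusion_injective _)
  have : Module.IsTorsionFree ℤ V := inferInstance
  have : Module.Free ℤ V := inferInstance
  let b := Module.finBasis ℤ V
  set s := Module.finrank ℤ V with hs
  have hbI : ∀ i, (b i).1 ∈ I := fun i => (b i).2.2
  have hbP : ∀ i, pl n (b i).1 := fun i => (b i).2.1
  -- rational span
  have hspan : (PL ℚ n ⊓ (I.map iQ).restrictScalars ℚ : Submodule ℚ (S ℚ)) ≤
      Submodule.span ℚ (Set.range fun i => iQ (b i).1) := by
    rintro y ⟨hy1, hy2⟩
    obtain ⟨c, hc, w, hw, e⟩ := map_mem_clear (show y ∈ I.map iQ from hy2)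
    have hwV : w ∈ V := ⟨by
      change pl n w
      rw [← pl_iQ, e, pl_rat hc]; exact hy1, hw⟩
    have hr := b.sum_repr ⟨w, hwV⟩
    have hr' := congrArg (fun v : V => iQ v.1) hr
    have : y = (c : ℚ)⁻¹ • iQ w := by
      rw [e]
      have h1 : (c : S ℚ) * y = (c : ℚ) • y := by
        rw [← zsmul_eq_mul]; exact (Int.cast_smul_eq_zsmul ℚ c y).symm
      rw [h1, smul_smul, inv_mul_cancel₀ (by exact_mod_cast hc), one_smul]
    rw [this]
    apply Submodule.smul_mem
    have hr'' : iQ w = ∑ i, iQ ((b.repr ⟨w, hwV⟩ i • b i : V) : S ℤ) := by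
      rw [← map_sum, ← Submodule.coe_sum, hr]
    rw [hr'']
    refine Submodule.sum_mem _ fun i _ => ?_
    rw [Submodule.coe_smul, map_zsmul, ← Int.cast_smul_eq_zsmul ℚ]
    exact Submodule.smul_mem _ _ (Submodule.subset_span ⟨i, rfl⟩)
  have hsr : Module.finrank ℚ (PL ℚ n ⊓ (I.map iQ).restrictScalars ℚ : Submodule ℚ (S ℚ)) ≤ s := by
    have : Module.Finite ℚ (Submodule.span ℚ (Set.range fun i => iQ (b i).1)) :=
      FiniteDimensional.span_of_finite ℚ (Set.finite_range _)
    have h1 := Submodule.finrank_mono (t := Submodule.span ℚ (Set.range fun i => iQ (b i).1)) hspan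
    have h2 := finrank_range_le_card (R := ℚ) (fun i => iQ (b i).1)
    rw [Fintype.card_fin] at h2
    exact h1.trans h2
  -- independence of the reductions
  let W : Submodule (ZMod 2) (S (ZMod 2)) :=
    PL (ZMod 2) m ⊓ (I.map (iP 2)).restrictScalars (ZMod 2)
  have hbW : ∀ i, iP 2 (b i).1 ∈ W := fun i =>
    ⟨pl_red hU hN hn.le (hbI i) (hbP i), Ideal.mem_map_of_mem _ (hbI i)⟩
  have hsm : ∀ (c : ℤ) (y : S (ZMod 2)), (c : ZMod 2) • y = c • y := fun c y =>
    Int.cast_smul_eq_zsmul (ZMod 2) c y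
  have hli : LinearIndependent (ZMod 2) (fun i => (⟨iP 2 (b i).1, hbW i⟩ : W)) := by
    rw [Fintype.linearIndependent_iff]
    intro g hg i
    choose c hc using fun i => ZMod.intCast_surjective (g i)
    have h1 : iP 2 ((∑ i, c i • b i : V) : S ℤ) = 0 := by
      have h2 := congrArg Subtype.val hg
      rw [Submodule.coe_sum] at h2
      rw [Submodule.coe_sum, map_sum]
      refine Eq.trans (Finset.sum_congr rfl fun i _ => ?_) h2
      rw [Submodule.coe_smul, Submodule.coe_smul, map_zsmul, ← hsm, hc]
    rw [iP_ker] at h1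
    obtain ⟨y, hy⟩ := h1
    have hmem := (∑ i, c i • b i : V).2
    rw [hy] at hmem
    have hyV : y ∈ V := by
      refine ⟨?_, ?_⟩
      · have : pl n (((2 : ℕ) : S ℤ) * y) := hmem.1
        change pl n y
        exact (pl_int (c := 2) (by norm_num)).mp (by exact_mod_cast this)
      · exact GM_sat ⟨U, hU, hN⟩ 2 (by norm_num) y (by exact_mod_cast hmem.2)
    have h3 : (∑ i, c i • b i : V) = (2 : ℤ) • ⟨y, hyV⟩ := by
      apply Subtype.ext
      rw [hy, Submodule.coe_smul, smul_int]; norm_num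
    have h4 := congrArg (fun v => b.repr v i) h3
    simp only [b.repr_sum_self, map_smul, Finsupp.smul_apply] at h4
    rw [← hc i, h4, smul_eq_mul]
    push_cast
    have : (2 : ZMod 2) = 0 := by decide
    rw [this, zero_mul]
  have : Module.Finite (ZMod 2) (PL (ZMod 2) m) := PL_finite _ _
  have hWf : Module.Finite (ZMod 2) W :=
    Module.Finite.of_injective (Submodule.inclusion (inf_le_left : W ≤ PL (ZMod 2) m))
      (Submodule.inclusion_injective _)
  have hcard := hli.fintype_card_le_finrank
  rw [Fintype.card_fin] at hcard
  have hst : Module.finrank (ZMod 2) W = s := by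
    refine le_antisymm ?_ hcard
    have : Module.finrank (ZMod 2) W + (U.map (Int.castRingHom (ZMod 2))).natDegree
      = m / 2 + 1 + (m - 5) / 2 := e1.symm
    omega
  have htop := hli.span_eq_top_of_card_eq_finrank' (by rw [Fintype.card_fin, hst])
  have hxm : (⟨x, hpx, hx⟩ : W) ∈ Submodule.span (ZMod 2)
      (Set.range (fun i => (⟨iP 2 (b i).1, hbW i⟩ : W))) := by rw [htop]; trivial
  rw [Submodule.mem_span_range_iff_exists_fun] at hxm
  obtain ⟨g, hg⟩ := hxm
  choose c hc using fun i => ZMod.intCast_surjective (g i)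
  refine ⟨((∑ i, c i • b i : V) : S ℤ), (∑ i, c i • b i : V).2.2, ?_, fun n' hn' => ?_⟩
  · have h2 := congrArg Subtype.val hg
    rw [Submodule.coe_sum] at h2
    rw [Submodule.coe_sum, map_sum]
    refine Eq.trans (Finset.sum_congr rfl fun i _ => ?_) h2
    rw [Submodule.coe_smul, Submodule.coe_smul, map_zsmul, ← hsm, hc]
  · obtain rfl : n' = n := by omega
    exact (∑ i, c i • b i : V).2.1

end lat

section dv
variable {k : Type*} [CommRing k] [IsDomain k]

/-- The ideal `g * conj I / U`. -/
lemma div_ideal {I : Ideal (S k)} {U e : k[X]} (hN : HasN I U) (hU : U ≠ 0) {g : S k} (hg : g ∈ I)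
    (he : nm g = U * e) : ∃ J : Ideal (S k), Ideal.span {cc U} * J = Ideal.span {g} * cj I ∧
      HasN J e := by
  let J : Ideal (S k) := Submodule.comap (LinearMap.mulLeft (S k) (cc U)) (Ideal.span {g} * cj I)
  have hcU : (cc U : S k) ≠ 0 := fun h0 => hU (by simpa using congrArg QuadraticAlgebra.re h0)
  have h1 : Ideal.span {cc U} * J = Ideal.span {g} * cj I := by
    ext x
    rw [Ideal.mem_span_singleton_mul]
    constructor
    · rintro ⟨z, hz, rfl⟩
      exact hz
    · intro hx
      have hx' := hx
      rw [Ideal.mem_span_singleton_mul] at hx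
      obtain ⟨z, hz, rfl⟩ := hx
      obtain ⟨q, hq⟩ := hN.mul_dvd hg hz
      refine ⟨q, ?_, hq.symm⟩
      change cc U * q ∈ Ideal.span {g} * cj I
      rw [← hq]; exact hx'
  refine ⟨J, h1, ?_⟩
  have h2 : Ideal.span {(cc U : S k)} * cj J = Ideal.span {star g} * I := by
    have := congrArg cj h1
    rwa [cj_mul, cj_mul, cj_span, cj_span, st_cc, cj_cj] at this
  have h3 : Ideal.span {(cc U : S k)} * (Ideal.span {(cc U : S k)} * (J * cj J)) =
      Ideal.span {(cc U : S k)} * (Ideal.span {(cc U : S k)} * Ideal.span {cc e}) := by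
    calc _ = (Ideal.span {(cc U : S k)} * J) * (Ideal.span {(cc U : S k)} * cj J) := by ring
      _ = Ideal.span {g} * Ideal.span {star g} * (I * cj I) := by rw [h1, h2]; ring
      _ = _ := by
        rw [hN, Ideal.span_singleton_mul_span_singleton, mul_st, he, map_mul,
          ← Ideal.span_singleton_mul_span_singleton]
        ring
  have inj := fun A B => (Ideal.span_singleton_mul_right_inj (I := A) (J := B) hcU).mp
  exact inj _ _ (inj _ _ h3)

end dv

end N3
end

section
open Polynomial
namespace N3

lemma nm_add {k : Type*} [CommRing k] (x y : S k) : nm (x + y) = nm x + nm y +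
    (2 * (x * star y).re - Rp k * (x * star y).im) := by
  simp [nm_def]; ring

lemma two_poly : (2 : (ZMod 2)[X]) = 0 := by
  have : (2 : (ZMod 2)[X]) = C 2 := rfl
  rw [this, show (2 : ZMod 2) = 0 by decide, C_0]

lemma Rp_monic {k : Type*} [CommRing k] : (Rp k).Monic := by
  unfold Rp
  have : (X ^ 3 + X ^ 2 - 2 * X + 1 : k[X]) = X ^ 3 + (X ^ 2 + C (-2) * X + C 1) := by
    rw [show (C (-2) : k[X]) = -2 by rw [C_neg]; rfl, C_1]; ring
  rw [this]
  rcases subsingleton_or_nontrivial k with h | h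
  · exact Subsingleton.elim _ _
  · apply monic_X_pow_add
    compute_degree!

lemma Rp_natDegree {k : Type*} [CommRing k] [Nontrivial k] : (Rp k).natDegree = 3 := by
  unfold Rp; compute_degree!

lemma Rp_not_dvd_one : ¬ Rp (ZMod 2) ∣ 1 := by
  intro h
  have := natDegree_le_of_dvd h one_ne_zero
  rw [Rp_natDegree, natDegree_one] at this
  omega

lemma exists_odd {I : Ideal (S (ZMod 2))} {U : (ZMod 2)[X]} (hN : HasN I U) (hU : U ≠ 0) :
    ∃ a ∈ I, ¬ (U * Rp (ZMod 2)) ∣ nm a := by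
  by_contra hc
  push Not at hc
  have key : ∀ x ∈ I * cj I, ∃ q, x = cc U * q ∧ Rp (ZMod 2) ∣ nm q := by
    intro x hx
    refine Submodule.mul_induction_on hx ?_ ?_
    · intro a ha b hb
      obtain ⟨q, hq⟩ := hN.mul_dvd ha hb
      refine ⟨q, hq, ?_⟩
      obtain ⟨s, hs⟩ := hc a ha
      obtain ⟨t, ht⟩ := hc (star b) (mem_cj.mp hb)
      rw [nm_st] at ht
      have h1 := congrArg nm hq
      rw [map_mul, map_mul, nm_cc, hs, ht] at h1
      refine ⟨s * (Rp (ZMod 2) * t), ?_⟩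
      apply mul_left_cancel₀ (pow_ne_zero 2 hU)
      rw [← h1]; ring
    · rintro x y ⟨q, rfl, hq⟩ ⟨r, rfl, hr⟩
      refine ⟨q + r, by ring, ?_⟩
      rw [nm_add, two_poly, zero_mul, zero_sub]
      exact dvd_add (dvd_add hq hr) ((dvd_mul_right _ _).neg_right)
  obtain ⟨q, hq, hR⟩ := key (cc U) (by rw [hN]; exact Ideal.mem_span_singleton_self _)
  have hcU : (cc U : S (ZMod 2)) ≠ 0 := fun h0 => hU (by simpa using congrArg QuadraticAlgebra.re h0)
  have : q = 1 := by
    apply mul_left_cancel₀ hcU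
    rw [← hq, mul_one]
  rw [this, map_one] at hR
  exact Rp_not_dvd_one hR

/-- Every class contains an ideal whose norm behaves well modulo two. -/
theorem moving {I : Ideal (S ℤ)} (hI : I ∈ GM ℤ) : ∃ (J : Ideal (S ℤ)) (hJ : J ∈ GM ℤ) (e : ℤ[X]),
    HasN J e ∧ e.IsPrimitive ∧ (e.map (Int.castRingHom (ZMod 2))).natDegree = e.natDegree ∧
    ¬ Rp (ZMod 2) ∣ e.map (Int.castRingHom (ZMod 2)) ∧ cls J hJ = (cls I hI)⁻¹ := by
  obtain ⟨U, hU, hN⟩ := id hI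
  have hU2 := prim_iff.mp hU 2 Nat.prime_two
  set u := U.map (Int.castRingHom (ZMod 2)) with hu
  have hNb : HasN (I.map (iP 2)) u := hN.map _
  obtain ⟨m1, hm1⟩ := move_lift hU hN
  obtain ⟨a, ha, hna⟩ := exists_odd hNb hU2
  -- the modified element
  set j := m1 + a.re.natDegree + 1 with hj
  set p := Rp (ZMod 2) * (u * X ^ j) with hp
  have hp0 : Rp (ZMod 2) ≠ 0 := Rp_monic.ne_zero
  have hXj : (X ^ j : (ZMod 2)[X]) ≠ 0 := pow_ne_zero _ X_ne_zero
  have hpd : p.natDegree = 3 + (u.natDegree + j) := by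
    rw [hp, natDegree_mul hp0 (mul_ne_zero hU2 hXj), natDegree_mul hU2 hXj, Rp_natDegree, natDegree_X_pow]
  set g := a + cc p with hg
  have hgI : g ∈ I.map (iP 2) := by
    refine Ideal.add_mem _ ha ?_
    have : p = u * (Rp (ZMod 2) * X ^ j) := by rw [hp]; ring
    rw [this, map_mul]
    exact Ideal.mul_mem_right _ _ hNb.cc_mem
  have hgre : g.re.natDegree = p.natDegree := by
    have : g.re = a.re + p := by simp [hg]
    rw [this]
    exact natDegree_add_eq_right_of_natDegree_lt (by rw [hpd]; omega)
  have hgn : ¬ (u * Rp (ZMod 2)) ∣ nm g := by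
    intro h
    apply hna
    rw [hg, nm_add, two_poly, zero_mul, zero_sub, nm_cc, st_cc] at h
    have e1 : (a * cc p).im = p * a.im := by rw [mul_comm, cc_mul_im]
    rw [e1, add_assoc] at h
    refine (dvd_add_left ?_).mp h
    refine ⟨X ^ j * p - Rp (ZMod 2) * X ^ j * a.im, ?_⟩
    rw [hp]; ring
  have hg0 : g ≠ 0 := by
    rintro h0
    apply hgn; rw [h0, nm_zero]; exact dvd_zero _
  obtain ⟨hgn0, hgpl⟩ := nm_pl hg0
  set m := (nm g).natDegree with hm
  have hmm : m ≥ m1 := by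
    have := (pl_deg hgpl).1
    rw [hgre, hpd] at this
    omega
  obtain ⟨w, hw, hwg, hwp⟩ := hm1 m hmm g hgI hgpl
  have hw0 : w ≠ 0 := by rintro rfl; simp at hwg; exact hg0 hwg.symm
  obtain ⟨d, hd, x, rfl, hx⟩ := exists_prim hw0
  have hd2 : (d : ZMod 2) = 1 := by
    have h2 : ∀ z : ZMod 2, z = 0 ∨ z = 1 := by decide
    rcases h2 d with h | h
    · exfalso
      rw [map_mul, map_intCast] at hwg
      have : ((d : ℤ) : S (ZMod 2)) = 0 := by
        rw [int_cc]
        have : ((d : ℤ) : (ZMod 2)[X]) = C (d : ZMod 2) := by simp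
        rw [this, h]; simp
      rw [this, zero_mul] at hwg
      exact hg0 hwg.symm
    · exact h
  have hxg : iP 2 x = g := by
    rw [map_mul, map_intCast] at hwg
    have : ((d : ℤ) : S (ZMod 2)) = 1 := by
      rw [int_cc]
      have : ((d : ℤ) : (ZMod 2)[X]) = C (d : ZMod 2) := by simp
      rw [this, hd2]; simp
    rwa [this, one_mul] at hwg
  have hxI : x ∈ I := GM_sat ⟨U, hU, hN⟩ d hd x hw
  have hx0 : x ≠ 0 := right_ne_zero_of_mul hw0
  obtain ⟨e, he⟩ := hN.nm_dvd hxI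
  have he' : nm g = u * e.map (Int.castRingHom (ZMod 2)) := by
    rw [← hxg, nm_mp, he, Polynomial.map_mul]
  have he0 : e ≠ 0 := by
    rintro rfl; rw [mul_zero] at he; exact (nm_pl hx0).1 he
  have heb0 : e.map (Int.castRingHom (ZMod 2)) ≠ 0 := by
    intro h; rw [h, mul_zero] at he'; exact hgn0 he'
  have hpr : e.IsPrimitive := isPrimitive_of_dvd (prim_nm hx) ⟨U, by rw [he, mul_comm]⟩
  obtain ⟨J, hJ, hJN⟩ := div_ideal hN hU.ne_zero hxI he
  have hJG : J ∈ GM ℤ := ⟨e, hpr, hJN⟩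
  refine ⟨J, hJG, e, hJN, hpr, ?_, ?_, ?_⟩
  · have hle : u.natDegree ≤ U.natDegree := natDegree_map_le
    have h1 := pl_nm ((pl_int hd).mp (hwp (m + U.natDegree - u.natDegree) (by rw [← hu]; omega)))
    rw [he, natDegree_mul hU.ne_zero he0] at h1
    have h2 : m = u.natDegree + (e.map (Int.castRingHom (ZMod 2))).natDegree := by
      rw [hm, he', natDegree_mul hU2 heb0]
    have h3 : (e.map (Int.castRingHom (ZMod 2))).natDegree ≤ e.natDegree := natDegree_map_le
    omega
  · intro h
    apply hgn
    rw [he']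
    exact mul_dvd_mul_left _ h
  · rw [← cls_cj, cls_eq]
    exact ⟨cc U, x, fun h0 => hU.ne_zero (by simpa using congrArg QuadraticAlgebra.re h0), hx0, hJ⟩

end N3
end

section
open Polynomial
namespace N3

section fin
variable {k : Type*} [Field k] [NormalizedGCDMonoid k]

lemma prim_fld {U : k[X]} (hU : U ≠ 0) : U.IsPrimitive := by
  intro r hr
  refine isUnit_iff_ne_zero.mpr ?_
  rintro rfl
  rw [C_0, zero_dvd_iff] at hr
  exact hU hr

/-- each class contains an ideal of small norm -/
lemma small_rep (h59 : (5911 : k) ≠ 0) (D : Cl k) : ∃ (J : Ideal (S k)) (hJ : J ∈ GM k) (e : k[X]),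
    e ≠ 0 ∧ HasN J e ∧ e.natDegree ≤ 3 ∧ D = cls J hJ := by
  obtain ⟨I, hI, hD⟩ := cls_surj D⁻¹
  obtain ⟨U, hU, hN⟩ := id hI
  have hr := inter_rank h59 hN hU.ne_zero (U.natDegree + 3)
  have hpos : 0 < Module.finrank k (PL k (U.natDegree + 3) ⊓ I.restrictScalars k : Submodule k (S k)) := by
    omega
  have := PL_finite k (U.natDegree + 3)
  have hne : (PL k (U.natDegree + 3) ⊓ I.restrictScalars k : Submodule k (S k)) ≠ ⊥ := by
    intro h0; rw [h0, finrank_bot] at hpos; omega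
  obtain ⟨g, ⟨hg1, hg2⟩, hg0⟩ := Submodule.exists_mem_ne_zero_of_ne_bot hne
  obtain ⟨e, he⟩ := hN.nm_dvd hg2
  have hn0 := (nm_pl hg0).1
  have he0 : e ≠ 0 := by rintro rfl; simp at he; exact hn0 he
  have hd := pl_nm hg1
  rw [he, natDegree_mul hU.ne_zero he0] at hd
  obtain ⟨J, hJ, hJN⟩ := div_ideal hN hU.ne_zero hg2 he
  have hJG : J ∈ GM k := ⟨e, prim_fld he0, hJN⟩
  refine ⟨J, hJG, e, he0, hJN, by omega, ?_⟩
  rw [← inv_inv D, hD, ← cls_cj hI, cls_eq]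
  exact ⟨g, cc U, hg0, fun h0 => hU.ne_zero (by simpa using congrArg QuadraticAlgebra.re h0), hJ.symm⟩

lemma ideal_gen {I J : Ideal (S k)} {U V : k[X]} (hI : cc U ∈ I) (hJ : cc V ∈ J) (hU : U ≠ 0)
    (hV : V ≠ 0)
    (dU : U.natDegree ≤ 3) (dV : V.natDegree ≤ 3)
    (e : ∀ x ∈ PL k 13, x ∈ I ↔ x ∈ J) : I = J := by
  have key : ∀ {I J : Ideal (S k)} {U V : k[X]} (hI : cc U ∈ I) (hJ : cc V ∈ J) (hU : U ≠ 0)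
    (dU : U.natDegree ≤ 3) (e : ∀ x ∈ PL k 13, x ∈ I ↔ x ∈ J), I ≤ J := by
    intro I J U V hI hJ hU dU e x hx
    have d1 : (cc U : S k) ∈ PL k 13 := pl_of_deg (by simp; omega) (by simp)
    have d2 : ∀ p : k[X], 2 * (p % U).natDegree ≤ 6 := fun p => by
      have := natDegree_le_natDegree (degree_mod_lt p hU).le
      omega
    have hx2 : x - cc U * ⟨x.re / U, x.im / U⟩ = ⟨x.re % U, x.im % U⟩ := by
      ext1
      · simp [EuclideanDomain.mod_eq_sub_mul_div]
      · simp [EuclideanDomain.mod_eq_sub_mul_div]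
    have h3 : x - cc U * ⟨x.re / U, x.im / U⟩ ∈ I := I.sub_mem hx (I.mul_mem_right _ hI)
    have h4 : x - cc U * ⟨x.re / U, x.im / U⟩ ∈ J := by
      refine (e _ ?_).mp h3
      rw [hx2]
      exact pl_of_deg (by have := d2 x.re; dsimp only; omega)
        (Or.inr (by have := d2 x.im; dsimp only; omega))
    have := J.add_mem h4 (J.mul_mem_right (⟨x.re / U, x.im / U⟩ : S k) ((e _ d1).mp hI))
    simpa using this
  exact le_antisymm (key hI hJ hU dU e) (key hJ hI hV dV fun x hx => (e x hx).symm)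

lemma Cl_finite [Finite k] (h59 : (5911 : k) ≠ 0) : Finite (Cl k) := by
  have := PL_finite k 13
  have : Finite (PL k 13) := Module.finite_of_finite k
  choose J hJ e he hN hd hD using small_rep (k := k) h59
  refine Finite.of_injective (fun D : Cl k => ({x : PL k 13 | x.1 ∈ J D} : Set (PL k 13))) ?_
  intro D E h
  have : J D = J E := ideal_gen (hN D).cc_mem (hN E).cc_mem (he D) (he E) (hd D) (hd E)
    fun x hx => by
      have := congrArg (fun s => (⟨x, hx⟩ : PL k 13) ∈ s) h
      simpa using this
  rw [hD D, hD E]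
  congr 1
end fin

end N3
end

section
open Polynomial
namespace N3

section pz
variable (k : Type*) [CommRing k]

/-- element of norm `X ^ 12` -/
noncomputable def gam : S k := ⟨X ^ 6 + X ^ 5 - X ^ 4, X ^ 2 - 1⟩

lemma nm_gam : nm (gam k) = X ^ 12 := by
  rw [nm_def]; simp only [gam, Rp, N3.hp]; ring

lemma tr_cc (z : S k) : z + star z = cc (2 * z.re - Rp k * z.im) := by
  ext1
  · simp; ring
  · simp

lemma gam_tr : gam k + star (gam k) =
    1 - cc X * cc (2 - 3 * X ^ 2 + 3 * X ^ 3 - X ^ 4 - 2 * X ^ 5) := by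
  rw [tr_cc, ← map_one cc, ← map_mul, ← map_sub]
  congr 1
  simp only [gam, Rp]; ring

lemma pow_abs {A : Type*} [CommRing A] (x g g' q : A) (m : ℕ) (hm : 0 < m) (hg : g * g' = x ^ m)
    (e : g = g * g + x ^ m + q * (x * g)) : Ideal.span {x, g} ^ m = Ideal.span {g} := by
  have key : ∀ n : ℕ, n < m → Ideal.span {x, g} ^ (n + 1) = Ideal.span {x ^ (n + 1), g} := by
    intro n
    induction n with
    | zero => intro _; simp
    | succ n ih =>
      intro hn
      rw [pow_succ, ih (by omega)]
      apply le_antisymm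
      · rw [Ideal.span_pair_mul_span_pair, Ideal.span_le]
        have g1 : g ∈ Ideal.span {x ^ (n + 1 + 1), g} := Ideal.subset_span (by simp)
        have g2 : x ^ (n + 1 + 1) ∈ Ideal.span {x ^ (n + 1 + 1), g} :=
          Ideal.subset_span (by simp)
        rintro x (rfl | rfl | rfl | rfl)
        · rw [← pow_succ]; exact g2
        · exact Ideal.mul_mem_left _ _ g1
        · exact Ideal.mul_mem_right _ _ g1
        · exact Ideal.mul_mem_right _ _ g1
      · rw [Ideal.span_le]
        have g1 : g ∈ Ideal.span {x ^ (n + 1), g} := Ideal.subset_span (by simp)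
        have g2 : x ^ (n + 1) ∈ Ideal.span {x ^ (n + 1), g} := Ideal.subset_span (by simp)
        have g3 : g ∈ Ideal.span {x, g} := Ideal.subset_span (by simp)
        have g4 : x ∈ Ideal.span {x, g} := Ideal.subset_span (by simp)
        have hX : x ^ (n + 1 + 1) ∈ Ideal.span {x ^ (n + 1), g} * Ideal.span {x, g} := by
          rw [pow_succ x (n + 1)]; exact Ideal.mul_mem_mul g2 g4
        have hG : g ∈ Ideal.span {x ^ (n + 1), g} * Ideal.span {x, g} := by
          have h12 : x ^ m = x ^ (n + 1 + 1) * x ^ (m - (n + 1 + 1)) := by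
            rw [← pow_add]; congr 1; omega
          have hh : g * g + x ^ (n + 1 + 1) * x ^ (m - (n + 1 + 1)) + q * (g * x) ∈
              Ideal.span {x ^ (n + 1), g} * Ideal.span {x, g} :=
            Ideal.add_mem _ (Ideal.add_mem _ (Ideal.mul_mem_mul g1 g3)
              (Ideal.mul_mem_right _ _ hX)) (Ideal.mul_mem_left _ _ (Ideal.mul_mem_mul g1 g4))
          rwa [← h12, mul_comm g x, ← e] at hh
        rintro z (rfl | rfl)
        · exact hX
        · exact hG
  have h0 := key (m - 1) (by omega)
  rw [Nat.sub_add_cancel hm] at h0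
  rw [h0, ← hg]
  apply le_antisymm
  · rw [Ideal.span_le]
    rintro x (rfl | rfl)
    · exact Ideal.mul_mem_right _ _ (Ideal.mem_span_singleton_self _)
    · exact Ideal.mem_span_singleton_self _
  · exact Ideal.span_mono (by simp)

/-- the prime at the point `(0,0)` -/
noncomputable def p0 : Ideal (S k) := Ideal.span {cc X, gam k}

variable {k}
lemma gam_mem : gam k ∈ p0 k := Ideal.subset_span (by simp)
lemma X_mem : cc X ∈ p0 k := Ideal.subset_span (by simp)

lemma cj_p0 : cj (p0 k) = Ideal.span {cc X, star (gam k)} := by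
  apply le_antisymm
  · intro x hx
    rw [mem_cj, p0, Ideal.mem_span_pair] at hx
    obtain ⟨a, b, e⟩ := hx
    rw [Ideal.mem_span_pair]
    refine ⟨star a, star b, ?_⟩
    rw [← star_star x, ← e, star_add, star_mul', star_mul', st_cc]
  · rw [Ideal.span_le]
    rintro x (rfl | rfl)
    · rw [SetLike.mem_coe, mem_cj, st_cc]; exact X_mem
    · rw [SetLike.mem_coe, mem_cj, star_star]; exact gam_mem

lemma p0_sup : p0 k ⊔ cj (p0 k) = ⊤ := by
  rw [Ideal.eq_top_iff_one]
  have e : (1 : S k) = (gam k + cc (2 - 3 * X ^ 2 + 3 * X ^ 3 - X ^ 4 - 2 * X ^ 5) * cc X) + star (gam k) := by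
    have := gam_tr k
    linear_combination -this
  rw [e]
  refine Submodule.add_mem_sup ((p0 k).add_mem gam_mem ((p0 k).mul_mem_left _ X_mem)) ?_
  rw [mem_cj, star_star]; exact gam_mem

lemma p0_hasN : HasN (p0 k) X := by
  have hg : gam k * star (gam k) = cc X ^ 12 := by rw [mul_st, nm_gam, map_pow]
  apply le_antisymm
  · rw [cj_p0, p0, Ideal.span_pair_mul_span_pair, Ideal.span_le]
    rintro x hx
    rw [SetLike.mem_coe, Ideal.mem_span_singleton]
    rcases hx with rfl | rfl | rfl | rfl
    · exact Dvd.intro _ rfl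
    · exact Dvd.intro _ rfl
    · exact Dvd.intro_left _ rfl
    · rw [hg]; exact dvd_pow_self _ (by norm_num)
  · rw [Ideal.span_le, Set.singleton_subset_iff, SetLike.mem_coe]
    have e : (cc X : S k) = gam k * cc X + cc X * star (gam k) +
        cc (2 - 3 * X ^ 2 + 3 * X ^ 3 - X ^ 4 - 2 * X ^ 5) * (cc X * cc X) := by
      have := gam_tr k
      linear_combination (-cc X) * this
    have c1 : cc X ∈ cj (p0 k) := by rw [mem_cj, st_cc]; exact X_mem
    have c2 : star (gam k) ∈ cj (p0 k) := by rw [mem_cj, star_star]; exact gam_mem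
    rw [e]
    exact Ideal.add_mem _ (Ideal.add_mem _ (Ideal.mul_mem_mul gam_mem c1)
      (Ideal.mul_mem_mul X_mem c2)) (Ideal.mul_mem_left _ _ (Ideal.mul_mem_mul X_mem c1))

lemma p0_pow_aux (m : ℕ) (hm : m = 12) : p0 k ^ m = Ideal.span {gam k} := by
  have hg : gam k * star (gam k) = cc X ^ m := by rw [mul_st, nm_gam, map_pow, hm]
  have e : (gam k : S k) = gam k * gam k + cc X ^ m +
      cc (2 - 3 * X ^ 2 + 3 * X ^ 3 - X ^ 4 - 2 * X ^ 5) * (cc X * gam k) := by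
    have := gam_tr k
    linear_combination (-gam k) * this + hg
  exact pow_abs (cc X) (gam k) (star (gam k)) (cc (2 - 3 * X ^ 2 + 3 * X ^ 3 - X ^ 4 - 2 * X ^ 5))
    m (by omega) hg e

lemma p0_pow : p0 k ^ 12 = Ideal.span {gam k} := p0_pow_aux 12 rfl

lemma p0_map {l : Type*} [CommRing l] (φ : k →+* l) : (p0 k).map (mp φ) = p0 l := by
  rw [p0, Ideal.map_span, Set.image_pair, mp_cc, Polynomial.map_X]
  have : mp φ (gam k) = gam l := by
    ext1 <;> simp [gam]
  rw [this, p0]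
end pz

section pz2
variable {k : Type*} [CommRing k] [IsDomain k] [NormalizedGCDMonoid k]
lemma p0_GM : p0 k ∈ GM k := ⟨X, monic_X.isPrimitive, p0_hasN⟩

/-- the class of `p0` -/
noncomputable def P0 (k : Type*) [CommRing k] [IsDomain k] [NormalizedGCDMonoid k] : Cl k :=
  cls (p0 k) p0_GM

lemma gam_ne : gam k ≠ 0 := by
  intro h
  have := nm_gam k
  rw [h, nm_zero] at this
  exact pow_ne_zero 12 X_ne_zero this.symm

lemma P0_12 : P0 k ^ 12 = 1 := by
  rw [P0, cls_pow, cls_eq_one]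
  exact ⟨gam k, gam_ne, p0_pow⟩
end pz2

lemma red_P0 : red (P0 ℤ) = P0 (ZMod 2) := by
  rw [P0, red_cls, P0]
  congr 1
  exact p0_map _

lemma P0_6 : P0 (ZMod 2) ^ 6 ≠ 1 := by
  intro h
  rw [P0, cls_pow, cls_eq_one] at h
  obtain ⟨x, hx, e⟩ := h
  have hN : ∀ n, HasN (p0 (ZMod 2) ^ n) (X ^ n) := by
    intro n
    induction n with
    | zero => simpa using hasN_one
    | succ n ih => rw [pow_succ, pow_succ]; exact ih.mul p0_hasN
  have ha := hasN_unique (hN 6) (e ▸ hasN_span x)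
  have hd : (nm x).natDegree = 6 := by
    rw [← natDegree_eq_of_degree_eq (degree_eq_degree_of_associated ha), natDegree_X_pow]
  have hp := (nm_pl hx).2
  rw [hd] at hp
  have him : x.im = 0 := by
    rcases (pl_deg hp).2 with h | h
    · exact h
    · omega
  have hxc : x = cc x.re := by ext1 <;> simp [him]
  have hn : nm x = x.re ^ 2 := by rw [hxc, nm_cc]; simp
  rw [hn] at ha
  have hu : Associated (X ^ 3 : (ZMod 2)[X]) x.re := by
    have h1 : (X ^ 3 : (ZMod 2)[X]) ^ 2 ∣ x.re ^ 2 := by rw [← pow_mul]; exact ha.dvd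
    have h2 : x.re ^ 2 ∣ (X ^ 3 : (ZMod 2)[X]) ^ 2 := by rw [← pow_mul]; exact ha.symm.dvd
    exact associated_of_dvd_dvd ((UniqueFactorizationMonoid.pow_dvd_pow_iff_dvd (by norm_num)).mp h1)
      ((UniqueFactorizationMonoid.pow_dvd_pow_iff_dvd (by norm_num)).mp h2)
  have h3 : p0 (ZMod 2) ^ 6 = Ideal.span {cc (X ^ 3)} := by
    rw [e, hxc, Ideal.span_singleton_eq_span_singleton]
    exact (hu.map cc).symm
  have h4 : p0 (ZMod 2) ^ 3 * p0 (ZMod 2) ^ 3 = p0 (ZMod 2) ^ 3 * cj (p0 (ZMod 2) ^ 3) := by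
    rw [hN 3, ← h3, ← pow_add]
  have h5 : p0 (ZMod 2) ^ 3 = cj (p0 (ZMod 2) ^ 3) := (hN 3).cancel (by simp) h4
  have h6 : p0 (ZMod 2) ^ 3 ⊔ cj (p0 (ZMod 2) ^ 3) = ⊤ := by
    rw [cj_pow]
    exact Ideal.pow_sup_pow_eq_top p0_sup
  rw [← h5, sup_idem] at h6
  have h7 := hasN_unique (hN 3) (show HasN _ 1 by rw [h6, ← Ideal.one_eq_top]; exact hasN_one)
  have := degree_eq_degree_of_associated h7
  simp at this

end N3
end

section
open Polynomial
namespace N3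

lemma pl_mul {k : Type*} [CommRing k] [IsDomain k] {a b : ℕ} {z w : S k} (hz : pl a z)
    (hw : pl b w) : pl (a + b) (z * w) := by
  by_cases h : z * w = 0
  · rw [h]; exact (PL k _).zero_mem
  refine pl_mono ?_ (nm_pl h).2
  rw [map_mul]
  exact natDegree_mul_le.trans (add_le_add (pl_nm hz) (pl_nm hw))

lemma pl_pow {k : Type*} [CommRing k] [IsDomain k] {a : ℕ} {z : S k} (hz : pl a z) (n : ℕ) :
    pl (n * a) (z ^ n) := by
  induction n with
  | zero =>
    rw [pow_zero]
    exact pl_of_deg (by simp [QuadraticAlgebra.re_one]) (by simp [QuadraticAlgebra.im_one])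
  | succ n ih => rw [pow_succ, add_mul, one_mul]; exact pl_mul ih hz

lemma pl_mp {k l : Type*} [CommRing k] [CommRing l] (φ : k →+* l) {n : ℕ} {z : S k} (hz : pl n z) :
    pl n (mp φ z) :=
  ⟨fun i hi => by simp [hz.1 i hi], fun i hi => by simp [hz.2 i hi]⟩

lemma pl_lift {k l : Type*} [CommRing k] [CommRing l] (φ : k →+* l) (hφ : Function.Surjective φ)
    {n : ℕ} {z : S l} (hz : pl n z) : ∃ w, pl n w ∧ mp φ w = z := by
  have key : ∀ p : l[X], ∃ q : k[X], q.map φ = p ∧ q.degree = p.degree := fun p => by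
    refine mem_lifts_and_degree_eq ((lifts_iff_set_range p).mpr ?_)
    exact map_surjective φ hφ p
  obtain ⟨a, ha, da⟩ := key z.re
  obtain ⟨b, hb, db⟩ := key z.im
  obtain ⟨h1, h2⟩ := pl_deg hz
  refine ⟨⟨a, b⟩, pl_of_deg ?_ ?_, by ext1 <;> simp [ha, hb]⟩
  · dsimp only; rw [natDegree_eq_of_degree_eq da]; exact h1
  · dsimp only; rw [natDegree_eq_of_degree_eq db]
    refine h2.imp_left fun h => ?_
    rw [h, degree_zero, degree_eq_bot] at db
    exact db

lemma pl_div {k : Type*} [CommRing k] {W : k[X]} (hW : IsUnit W.leadingCoeff) {d : ℕ} {z : S k}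
    (h : pl (d + 2 * W.natDegree) (cc W * z)) : pl d z := by
  obtain ⟨h1, h2⟩ := pl_deg h
  have key : ∀ p : k[X], p ≠ 0 → (W * p).natDegree = W.natDegree + p.natDegree ∧ W * p ≠ 0 :=
    fun p hp => by
      have : W.leadingCoeff * p.leadingCoeff ≠ 0 := by
        rw [Ne, hW.mul_right_eq_zero]; exact leadingCoeff_ne_zero.mpr hp
      refine ⟨natDegree_mul' this, fun h0 => this ?_⟩
      rw [← leadingCoeff_mul' this, h0, leadingCoeff_zero]
  rw [cc_mul_re] at h1
  rw [cc_mul_im] at h2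
  refine pl_of_deg ?_ ?_
  · by_cases h0 : z.re = 0
    · simp [h0]
    · rw [(key _ h0).1] at h1; omega
  · by_cases h0 : z.im = 0
    · exact Or.inl h0
    · rw [(key _ h0).1] at h2
      rcases h2 with h2 | h2
      · exact absurd h2 (key _ h0).2
      · right; omega

lemma gen_of_nm {k : Type*} [Field k] {I : Ideal (S k)} {U : k[X]} (hN : HasN I U) (hU : U ≠ 0)
    {x : S k} (hx : x ∈ I) (hx0 : x ≠ 0) (hd : (nm x).natDegree ≤ U.natDegree) :
    I = Ideal.span {x} := by
  obtain ⟨e, he⟩ := hN.nm_dvd hx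
  have hn0 := (nm_pl hx0).1
  have he0 : e ≠ 0 := by rintro rfl; simp at he; exact hn0 he
  rw [he, natDegree_mul hU he0] at hd
  obtain ⟨c, rfl⟩ : ∃ c, e = C c := ⟨_, eq_C_of_natDegree_eq_zero (by omega)⟩
  have hc : c ≠ 0 := fun h => he0 (by simp [h])
  have hcU : (cc U : S k) ≠ 0 := fun h0 => hU (by simpa using congrArg QuadraticAlgebra.re h0)
  apply le_antisymm
  · intro z hz
    obtain ⟨q, hq⟩ := hN.mul_dvd hz (show star x ∈ cj I by rw [mem_cj, star_star]; exact hx)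
    rw [Ideal.mem_span_singleton]
    refine ⟨cc (C c⁻¹) * q, ?_⟩
    apply mul_left_cancel₀ hcU
    have h1 : cc (C c) * cc (C c⁻¹) = (1 : S k) := by
      rw [← map_mul, ← C_mul, mul_inv_cancel₀ hc, C_1, map_one]
    have h2 : x * star x = cc U * cc (C c) := by rw [mul_st, he, map_mul]
    linear_combination (-cc U * z) * h1 + (z * cc (C c⁻¹)) * (-h2) + x * cc (C c⁻¹) * hq
  · rw [Ideal.span_le, Set.singleton_subset_iff]; exact hx

lemma one_of_mem {I : Ideal (S ℤ)} (hI : I ∈ GM ℤ) {U : ℤ[X]} (hN : HasN I U) (hU : U ≠ 0)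
    {x : S ℤ} (hx : x ∈ I) (hx0 : x ≠ 0) (hp : pl U.natDegree x) : cls I hI = 1 := by
  have hx0' : iQ x ≠ 0 := fun h => hx0 (iQ_inj (by rw [h, map_zero]))
  refine principal_of_rat hI hx0' ?_
  have hUQ : U.map (Int.castRingHom ℚ) ≠ 0 := by
    rw [Ne, Polynomial.map_eq_zero_iff (RingHom.injective_int _)]; exact hU
  refine gen_of_nm (hN.map _) hUQ (Ideal.mem_map_of_mem _ hx) hx0' ?_
  rw [nm_mp, natDegree_map_eq_of_injective (RingHom.injective_int _),
    natDegree_map_eq_of_injective (RingHom.injective_int _)]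
  exact pl_nm hp

lemma two_adic {a : ℕ} {n : ℤ} (hn : ¬ (2 : ℤ) ^ a ∣ n) {x : S ℤ}
    (h : (2 : S ℤ) ^ a ∣ (n : S ℤ) * x) : (2 : S ℤ) ∣ x := by
  have h1 := (Int.gcd_dvd_left ((2 : ℤ) ^ a) n)
  obtain ⟨b, hb, hb'⟩ := (Nat.dvd_prime_pow Nat.prime_two).mp
    (show (Int.gcd ((2 : ℤ) ^ a) n) ∣ 2 ^ a by exact_mod_cast h1)
  have hlt : b < a := by
    refine lt_of_le_of_ne hb fun hab => hn ?_
    have := Int.gcd_dvd_right ((2 : ℤ) ^ a) n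
    rw [hb', hab] at this
    exact_mod_cast this
  have h2 : (2 : S ℤ) ^ a ∣ 2 ^ b * x := by
    have hbz := congrArg (Int.cast : ℤ → S ℤ) (Int.gcd_eq_gcd_ab ((2 : ℤ) ^ a) n)
    rw [hb'] at hbz
    push_cast at hbz
    rw [hbz, add_mul]
    refine dvd_add ?_ ?_
    · rw [mul_assoc]; exact Dvd.intro _ rfl
    · rw [mul_right_comm]; exact h.mul_right _
  obtain ⟨c, rfl⟩ : ∃ c, a = b + 1 + c := ⟨a - b - 1, by omega⟩
  have h20 : (2 : S ℤ) ≠ 0 := by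
    intro h
    have h' : (cc 2 : S ℤ) = cc 0 := by rw [map_ofNat, map_zero, h]
    exact two_ne_zero (cc_inj.mp h')
  rw [add_assoc, pow_add] at h2
  have h3 := (mul_dvd_mul_iff_left (pow_ne_zero b h20)).mp h2
  exact (dvd_pow_self 2 (by omega)).trans h3

end N3
end

section
open Polynomial
namespace N3

lemma pseudo_div {U : ℤ[X]} (hU : U ≠ 0) (n : ℕ) : ∀ p : ℤ[X], p.natDegree ≤ n →
    ∃ (m : ℕ) (q r : ℤ[X]), C (U.leadingCoeff ^ m) * p = U * q + r ∧ r.natDegree ≤ U.natDegree := by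
  induction n with
  | zero => exact fun p hp => ⟨0, 0, p, by simp, by omega⟩
  | succ n ih =>
    intro p hp
    by_cases h : p.natDegree ≤ U.natDegree
    · exact ⟨0, 0, p, by simp, h⟩
    have hp0 : p ≠ 0 := by rintro rfl; simp at h
    have hu : U.leadingCoeff ≠ 0 := leadingCoeff_ne_zero.mpr hU
    have hlp : p.leadingCoeff ≠ 0 := leadingCoeff_ne_zero.mpr hp0
    set k := p.natDegree - U.natDegree with hk
    have hd : (C U.leadingCoeff * p).natDegree = p.natDegree := natDegree_C_mul hu
    have hlt : degree (C U.leadingCoeff * p - U * (C p.leadingCoeff * X ^ k)) <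
        degree (C U.leadingCoeff * p) := by
      apply degree_sub_lt
      · rw [degree_eq_natDegree (mul_ne_zero (C_ne_zero.mpr hu) hp0), hd,
          degree_eq_natDegree (mul_ne_zero hU (mul_ne_zero (C_ne_zero.mpr hlp) (pow_ne_zero _ X_ne_zero))),
          natDegree_mul hU (mul_ne_zero (C_ne_zero.mpr hlp) (pow_ne_zero _ X_ne_zero)),
          natDegree_C_mul_X_pow _ _ hlp]
        congr 1; omega
      · exact mul_ne_zero (C_ne_zero.mpr hu) hp0
      · simp only [leadingCoeff_mul, leadingCoeff_C, leadingCoeff_X_pow, mul_one]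
    set p1 := C U.leadingCoeff * p - U * (C p.leadingCoeff * X ^ k) with hp1
    have hn : p1.natDegree ≤ n := by
      by_cases h1 : p1 = 0
      · simp [h1]
      · have := natDegree_lt_natDegree h1 hlt
        omega
    obtain ⟨m, q, r, e, hr⟩ := ih p1 hn
    refine ⟨m + 1, q + C (U.leadingCoeff ^ m) * (C p.leadingCoeff * X ^ k), r, ?_, hr⟩
    rw [hp1] at e
    rw [pow_succ, C_mul]
    linear_combination e

lemma fg_clear (T : Submodule ℤ (S ℚ)) (hT : T.FG) :
    ∃ N : ℤ, N ≠ 0 ∧ ∀ x ∈ T, ∃ w : S ℤ, iQ w = (N : S ℚ) * x := by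
  induction T, hT using Submodule.fg_induction with
  | singleton x =>
    obtain ⟨n, hn, w, hw⟩ := S_clear x
    refine ⟨n, hn, fun y hy => ?_⟩
    obtain ⟨c, rfl⟩ := Submodule.mem_span_singleton.mp hy
    refine ⟨c • w, ?_⟩
    rw [map_zsmul, hw, mul_smul_comm]
  | sup A B hA hB h1 h2 =>
    obtain ⟨n, hn, h1⟩ := h1
    obtain ⟨m, hm, h2⟩ := h2
    refine ⟨n * m, mul_ne_zero hn hm, fun y hy => ?_⟩
    obtain ⟨a, ha, b, hb, rfl⟩ := Submodule.mem_sup.mp hy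
    obtain ⟨w, hw⟩ := h1 a ha
    obtain ⟨v, hv⟩ := h2 b hb
    refine ⟨m * w + n * v, ?_⟩
    rw [map_add, map_mul, map_mul, hw, hv]
    simp only [map_intCast]
    push_cast; ring

lemma lin_clear {I : Ideal (S ℤ)} {U : ℤ[X]} (hN : HasN I U) (hU : U ≠ 0)
    (hodd : ¬ (2 : ℤ) ∣ U.leadingCoeff) (h0 : ∀ x ∈ I, pl U.natDegree x → x = 0) :
    ∃ N : ℤ, N ≠ 0 ∧ ∀ (c : ℤ) (μ z : S ℤ), pl U.natDegree μ → μ + c * z ∈ I →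
      ∃ t : ℤ, ¬ (2 : ℤ) ∣ t ∧ (c : S ℤ) ∣ ((t * N : ℤ) : S ℤ) * μ := by
  set d := U.natDegree with hd
  let Q := (I.map iQ).restrictScalars ℚ
  let f : PL ℚ d →ₗ[ℚ] (S ℚ ⧸ Q) := Q.mkQ.comp (PL ℚ d).subtype
  have hf : LinearMap.ker f = ⊥ := by
    rw [LinearMap.ker_eq_bot']
    rintro ⟨x, hx⟩ hfx
    have hxQ : x ∈ I.map iQ := by
      have : Q.mkQ x = 0 := hfx
      rwa [Submodule.mkQ_apply, Submodule.Quotient.mk_eq_zero] at this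
    obtain ⟨n, hn, w, hw, e⟩ := map_mem_clear hxQ
    have hw0 : w = 0 := h0 w hw (by
      rw [← pl_iQ, e, pl_rat hn]; exact hx)
    rw [hw0, map_zero, eq_comm, mul_eq_zero] at e
    apply Subtype.ext
    rcases e with e | e
    · exact absurd e (isUnit_int hn).ne_zero
    · exact e
  obtain ⟨g, hg⟩ := LinearMap.exists_leftInverse_of_injective f hf
  let L : S ℚ →ₗ[ℚ] S ℚ := (PL ℚ d).subtype.comp (g.comp Q.mkQ)
  have hL1 : ∀ x ∈ I.map iQ, L x = 0 := by
    intro x hx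
    have : Q.mkQ x = 0 := by
      rw [Submodule.mkQ_apply, Submodule.Quotient.mk_eq_zero]; exact hx
    simp only [L, LinearMap.comp_apply, this, map_zero]
  have hL2 : ∀ x, pl d x → L x = x := by
    intro x hx
    have := LinearMap.congr_fun hg ⟨x, hx⟩
    exact congrArg Subtype.val this
  let ι : S ℤ →ₗ[ℤ] S ℚ := (iQ : S ℤ →+* S ℚ).toAddMonoidHom.toIntLinearMap
  let Lz : S ℤ →ₗ[ℤ] S ℚ := (L.restrictScalars ℤ).comp ι
  have hLz : ∀ x, Lz x = L (iQ x) := fun x => rfl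
  have hfin := PL_finite ℤ (2 * d + 7)
  have hfg : ((PL ℤ (2 * d + 7)).map Lz).FG :=
    Submodule.FG.map _ ((Submodule.fg_top _).mp hfin.fg_top)
  obtain ⟨N, hN0, hNc⟩ := fg_clear _ hfg
  refine ⟨N, hN0, fun c μ z hμ hmem => ?_⟩
  obtain ⟨m1, q1, r1, e1, d1⟩ := pseudo_div hU _ z.re le_rfl
  obtain ⟨m2, q2, r2, e2, d2⟩ := pseudo_div hU _ z.im le_rfl
  set u := U.leadingCoeff with hu
  set t := u ^ m1 * u ^ m2 with ht
  have hto : ¬ (2 : ℤ) ∣ t := by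
    rw [ht, ← pow_add]
    exact fun h => hodd (Int.prime_two.dvd_of_dvd_pow h)
  have hz : (t : S ℤ) * z = cc U * ⟨C (u ^ m2) * q1, C (u ^ m1) * q2⟩ +
      ⟨C (u ^ m2) * r1, C (u ^ m1) * r2⟩ := by
    have ht' : (t : S ℤ) = cc (C t) := by simp
    rw [ht']
    ext1
    · simp only [cc_mul_re, QuadraticAlgebra.re_add]
      rw [ht, C_mul]; linear_combination (C (u ^ m2)) * e1
    · simp only [cc_mul_im, QuadraticAlgebra.im_add]
      rw [ht, C_mul]; linear_combination (C (u ^ m1)) * e2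
  set ρ : S ℤ := ⟨C (u ^ m2) * r1, C (u ^ m1) * r2⟩ with hρ
  have hρP : ρ ∈ PL ℤ (2 * d + 7) := by
    have a1 := natDegree_C_mul_le (u ^ m2) r1
    have a2 := natDegree_C_mul_le (u ^ m1) r2
    exact pl_of_deg (by simp only [hρ]; omega) (Or.inr (by simp only [hρ]; omega))
  obtain ⟨w, hw⟩ := hNc (Lz ρ) ⟨ρ, hρP, rfl⟩
  refine ⟨t, hto, -w, ?_⟩
  apply iQ_inj
  have hsm : ∀ (n : ℤ) (x : S ℚ), L ((n : S ℚ) * x) = n * L x := fun n x => by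
    rw [← zsmul_eq_mul, map_zsmul, zsmul_eq_mul]
  have k1 : L (iQ ((t : S ℤ) * z)) = Lz ρ := by
    rw [hz, map_add, map_add, hL1, zero_add, hLz]
    exact Ideal.mem_map_of_mem _ (I.mul_mem_right _ hN.cc_mem)
  have k2 := hL1 _ (Ideal.mem_map_of_mem iQ hmem)
  rw [map_add, map_add, hL2 _ (pl_iQ.mpr hμ), map_mul, map_intCast, hsm] at k2
  rw [map_mul, map_intCast, hsm] at k1
  rw [map_mul, map_mul, map_neg, map_intCast, map_intCast, hw, ← k1]
  push_cast
  linear_combination (t * N : S ℚ) * k2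
end N3
end

section
open Polynomial
namespace N3

lemma good_rep (D : Cl ℤ) : ∃ (J : Ideal (S ℤ)) (hJ : J ∈ GM ℤ) (e : ℤ[X]),
    HasN J e ∧ e.IsPrimitive ∧ (e.map (Int.castRingHom (ZMod 2))).natDegree = e.natDegree ∧
    ¬ (2 : ℤ) ∣ e.leadingCoeff ∧
    ¬ Rp (ZMod 2) ∣ e.map (Int.castRingHom (ZMod 2)) ∧ D = cls J hJ := by
  obtain ⟨I, hI, hD⟩ := cls_surj D⁻¹
  obtain ⟨J, hJ, e, h1, h2, h3, h4, h5⟩ := moving hI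
  refine ⟨J, hJ, e, h1, h2, h3, fun h => ?_, h4, by rw [h5, ← hD, inv_inv]⟩
  have h0 := prim_iff.mp h2 2 Nat.prime_two
  rw [← leadingCoeff_ne_zero, leadingCoeff, h3, coeff_map] at h0
  exact h0 ((ZMod.intCast_zmod_eq_zero_iff_dvd _ 2).mpr (by exact_mod_cast h))

lemma nm_gen {I : Ideal (S ℤ)} {U : ℤ[X]} (hN : HasN I U) {x : S ℤ} (e : I = Ideal.span {x}) :
    Associated U (nm x) := by
  have h1 : Ideal.span {(cc U : S ℤ)} = Ideal.span {cc (nm x)} := by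
    rw [← hN, ← hasN_span x, ← e]
  have h2 := Ideal.span_singleton_eq_span_singleton.mp h1
  exact associated_of_dvd_dvd ((cc_dvd_cc _ _).mp h2.dvd) ((cc_dvd_cc _ _).mp h2.symm.dvd)

lemma hasN_pow {k : Type*} [CommRing k] {I : Ideal (S k)} {U : k[X]} (h : HasN I U) (n : ℕ) :
    HasN (I ^ n) (U ^ n) := by
  induction n with
  | zero => simpa using hasN_one
  | succ n ih => rw [pow_succ, pow_succ]; exact ih.mul h

lemma pow_congr_two {A : Type*} [CommRing A] (x y : A) (r : ℕ) (h : (2 : A) ∣ x - y) :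
    (2 : A) ^ (r + 1) ∣ x ^ 2 ^ r - y ^ 2 ^ r := by
  induction r with
  | zero => simpa using h
  | succ r ih =>
    rw [pow_succ 2 r, pow_mul, pow_mul, sq_sub_sq, pow_succ (2 : A) (r + 1), mul_comm (x ^ 2 ^ r + _)]
    refine mul_dvd_mul ih ?_
    obtain ⟨c, hc⟩ := (dvd_pow_self (2 : A) (Nat.succ_ne_zero r)).trans ih
    exact ⟨c + y ^ 2 ^ r, by linear_combination hc⟩

lemma prim_pow {V : ℤ[X]} (hV : V.IsPrimitive) (n : ℕ) : (V ^ n).IsPrimitive := by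
  induction n with
  | zero => simpa using isPrimitive_one
  | succ n ih => rw [pow_succ]; exact ih.mul hV

/-- approximations -/
lemma approx {I J : Ideal (S ℤ)} (hI : I ∈ GM ℤ) (hJ : J ∈ GM ℤ) {U V : ℤ[X]} (hN : HasN I U)
    (hU : U.IsPrimitive) (hV : V.IsPrimitive)
    (hM : HasN J V) (hd : (V.map (Int.castRingHom (ZMod 2))).natDegree = V.natDegree)
    (hVo : ¬ (2 : ℤ) ∣ V.leadingCoeff) (r : ℕ) (hp : cls I hI = cls J hJ ^ 2 ^ r)
    (hred : red (cls J hJ) = 1) :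
    ∃ μ z : S ℤ, pl U.natDegree μ ∧ μ + ((2 ^ (r + 1) : ℤ) : S ℤ) * z ∈ I ∧ ¬ (2 : S ℤ) ∣ μ := by
  rw [red_cls, cls_eq_one] at hred
  obtain ⟨f, hf0, hf⟩ := hred
  have hV2 := prim_iff.mp hV 2 Nat.prime_two
  have hass := hasN_unique (hM.map (Int.castRingHom (ZMod 2))) (hf ▸ hasN_span f)
  have hfd : pl V.natDegree f := by
    have := (nm_pl hf0).2
    rwa [← natDegree_eq_of_degree_eq (degree_eq_degree_of_associated hass), hd] at this
  obtain ⟨φ, hφ, hφf⟩ := (Ideal.mem_map_iff_of_surjective (iP 2) (iP_surj 2)).mp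
    (hf ▸ Ideal.mem_span_singleton_self f : f ∈ J.map (iP 2))
  obtain ⟨φ0, hφ0, hφ0f⟩ := pl_lift (Int.castRingHom (ZMod 2)) ZMod.intCast_surjective hfd
  have h2 : (2 : S ℤ) ∣ φ - φ0 := by
    have := (iP_ker 2 (φ - φ0)).mp (by rw [map_sub, hφf, hφ0f, sub_self])
    exact_mod_cast this
  set n := 2 ^ r with hn
  have hprin : cls (I * cj J ^ n) ((GM ℤ).mul_mem hI ((GM ℤ).pow_mem (GM_cj hJ) n)) = 1 := by
    rw [← cls_mul hI ((GM ℤ).pow_mem (GM_cj hJ) n), ← cls_pow (GM_cj hJ) n, cls_cj hJ, hp, inv_pow,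
      mul_inv_cancel]
  rw [cls_eq_one] at hprin
  obtain ⟨χ, hχ0, hχ⟩ := hprin
  have hχN := nm_gen (hN.mul (hasN_pow hM.cj n)) hχ
  have hχm : χ ∈ I * cj J ^ n := hχ ▸ Ideal.mem_span_singleton_self χ
  -- the quotient
  obtain ⟨l, hl, hle⟩ : ∃ l ∈ I, cc (V ^ n) * l = χ * φ ^ n := by
    have h1 : χ * φ ^ n ∈ I * Ideal.span {cc (V ^ n)} := by
      have h3 : I * Ideal.span {cc (V ^ n)} = I * cj J ^ n * J ^ n := by
        have := hasN_pow hM n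
        rw [HasN, cj_pow] at this
        rw [← this]; ring
      rw [h3]
      exact Ideal.mul_mem_mul hχm (Ideal.pow_mem_pow hφ n)
    rw [mul_comm, Ideal.mem_span_singleton_mul] at h1
    exact h1
  have hl2 : iP 2 l ≠ 0 := by
    intro h0
    have h1 := congrArg (iP 2) hle
    rw [map_mul, h0, mul_zero, map_mul, map_pow, hφf, eq_comm, mul_eq_zero] at h1
    rcases h1 with h1 | h1
    · have h3 : (nm χ).IsPrimitive := by
        obtain ⟨c, hc⟩ := hχN.symm.dvd
        exact isPrimitive_of_dvd (hU.mul (prim_pow hV n)) ⟨c, hc⟩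
      have := prim_iff.mp h3 2 Nat.prime_two
      rw [← nm_mp, h1, nm_zero] at this
      exact this rfl
    · exact hf0 ((pow_eq_zero_iff (by positivity)).mp h1)
  -- modulo a power of two
  set M := 2 ^ (r + 1) with hM'
  have hunit : IsUnit ((Int.castRingHom (ZMod M)) V.leadingCoeff) := by
    have hc : IsCoprime V.leadingCoeff ((2 : ℤ) ^ (r + 1)) :=
      ((Int.prime_two.coprime_iff_not_dvd.mpr hVo).symm).pow_right
    obtain ⟨a, b, hab⟩ := hc
    have h3 := congrArg (Int.castRingHom (ZMod M)) hab
    have h4 : (Int.castRingHom (ZMod M)) (2 ^ (r + 1)) = 0 := by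
      rw [eq_intCast, ZMod.intCast_zmod_eq_zero_iff_dvd, hM']; push_cast; exact dvd_rfl
    rw [map_add, map_mul, map_mul, h4, mul_zero, add_zero, map_one] at h3
    exact IsUnit.of_mul_eq_one_right _ h3
  have hM1 : 1 < M := Nat.one_lt_two_pow (by omega)
  have : Fact (1 < M) := ⟨hM1⟩
  have hlead : ((V ^ n).map (Int.castRingHom (ZMod M))).natDegree = n * V.natDegree ∧
      IsUnit ((V ^ n).map (Int.castRingHom (ZMod M))).leadingCoeff := by
    have hu : IsUnit ((Int.castRingHom (ZMod M)) (V ^ n).leadingCoeff) := by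
      rw [leadingCoeff_pow, map_pow]; exact hunit.pow n
    constructor
    · rw [natDegree_map_of_leadingCoeff_ne_zero _ hu.ne_zero, natDegree_pow]
    · rw [leadingCoeff_map_of_leadingCoeff_ne_zero _ hu.ne_zero]; exact hu
  have hML : ((M : ℕ) : S ℤ) = 2 ^ (r + 1) := by rw [hM']; push_cast; rfl
  have hpl : pl U.natDegree (iP M l) := by
    refine pl_div hlead.2 ?_
    have h3 : cc ((V ^ n).map (Int.castRingHom (ZMod M))) * iP M l = iP M (χ * φ0 ^ n) := by
      rw [← mp_cc, ← map_mul, hle, ← sub_eq_zero, ← map_sub, iP_ker, ← mul_sub, hML]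
      exact (pow_congr_two φ φ0 r h2).mul_left _
    rw [h3, hlead.1]
    refine pl_mp _ ?_
    have h4 : pl (U.natDegree + n * V.natDegree) χ := by
      have := (nm_pl hχ0).2
      rwa [← natDegree_eq_of_degree_eq (degree_eq_degree_of_associated hχN),
        natDegree_mul hU.ne_zero (pow_ne_zero _ hV.ne_zero), natDegree_pow] at this
    refine pl_mono ?_ (pl_mul h4 (pl_pow hφ0 n))
    ring_nf; exact le_rfl
  obtain ⟨μ, hμ, hμl⟩ := pl_lift (Int.castRingHom (ZMod M)) ZMod.intCast_surjective hpl
  obtain ⟨z, hz⟩ := (iP_ker M (l - μ)).mp (by rw [map_sub, hμl, sub_self])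
  refine ⟨μ, z, hμ, ?_, fun h => hl2 ?_⟩
  · have : μ + ((2 ^ (r + 1) : ℤ) : S ℤ) * z = l := by
      rw [hML] at hz; push_cast; linear_combination -hz
    rw [this]; exact hl
  · rw [iP_ker]
    rw [hML] at hz
    have h5 : (2 : S ℤ) ∣ l - μ := by rw [hz]; exact (dvd_pow_self 2 (Nat.succ_ne_zero r)).mul_right z
    have := dvd_add h5 h
    rw [sub_add_cancel] at this
    exact_mod_cast this

theorem div_one {D : Cl ℤ} (h : ∀ r : ℕ, ∃ E : Cl ℤ, D = E ^ 2 ^ r ∧ red E = 1) : D = 1 := by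
  obtain ⟨I, hI, U, hN, hU, hUd, hUo, -, rfl⟩ := good_rep D
  by_contra hne
  have h0 : ∀ x ∈ I, pl U.natDegree x → x = 0 := by
    intro x hx hp
    by_contra hx0
    exact hne (one_of_mem hI hN hU.ne_zero hx hx0 hp)
  obtain ⟨N, hN0, hNc⟩ := lin_clear hN hU.ne_zero hUo h0
  set r := N.natAbs with hr
  obtain ⟨E, hE, hred⟩ := h r
  obtain ⟨J, hJ, V, hM, hV, hVd, hVo, -, rfl⟩ := good_rep E
  obtain ⟨μ, z, hμ, hmem, h2⟩ := approx hI hJ hN hU hV hM hVd hVo r hE hred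
  obtain ⟨t, ht, hdv⟩ := hNc _ μ z hμ hmem
  refine h2 (two_adic (a := r + 1) (n := t * N) ?_ (by exact_mod_cast hdv))
  intro hd
  have hc : IsCoprime ((2 : ℤ) ^ (r + 1)) t :=
    (Int.prime_two.coprime_iff_not_dvd.mpr ht).pow_left
  have h3 := Int.le_of_dvd (by positivity) ((dvd_abs _ _).mpr (hc.dvd_of_dvd_mul_left hd))
  have h4 : r + 1 < 2 ^ (r + 1) := Nat.lt_two_pow_self
  have h5 : |N| = (r : ℤ) := by rw [hr]; exact Int.abs_eq_natAbs N
  rw [h5] at h3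
  have h6 : ((r + 1 : ℕ) : ℤ) < ((2 ^ (r + 1) : ℕ) : ℤ) := by exact_mod_cast h4
  push_cast at h6
  omega

end N3
end

section
open Polynomial
namespace N3

lemma four_dvd {G : Type*} [CommGroup G] {p : G} (h12 : p ^ 12 = 1) (h6 : p ^ 6 ≠ 1) :
    4 ∣ orderOf p := by
  have h1 := orderOf_dvd_of_pow_eq_one h12
  have h2 : ¬ orderOf p ∣ 6 := fun h => h6 (orderOf_dvd_iff_pow_eq_one.mp h)
  have h3 : orderOf p ≤ 12 := Nat.le_of_dvd (by norm_num) h1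
  generalize orderOf p = o at h1 h2 h3
  interval_cases o <;> simp_all

lemma group_arg {G H : Type*} [CommGroup G] [CommGroup H] [Finite H] (f : G →* H) (P : G)
    (h12 : P ^ 12 = 1) (h6 : f P ^ 6 ≠ 1) (hA : ∀ D : G, ∃ (k : ℕ) (E : G), D = P ^ k * E ^ 2)
    {D : G} (hD : f D = 1) (r : ℕ) : ∃ E : G, D = E ^ 2 ^ r ∧ f E = 1 := by
  have hA' : ∀ n : ℕ, ∀ D : G, ∃ (k : ℕ) (E : G), D = P ^ k * E ^ 2 ^ n := by
    intro n
    induction n with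
    | zero => exact fun D => ⟨0, D, by simp⟩
    | succ n ih =>
      intro D
      obtain ⟨k, E, rfl⟩ := hA D
      obtain ⟨l, F, rfl⟩ := ih E
      refine ⟨k + l * 2, F, ?_⟩
      rw [mul_pow, ← pow_mul, ← pow_mul, pow_succ, pow_add, mul_assoc]
  obtain ⟨a, m, hm, hc⟩ := Nat.exists_eq_two_pow_mul_odd (Nat.card_pos (α := H)).ne'
  obtain ⟨k, E, hE⟩ := hA' (r + a) D
  have hcard : ∀ x : H, x ^ (2 ^ a * m) = 1 := fun x => by rw [← hc]; exact pow_card_eq_one'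
  have hk : 4 ∣ k := by
    have h1 : f P ^ (k * m) = 1 := by
      have h2 := congrArg (fun x => f x ^ m) hE
      simp only [hD, one_pow, map_mul, map_pow, mul_pow] at h2
      rw [← pow_mul, ← pow_mul, pow_add, mul_assoc, mul_comm (2 ^ r), pow_mul (f E), hcard, one_pow,
        mul_one] at h2
      exact h2.symm
    have h3 := (four_dvd (by rw [← map_pow, h12, map_one]) h6).trans (orderOf_dvd_of_pow_eq_one h1)
    have hcop : Nat.Coprime 4 m := by
      rw [show 4 = 2 ^ 2 by norm_num]
      exact (Nat.coprime_two_left.mpr hm).pow_left 2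
    exact hcop.dvd_of_dvd_mul_right h3
  obtain ⟨j, rfl⟩ := hk
  set E' := E ^ (2 ^ a * (3 * m)) with hE'
  have hfE' : f E' = 1 := by
    rw [hE', map_pow, show 2 ^ a * (3 * m) = 2 ^ a * m * 3 by ring, pow_mul, hcard, one_pow]
  have h3 : D ^ (3 * m) = E' ^ 2 ^ r := by
    rw [hE, mul_pow, ← pow_mul, show 4 * j * (3 * m) = 12 * (j * m) by ring, pow_mul, h12, one_pow,
      one_mul, hE', ← pow_mul, ← pow_mul]
    congr 1; ring
  have hcop : Nat.Coprime (3 * m) (2 ^ r) := by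
    refine Nat.Coprime.pow_right r ?_
    exact (Nat.coprime_two_right.mpr ((by decide : Odd 3).mul hm))
  have hbz := Nat.gcd_eq_gcd_ab (3 * m) (2 ^ r)
  rw [hcop] at hbz
  set u := Nat.gcdA (3 * m) (2 ^ r)
  set v := Nat.gcdB (3 * m) (2 ^ r)
  refine ⟨E' ^ u * D ^ v, ?_, by rw [map_mul, map_zpow, map_zpow, hfE', hD, one_zpow, one_zpow, one_mul]⟩
  calc D = D ^ (((3 * m : ℕ) : ℤ) * u + ((2 ^ r : ℕ) : ℤ) * v) := by rw [← hbz]; simp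
    _ = _ := by
      rw [zpow_add, zpow_mul, zpow_natCast, h3, mul_pow, mul_comm _ v, zpow_mul, zpow_natCast,
        ← zpow_natCast (E' ^ u), ← zpow_natCast E', ← zpow_mul, ← zpow_mul, mul_comm u]

theorem red_inj (hA : ∀ D : Cl ℤ, ∃ (k : ℕ) (E : Cl ℤ), D = P0 ℤ ^ k * E ^ 2)
    {D : Cl ℤ} (hD : red D = 1) : D = 1 := by
  have : Finite (Cl (ZMod 2)) := Cl_finite (by decide)
  exact div_one (group_arg red (P0 ℤ) P0_12 (by rw [red_P0]; exact P0_6) hA hD)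

end N3
end

section
open Polynomial
namespace N3

/-- evaluation homomorphisms -/
noncomputable def evS {k A : Type*} [CommRing k] [CommRing A] (g : k[X] →+* A) (t : A)
    (ht : t * t = g (hp k) - g (Rp k) * t) : S k →+* A where
  toFun z := g z.re + g z.im * t
  map_one' := by simp [QuadraticAlgebra.re_one, QuadraticAlgebra.im_one]
  map_zero' := by simp
  map_add' x y := by simp; ring
  map_mul' x y := by
    simp only [QuadraticAlgebra.re_mul, QuadraticAlgebra.im_mul, map_add, map_mul, map_neg]
    linear_combination (-(g x.im) * g y.im) * ht

lemma evS_apply {k A : Type*} [CommRing k] [CommRing A] (g : k[X] →+* A) (t : A)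
    (ht : t * t = g (hp k) - g (Rp k) * t) (z : S k) : evS g t ht z = g z.re + g z.im * t := rfl

lemma pt (x y : ℚ) (hxy : y ^ 2 + (x ^ 3 + x ^ 2 - 2 * x + 1) * y = x ^ 4 * (x - 1) ^ 3) :
    ∃ (I : Ideal (S ℤ)) (_ : I ∈ GM ℤ) (U : ℤ[X]), HasN I U ∧ U.IsPrimitive ∧ U.natDegree = 1 ∧
      aeval x U = 0 ∧ ∀ w, w ∈ I ↔ aeval x w.re + aeval x w.im * y = 0 := by
  have ht : y * y = (evalRingHom x) (hp ℚ) - (evalRingHom x) (Rp ℚ) * y := by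
    simp only [hp, Rp, coe_evalRingHom, eval_mul, eval_pow, eval_X, eval_sub, eval_one, eval_add,
      eval_ofNat]
    linear_combination hxy
  let ev := evS (evalRingHom x) y ht
  have hev : ∀ z, ev z = z.re.eval x + z.im.eval x * y := fun z => rfl
  let evl : S ℚ →ₗ[ℚ] ℚ :=
    { toFun := ev, map_add' := map_add ev, map_smul' := fun c z => by simp [hev]; ring }
  have hQ : RingHom.ker ev ≠ ⊥ := by
    intro h
    have h1 : (cc (X - C x) : S ℚ) ∈ RingHom.ker ev := by
      rw [RingHom.mem_ker, hev]; simp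
    rw [h, Ideal.mem_bot] at h1
    have := congrArg QuadraticAlgebra.re h1
    exact X_sub_C_ne_zero x (by simpa using this)
  obtain ⟨U, hU, hN⟩ := closure_hasN (RingHom.ker ev) hQ
  have hmem : ∀ w, w ∈ (RingHom.ker ev).comap iQ ↔ aeval x w.re + aeval x w.im * y = 0 := by
    intro w
    rw [Ideal.mem_comap, RingHom.mem_ker, hev]
    simp only [mp_re, mp_im, eval_map, aeval_def]
    rfl
  refine ⟨_, ⟨U, hU, hN⟩, U, hN, hU, ?_, ?_, hmem⟩
  · have hNQ := hN.map (Int.castRingHom ℚ)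
    rw [map_comap_iQ] at hNQ
    have hUQ : U.map (Int.castRingHom ℚ) ≠ 0 := by
      rw [Ne, Polynomial.map_eq_zero_iff (RingHom.injective_int _)]; exact hU.ne_zero
    have h1 := (codim (by norm_num) hNQ hUQ).2
    rw [natDegree_map_eq_of_injective (RingHom.injective_int _)] at h1
    have h2 : (RingHom.ker ev).restrictScalars ℚ = LinearMap.ker evl := by ext z; rfl
    rw [h2, (evl.quotKerEquivOfSurjective fun c => ⟨cc (C c), by
      change ev _ = c; rw [hev]; simp⟩).finrank_eq, Module.finrank_self] at h1
    exact h1.symm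
  · have := (hmem _).mp hN.cc_mem
    simpa using this

/-- the element `y` -/
noncomputable def yy (k : Type*) [CommRing k] : S k := ⟨0, 1⟩

lemma proper_eq {I J : Ideal (S (ZMod 2))} (hI : (1 : S (ZMod 2)) ∉ I) (a b : ZMod 2)
    (h1 : cc (X - C a) ∈ I) (h2 : yy _ - cc (C b) ∈ I)
    (h1' : cc (X - C a) ∈ J) (h2' : yy _ - cc (C b) ∈ J) : I ≤ J := by
  have key : ∀ z : S (ZMod 2), ∃ c : ZMod 2, ∃ u v : S (ZMod 2),
      z = cc (C c) + u * cc (X - C a) + v * (yy _ - cc (C b)) := by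
    intro z
    obtain ⟨p, hp⟩ := X_sub_C_dvd_sub_C_eval (a := a) (p := z.re)
    obtain ⟨q, hq⟩ := X_sub_C_dvd_sub_C_eval (a := a) (p := z.im)
    have hz : z = cc z.re + cc z.im * yy _ := by
      ext1
      · simp [yy]
      · simp [yy]
    refine ⟨eval a z.re + eval a z.im * b, cc p + cc q * yy _, cc (C (eval a z.im)), ?_⟩
    have e1 : (cc z.re : S (ZMod 2)) = cc (C (eval a z.re)) + cc (X - C a) * cc p := by
      rw [← map_mul, ← hp, ← map_add]; congr 1; ring
    have e2 : (cc z.im : S (ZMod 2)) = cc (C (eval a z.im)) + cc (X - C a) * cc q := by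
      rw [← map_mul, ← hq, ← map_add]; congr 1; ring
    rw [C_add, C_mul, map_add cc (C _) (_ * _), map_mul cc (C _) (C b)]
    linear_combination hz + e1 + (yy _) * e2
  intro z hz
  obtain ⟨c, u, v, e⟩ := key z
  have hc : cc (C c) ∈ I := by
    have : cc (C c) = z - u * cc (X - C a) - v * (yy _ - cc (C b)) := by linear_combination -e
    rw [this]
    exact I.sub_mem (I.sub_mem hz (I.mul_mem_left _ h1)) (I.mul_mem_left _ h2)
  have hc0 : c = 0 := by
    by_contra h
    apply hI
    have : (1 : S (ZMod 2)) = cc (C c⁻¹) * cc (C c) := by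
      rw [← map_mul, ← C_mul, inv_mul_cancel₀ h, C_1, map_one]
    rw [this]; exact I.mul_mem_left _ hc
  rw [e, hc0, C_0, map_zero, zero_add]
  exact J.add_mem (J.mul_mem_left _ h1') (J.mul_mem_left _ h2')

lemma pl_two {g : S ℤ} (hg : g ≠ 0) (hd : (nm g).natDegree ≤ 2) : ∃ p : ℤ[X], g = cc p ∧ p.natDegree ≤ 1 := by
  have h := pl_deg (pl_mono hd (nm_pl hg).2)
  refine ⟨g.re, ?_, by omega⟩
  have : g.im = 0 := by rcases h.2 with h | h; exact h; omega
  ext1 <;> simp [this]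

theorem zm2_lift (a b : ZMod 2) : ∃ a' b' : ℤ, (a' : ZMod 2) = a ∧ (b' : ZMod 2) = b ∧
      (a' = 0 ∨ a' = 1) ∧ (b' = 0 ∨ b' = -1) := by
  have h : ∀ a : ZMod 2, a = 0 ∨ a = 1 := by decide
  obtain ⟨a', h1, h2⟩ : ∃ a' : ℤ, (a' : ZMod 2) = a ∧ (a' = 0 ∨ a' = 1) := by
    rcases h a with rfl | rfl
    · exact ⟨0, by simp, by simp⟩
    · exact ⟨1, by simp, by simp⟩
  obtain ⟨b', h3, h4⟩ : ∃ a' : ℤ, (a' : ZMod 2) = b ∧ (a' = 0 ∨ a' = -1) := by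
    rcases h b with rfl | rfl
    · exact ⟨0, by simp, by simp⟩
    · exact ⟨-1, by push_cast; decide, by simp⟩
  exact ⟨a', b', h1, h3, h2, h4⟩

theorem points (hinj : ∀ D : Cl ℤ, red D = 1 → D = 1) (x y : ℚ)
    (hxy : y ^ 2 + (x ^ 3 + x ^ 2 - 2 * x + 1) * y = x ^ 4 * (x - 1) ^ 3) : x = 0 ∨ x = 1 := by
  obtain ⟨I, hI, U, hN, hU, hd, hUx, hm⟩ := pt x y hxy
  have hU2 := prim_iff.mp hU 2 Nat.prime_two
  have hN2 := hN.map (Int.castRingHom (ZMod 2))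
  obtain ⟨hfin, hfr⟩ := codim (by decide) hN2 hU2
  have hle : (U.map (Int.castRingHom (ZMod 2))).natDegree ≤ 1 := hd ▸ natDegree_map_le
  by_cases h1 : (1 : S (ZMod 2)) ∈ I.map (iP 2)
  · exfalso
    have h2 : cls I hI = 1 := by
      apply hinj
      rw [red_cls, cls_eq_one]
      refine ⟨1, one_ne_zero, ?_⟩
      rw [Ideal.span_singleton_one]; exact (Ideal.eq_top_iff_one _).mpr h1
    rw [cls_eq_one] at h2
    obtain ⟨g, hg, e⟩ := h2
    have ha := nm_gen hN e
    have hdg := natDegree_eq_of_degree_eq (degree_eq_degree_of_associated ha)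
    obtain ⟨p, rfl, hp⟩ := pl_two hg (by omega)
    rw [nm_cc, natDegree_pow] at hdg
    omega
  -- reduction is a point
  have hone : Module.finrank (ZMod 2) (S (ZMod 2) ⧸ (I.map (iP 2)).restrictScalars (ZMod 2)) = 1 := by
    refine le_antisymm (hfr.le.trans hle) ?_
    by_contra h0
    have h0' : Module.finrank (ZMod 2) (S (ZMod 2) ⧸ (I.map (iP 2)).restrictScalars (ZMod 2)) = 0 := by
      omega
    have := Module.finrank_zero_iff.mp h0'
    have h3 := Subsingleton.elim (Submodule.Quotient.mk
      (p := (I.map (iP 2)).restrictScalars (ZMod 2)) (1 : S (ZMod 2))) 0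
    rw [Submodule.Quotient.mk_eq_zero] at h3
    exact h1 h3
  have hv : (Submodule.Quotient.mk
      (p := (I.map (iP 2)).restrictScalars (ZMod 2)) (1 : S (ZMod 2))) ≠ 0 := by
    rw [Ne, Submodule.Quotient.mk_eq_zero]; exact h1
  have hcon : ∀ z : S (ZMod 2), ∃ c : ZMod 2, z - cc (C c) ∈ I.map (iP 2) := by
    intro z
    obtain ⟨c, hc⟩ := (finrank_eq_one_iff_of_nonzero' _ hv).mp hone (Submodule.Quotient.mk z)
    refine ⟨c, ?_⟩
    rw [← Submodule.Quotient.mk_smul, eq_comm, Submodule.Quotient.eq] at hc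
    have : c • (1 : S (ZMod 2)) = cc (C c) := by
      ext1
      · simp [QuadraticAlgebra.re_one, smul_eq_C_mul]
      · simp [QuadraticAlgebra.im_one]
    rw [this] at hc
    exact hc
  obtain ⟨a, ha⟩ := hcon (cc X)
  obtain ⟨b, hb⟩ := hcon (yy _)
  rw [← map_sub] at ha
  obtain ⟨a', b', rfl, rfl, ha', hb'⟩ : ∃ a' b' : ℤ, (a' : ZMod 2) = a ∧ (b' : ZMod 2) = b ∧
      (a' = 0 ∨ a' = 1) ∧ (b' = 0 ∨ b' = -1) := zm2_lift a b
  obtain ⟨J, hJ, V, hM, hV, hVd, hVx, hmJ⟩ := pt a' b' (by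
    rcases ha' with rfl | rfl <;> rcases hb' with rfl | rfl <;> norm_num)
  have hIntg : ∀ p : ℤ[X], aeval (a' : ℚ) p = ((p.eval a' : ℤ) : ℚ) := fun p => by
    rw [← eq_intCast (algebraMap ℤ ℚ) a', aeval_algebraMap_apply]; simp
  have hJ1 : (1 : S (ZMod 2)) ∉ J.map (iP 2) := by
    intro h
    obtain ⟨w, hw, e⟩ := (Ideal.mem_map_iff_of_surjective (iP 2) (iP_surj 2)).mp h
    obtain ⟨z, hz⟩ := (iP_ker 2 (w - 1)).mp (by rw [map_sub, e, map_one, sub_self])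
    have hw' : w = 1 + cc 2 * z := by
      rw [map_ofNat]; push_cast at hz; linear_combination hz
    have h3 := (hmJ w).mp hw
    rw [hw', QuadraticAlgebra.re_add, QuadraticAlgebra.im_add, cc_mul_re, cc_mul_im,
      QuadraticAlgebra.re_one, QuadraticAlgebra.im_one, hIntg, hIntg] at h3
    simp only [eval_add, eval_mul, eval_one, eval_ofNat, eval_zero, zero_add] at h3
    have h4 : 1 + 2 * (eval a' z.re) + 2 * (eval a' z.im) * b' = 0 := by exact_mod_cast h3
    have h5 : (2 : ℤ) ∣ 1 := ⟨-(eval a' z.re + eval a' z.im * b'), by linear_combination h4⟩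
    omega
  have hJa : cc (X - C (a' : ZMod 2)) ∈ J.map (iP 2) := by
    have : cc (X - C a') ∈ J := (hmJ _).mpr (by simp)
    have := Ideal.mem_map_of_mem (iP 2) this
    rw [mp_cc] at this
    simpa using this
  have hJb : yy _ - cc (C (b' : ZMod 2)) ∈ J.map (iP 2) := by
    have : yy _ - cc (C b') ∈ J := (hmJ _).mpr (by simp [yy])
    have := Ideal.mem_map_of_mem (iP 2) this
    rw [map_sub, mp_cc] at this
    have e : iP 2 (yy ℤ) = yy _ := by ext1 <;> simp [yy]
    rw [e] at this
    simpa using this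
  have hIJ : I.map (iP 2) = J.map (iP 2) :=
    le_antisymm (proper_eq h1 _ _ ha hb hJa hJb) (proper_eq hJ1 _ _ hJa hJb ha hb)
  have hprod : cls (I * cj J) ((GM ℤ).mul_mem hI (GM_cj hJ)) = 1 := by
    apply hinj
    rw [← cls_mul hI (GM_cj hJ), cls_cj hJ, map_mul, map_inv, red_cls, red_cls, mul_inv_eq_one]
    congr 1
  rw [cls_eq_one] at hprod
  obtain ⟨g, hg, e⟩ := hprod
  have has := nm_gen (hN.mul hM.cj) e
  have hdg := natDegree_eq_of_degree_eq (degree_eq_degree_of_associated has)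
  rw [natDegree_mul hU.ne_zero hV.ne_zero, hd, hVd] at hdg
  obtain ⟨p, rfl, hp⟩ := pl_two hg (by omega)
  rw [nm_cc] at has
  have hr : ∀ t : ℚ, aeval t (U * V) = 0 → aeval t p = 0 := by
    intro t ht
    obtain ⟨c, hc⟩ := has.dvd
    have := congrArg (aeval t) hc
    rw [map_mul, ht, zero_mul, map_pow] at this
    exact pow_eq_zero_iff (two_ne_zero) |>.mp this
  have hp0 : p ≠ 0 := by rintro rfl; exact hg (map_zero cc)
  have r1 := hr x (by rw [map_mul, hUx, zero_mul])
  have r2 := hr a' (by rw [map_mul, hVx, mul_zero])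
  rw [eq_X_add_C_of_natDegree_le_one hp] at r1 r2
  simp only [map_add, map_mul, aeval_C, aeval_X] at r1 r2
  have hc1 : (algebraMap ℤ ℚ) (p.coeff 1) ≠ 0 := by
    intro h0
    rw [h0] at r1
    have h1 : p.coeff 0 = 0 := by simpa using r1
    have h2 : p.coeff 1 = 0 := by simpa using h0
    apply hp0
    rw [eq_X_add_C_of_natDegree_le_one hp, h1, h2]; simp
  have : x = a' := by
    apply mul_left_cancel₀ hc1
    linear_combination r1 - r2
  rw [this]
  rcases ha' with rfl | rfl <;> simp

end N3
end

section
open Polynomial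
namespace N3

/-- The ring `(ℤ/4)[x]/(x³-x²+1)`. -/
@[ext] structure GR where
  a : ZMod 4
  b : ZMod 4
  c : ZMod 4

instance : DecidableEq GR := fun u v =>
  decidable_of_iff (u.a = v.a ∧ u.b = v.b ∧ u.c = v.c) GR.ext_iff.symm

namespace GR

instance : Zero GR := ⟨⟨0, 0, 0⟩⟩
instance : One GR := ⟨⟨1, 0, 0⟩⟩
instance : Add GR := ⟨fun u v => ⟨u.a + v.a, u.b + v.b, u.c + v.c⟩⟩
instance : Neg GR := ⟨fun u => ⟨-u.a, -u.b, -u.c⟩⟩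
instance : Mul GR := ⟨fun u v =>
  ⟨u.a * v.a - (u.b * v.c + u.c * v.b) - u.c * v.c,
   u.a * v.b + u.b * v.a - u.c * v.c,
   u.a * v.c + u.b * v.b + u.c * v.a + (u.b * v.c + u.c * v.b) + u.c * v.c⟩⟩

theorem zero_def : (0 : GR) = ⟨0, 0, 0⟩ := rfl
theorem one_def : (1 : GR) = ⟨1, 0, 0⟩ := rfl
theorem add_def (u v : GR) : u + v = ⟨u.a + v.a, u.b + v.b, u.c + v.c⟩ := rfl
theorem neg_def (u : GR) : -u = ⟨-u.a, -u.b, -u.c⟩ := rfl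
theorem mul_def (u v : GR) : u * v = 
  ⟨u.a * v.a - (u.b * v.c + u.c * v.b) - u.c * v.c,
   u.a * v.b + u.b * v.a - u.c * v.c,
   u.a * v.c + u.b * v.b + u.c * v.a + (u.b * v.c + u.c * v.b) + u.c * v.c⟩ := rfl

instance : CommRing GR where
  add_assoc u v w := by ext <;> simp only [add_def] <;> ring
  zero_add u := by ext <;> simp only [add_def, zero_def] <;> ring
  add_zero u := by ext <;> simp only [add_def, zero_def] <;> ring
  add_comm u v := by ext <;> simp only [add_def] <;> ring
  neg_add_cancel u := by ext <;> simp only [add_def, neg_def, zero_def] <;> ring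
  mul_assoc u v w := by ext <;> simp only [mul_def] <;> ring
  one_mul u := by ext <;> simp only [mul_def, one_def] <;> ring
  mul_one u := by ext <;> simp only [mul_def, one_def] <;> ring
  zero_mul u := by ext <;> simp only [mul_def, zero_def] <;> ring
  mul_zero u := by ext <;> simp only [mul_def, zero_def] <;> ring
  left_distrib u v w := by ext <;> simp only [mul_def, add_def] <;> ring
  right_distrib u v w := by ext <;> simp only [mul_def, add_def] <;> ring
  mul_comm u v := by ext <;> simp only [mul_def] <;> ring
  nsmul := nsmulRec
  zsmul := zsmulRec

/-- the class of `x` -/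
def x : GR := ⟨0, 1, 0⟩
/-- the inverse of `x` -/
def xi : GR := ⟨0, 1, -1⟩

theorem x_xi : x * xi = 1 := by decide
theorem x_root : x ^ 3 - x ^ 2 + 1 = 0 := by decide
theorem x7 : x ^ 7 ≠ 1 := by decide
theorem x7' : x ^ 7 ≠ -1 := by decide
theorem m7 : (-1 : GR) ^ 7 ≠ 1 := by decide
theorem b_root : (1 - xi) ^ 4 + (1 - xi) ^ 2 + (1 - xi) + 1 = 0 := by decide

theorem tri (u : GR) : u * u = 0 ∨ u ^ 14 = 1 := by
  have h : ∀ a b c : ZMod 4, (⟨a, b, c⟩ * ⟨a, b, c⟩ : GR) = 0 ∨ (⟨a, b, c⟩ : GR) ^ 14 = 1 := by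
    decide +kernel
  exact h u.a u.b u.c

theorem unit14 {u : GR} (hu : IsUnit u) : u ^ 14 = 1 := by
  rcases tri u with h | h
  · exfalso
    have := (hu.mul hu)
    rw [h] at this
    have h2 := isUnit_zero_iff.mp this
    revert h2; decide
  · exact h

theorem sq_zero_iff (a b c : ZMod 4) (h : (⟨a, b, c⟩ * ⟨a, b, c⟩ : GR) = 0) :
    2 * a = 0 ∧ 2 * b = 0 ∧ 2 * c = 0 := by
  revert a b c; decide +kernel

end GR

/-- The evaluation `ℤ[X] → GR`. -/
noncomputable def ps : ℤ[X] →+* GR := eval₂RingHom (Int.castRingHom GR) GR.x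

theorem gr_int (n : ℤ) : ((n : ℤ) : GR) = ⟨n, 0, 0⟩ := by
  have key : ∀ n : ℕ, ((n : ℕ) : GR) = ⟨n, 0, 0⟩ := by
    intro n
    induction n with
    | zero => rw [Nat.cast_zero]; ext <;> simp [GR.zero_def]
    | succ n ih => rw [Nat.cast_succ, ih]; ext <;> simp [GR.add_def, GR.one_def]
  cases n with
  | ofNat n => simpa using key n
  | negSucc n =>
    rw [Int.cast_negSucc, key]
    ext <;> simp [GR.neg_def]

theorem C3_monic : (X ^ 3 - X ^ 2 + 1 : ℤ[X]).Monic := by monicity!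

theorem ps_unit (e : ℤ[X]) (he : ¬ Rp (ZMod 2) ∣ e.map (Int.castRingHom (ZMod 2))) :
    ps e ^ 14 = 1 := by
  rcases GR.tri (ps e) with h | h
  swap
  · exact h
  exfalso
  apply he
  set r := e %ₘ (X ^ 3 - X ^ 2 + 1 : ℤ[X]) with hr
  have hdiv := modByMonic_add_div e (X ^ 3 - X ^ 2 + 1 : ℤ[X])
  have hnd : (X ^ 3 - X ^ 2 + 1 : ℤ[X]).natDegree = 3 := by compute_degree!
  have hrd : r.natDegree < 3 := by
    rw [← hnd]
    apply natDegree_modByMonic_lt _ C3_monic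
    intro h; rw [h] at hnd; simp at hnd
  have hre : r = C (r.coeff 0) + C (r.coeff 1) * X + C (r.coeff 2) * X ^ 2 := by
    conv_lhs => rw [r.as_sum_range' 3 hrd]
    simp [Finset.sum_range_succ, ← C_mul_X_pow_eq_monomial]
  have hpe : ps e = ⟨r.coeff 0, r.coeff 1, r.coeff 2⟩ := by
    rw [← hdiv, map_add, map_mul]
    have : ps (X ^ 3 - X ^ 2 + 1 : ℤ[X]) = 0 := by
      simpa [ps] using GR.x_root
    rw [this, zero_mul, add_zero, ← hr]
    refine (congrArg ps hre).trans ?_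
    simp only [ps, eval₂_add, eval₂_mul, eval₂_pow, coe_eval₂RingHom, eval₂_C, eval₂_X]
    simp only [eq_intCast, gr_int]
    ext <;> simp [GR.add_def, GR.mul_def, GR.x, pow_two]
  rw [hpe] at h
  obtain ⟨h0, h1, h2⟩ := GR.sq_zero_iff _ _ _ h
  have two : ∀ n : ℤ, 2 * (n : ZMod 4) = 0 → (n : ZMod 2) = 0 := by
    intro n hn
    have : ((2 * n : ℤ) : ZMod 4) = 0 := by push_cast; exact hn
    rw [ZMod.intCast_zmod_eq_zero_iff_dvd] at this ⊢
    push_cast at *; omega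
  have hrm : r.map (Int.castRingHom (ZMod 2)) = 0 := by
    rw [hre]
    simp only [Polynomial.map_add, Polynomial.map_mul, Polynomial.map_C, Int.coe_castRingHom, two _ h0,
      two _ h1, two _ h2, C_0, zero_mul, add_zero]
  rw [← hdiv, Polynomial.map_add, ← hr, hrm, zero_add, Polynomial.map_mul]
  apply Dvd.dvd.mul_right
  apply dvd_of_eq
  have h2 : (2 : (ZMod 2)[X]) = 0 := by
    rw [← C_ofNat]; rw [show (OfNat.ofNat 2 : ZMod 2) = 0 from rfl, C_0]
  simp only [Rp, Polynomial.map_add, Polynomial.map_sub, Polynomial.map_pow, Polynomial.map_X, 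
    Polynomial.map_one]
  linear_combination (X ^ 2 - X) * h2

theorem grp_four {G H : Type*} [CommGroup G] [CommMonoid H] (τ η m w : G)
    (hgen : ∀ u : G, ∃ a b : ℤ, u = τ ^ a * η ^ b) (χ : G →* H) (hχ : ∀ s, χ (s ^ 2) = 1)
    (hm : χ m ≠ 1) (hw : χ w ≠ 1) (hmw : χ (m * w) ≠ 1) (u : G) :
    ∃ (i j : Bool) (s : G), u = (bif i then m else 1) * (bif j then w else 1) * s ^ 2 := by
  set N : Subgroup G := (powMonoidHom 2 : G →* G).range with hN
  have hmem : ∀ g, g ∈ N ↔ ∃ s, s ^ 2 = g := fun g => by simp [hN, MonoidHom.mem_range]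
  have hone : ∀ g ∈ N, χ g = 1 := by
    intro g hg; obtain ⟨s, rfl⟩ := (hmem g).mp hg; exact hχ s
  let F : Bool × Bool → G ⧸ N := fun p =>
    (((bif p.1 then τ else 1) * (bif p.2 then η else 1) : G) : G ⧸ N)
  let F' : Bool × Bool → G ⧸ N := fun p =>
    (((bif p.1 then m else 1) * (bif p.2 then w else 1) : G) : G ⧸ N)
  have hF : Function.Surjective F := by
    intro q
    obtain ⟨g, rfl⟩ := QuotientGroup.mk_surjective q
    obtain ⟨a, b, rfl⟩ := hgen g
    have key : ∀ (t : G) (a : ℤ), ∃ (i : Bool) (s : G), t ^ a = (bif i then t else 1) * s ^ 2 := by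
      intro t a
      rcases Int.even_or_odd' a with ⟨k, rfl | rfl⟩
      · exact ⟨false, t ^ k, by simp [mul_comm 2 k, zpow_mul]⟩
      · exact ⟨true, t ^ k, by simp [zpow_add, mul_comm 2 k, zpow_mul, mul_comm]⟩
    obtain ⟨i, s, h1⟩ := key τ a
    obtain ⟨j, t, h2⟩ := key η b
    refine ⟨(i, j), ?_⟩
    rw [QuotientGroup.eq, hmem]
    refine ⟨s * t, ?_⟩
    rw [h1, h2, mul_pow]
    simp only
    generalize (bif i then τ else 1) = p
    generalize (bif j then η else 1) = q
    rw [eq_inv_mul_iff_mul_eq]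
    exact mul_mul_mul_comm _ _ _ _
  have hfin : Finite (G ⧸ N) := Finite.of_surjective F hF
  have hcard : Nat.card (G ⧸ N) ≤ 4 := by
    have := Nat.card_le_card_of_surjective F hF
    simpa using this
  have hinv : ∀ g : G, χ g⁻¹ = 1 → χ g = 1 := by
    intro g hg
    have := map_mul χ g⁻¹ g
    rw [inv_mul_cancel, map_one, hg, one_mul] at this
    exact this.symm
  have hF' : Function.Injective F' := by
    rintro ⟨i, j⟩ ⟨k, l⟩ h
    have h2 := hone _ (QuotientGroup.eq.mp h)
    have hi : ∀ g, χ g⁻¹ = χ g := by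
      intro g
      rw [show g⁻¹ = g * (g⁻¹) ^ 2 by rw [pow_two, mul_inv_cancel_left], map_mul, hχ, mul_one]
    have mm : χ m * χ m = 1 := by rw [← map_mul, ← pow_two, hχ]
    have ww : χ w * χ w = 1 := by rw [← map_mul, ← pow_two, hχ]
    rw [map_mul] at hmw
    rw [map_mul, hi, map_mul, map_mul] at h2
    clear hone hmem hgen hχ h hi hF
    cases i <;> cases j <;> cases k <;> cases l <;>
      simp only [cond_true, cond_false, map_one, one_mul, mul_one] at h2 <;> grind
  have hb : Function.Bijective F' := by
    apply hF'.bijective_of_nat_card_le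
    simpa using hcard
  obtain ⟨⟨i, j⟩, hij⟩ := hb.2 (u : G ⧸ N)
  obtain ⟨s, hs⟩ := (hmem _).mp (QuotientGroup.eq.mp hij)
  refine ⟨i, j, s, ?_⟩
  rw [hs, mul_inv_cancel_left]

end N3
end

section
open Polynomial
namespace N3
open NumberField Module

theorem trace_pow {K : Type*} [Field K] [NumberField K] {n : ℕ} (b : Basis (Fin n) ℚ K) (θ : K)
    (A : Matrix (Fin n) (Fin n) ℤ) (hA : ∀ j, θ * b j = ∑ i, A i j • b i) (k : ℕ) :
    Algebra.trace ℚ K (θ ^ k) = ((A ^ k).trace : ℤ) := by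
  have h1 : Algebra.leftMulMatrix b θ = A.map (Int.castRingHom ℚ) := by
    ext i j
    rw [Algebra.leftMulMatrix_eq_repr_mul, hA]
    have : ∑ i, A i j • b i = ∑ i, (A i j : ℚ) • b i := by
      refine Finset.sum_congr rfl fun i _ => ?_
      rw [Int.cast_smul_eq_zsmul]
    rw [this, b.repr_sum_self]
    simp
  rw [Algebra.trace_eq_matrix_trace b, map_pow, h1, ← Matrix.map_pow]
  simp [Matrix.trace]

theorem discr_pow {K : Type*} [Field K] [NumberField K] {n : ℕ} (b : Basis (Fin n) ℚ K) (θ : 𝓞 K)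
    (A : Matrix (Fin n) (Fin n) ℤ) (hA : ∀ j, (θ : K) * b j = ∑ i, A i j • b i) :
    Algebra.discr ℤ (fun i : Fin n => θ ^ (i : ℕ)) =
      (Matrix.of fun i j : Fin n => (A ^ ((i : ℕ) + j)).trace).det := by
  rw [Algebra.discr_def]
  congr 1
  ext i j
  rw [Algebra.traceMatrix_apply, Algebra.traceForm_apply, ← pow_add, Matrix.of_apply]
  have h := trace_pow b (θ : K) A hA (i + j)
  have h2 := Algebra.coe_trace_int (θ ^ ((i : ℕ) + j))
  push_cast at h2
  rw [h] at h2
  exact_mod_cast h2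

theorem pow_basis {K : Type*} [Field K] [NumberField K] {n : ℕ} (hn : finrank ℚ K = n) (θ : 𝓞 K)
    (d : ℤ) (hd : ∀ m : ℤ, m ^ 2 ∣ d → IsUnit m)
    (h : Algebra.discr ℤ (fun i : Fin n => θ ^ (i : ℕ)) = d) :
    Submodule.span ℤ (Set.range fun i : Fin n => θ ^ (i : ℕ)) = ⊤ ∧ discr K = d := by
  classical
  have hr : finrank ℤ (𝓞 K) = n := by rw [RingOfIntegers.rank, hn]
  let B : Basis (Fin n) ℤ (𝓞 K) := finBasisOfFinrankEq ℤ (𝓞 K) hr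
  have h1 := Algebra.discr_of_matrix_vecMul (A := ℤ) (⇑B) (B.toMatrix fun i : Fin n => θ ^ (i : ℕ))
  rw [Basis.toMatrix_map_vecMul, h, discr_eq_discr K B] at h1
  have hu : IsUnit (B.toMatrix fun i : Fin n => θ ^ (i : ℕ)).det := hd _ ⟨_, h1⟩
  have h2 := (Basis.is_basis_iff_det B).mpr hu
  refine ⟨h2.2, ?_⟩
  rcases Int.isUnit_iff.mp hu with e | e
  · rw [h1, e]; ring
  · rw [h1, e]; ring

theorem aeval_surj {R : Type*} [CommRing R] {n : ℕ} (θ : R)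
    (h : Submodule.span ℤ (Set.range fun i : Fin n => θ ^ (i : ℕ)) = ⊤) (z : R) :
    ∃ p : ℤ[X], aeval θ p = z := by
  have hz : z ∈ Submodule.span ℤ (Set.range fun i : Fin n => θ ^ (i : ℕ)) := by rw [h]; trivial
  have hle : Submodule.span ℤ (Set.range fun i : Fin n => θ ^ (i : ℕ)) ≤
      LinearMap.range (aeval θ : ℤ[X] →ₐ[ℤ] R).toLinearMap := by
    rw [Submodule.span_le]
    rintro _ ⟨i, rfl⟩
    exact ⟨X ^ (i : ℕ), by simp⟩
  exact hle hz

/-- homs out of a monogenic order -/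
theorem exists_hom {R A : Type*} [CommRing R] [CommRing A] (θ : R)
    (hs : ∀ z : R, ∃ p : ℤ[X], aeval θ p = z) (F : ℤ[X])
    (hF : ∀ p : ℤ[X], aeval θ p = 0 → F ∣ p) (x : A) (hx : aeval x F = 0) :
    ∃ φ : R →+* A, ∀ p : ℤ[X], φ (aeval θ p) = aeval x p := by
  have hs' : Function.Surjective (aeval θ : ℤ[X] →ₐ[ℤ] R).toRingHom := hs
  have hk : RingHom.ker (aeval θ : ℤ[X] →ₐ[ℤ] R).toRingHom ≤
      RingHom.ker (aeval x : ℤ[X] →ₐ[ℤ] A).toRingHom := by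
    intro p hp
    obtain ⟨q, rfl⟩ := hF p hp
    rw [RingHom.mem_ker]
    change aeval x (F * q) = 0
    rw [map_mul, hx, zero_mul]
  refine ⟨RingHom.liftOfSurjective _ hs' ⟨_, hk⟩, fun p => ?_⟩
  exact RingHom.liftOfRightInverse_comp_apply _ _ _ ⟨_, hk⟩ p

theorem dvd_of_aeval {K : Type*} [Field K] [CharZero K] (F : ℤ[X]) (hF : F.IsPrimitive)
    (hi : Irreducible (F.map (Int.castRingHom ℚ))) (θ : K) (h0 : aeval θ F = 0) (p : ℤ[X])
    (hp : aeval θ p = 0) : F ∣ p := by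
  have ev : ∀ q : ℤ[X], aeval θ (q.map (Int.castRingHom ℚ)) = aeval θ q := fun q =>
    aeval_map_algebraMap ℚ θ q
  have h2 : F.map (Int.castRingHom ℚ) ∣ p.map (Int.castRingHom ℚ) := by
    have h3 := minpoly.eq_of_irreducible hi (x := θ) (by rw [ev, h0])
    have h4 := minpoly.dvd ℚ θ (p := p.map (Int.castRingHom ℚ)) (by rw [ev, hp])
    rw [← h3] at h4
    exact (dvd_mul_right _ _).trans h4
  exact (IsPrimitive.Int.dvd_iff_map_cast_dvd_map_cast F p hF).mpr h2

theorem units_gen {K : Type*} [Field K] [NumberField K] (h : Units.rank K = 1) :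
    ∃ τ η : (𝓞 K)ˣ, ∀ u : (𝓞 K)ˣ, ∃ a b : ℤ, u = τ ^ a * η ^ b := by
  obtain ⟨⟨τ, hτ⟩, hg⟩ := IsCyclic.exists_generator (α := Units.torsion K)
  refine ⟨τ, Units.fundSystem K (Fin.cast h.symm 0), fun u => ?_⟩
  obtain ⟨⟨ζ, e⟩, he, -⟩ := Units.exist_unique_eq_mul_prod K u
  obtain ⟨a, ha⟩ := hg ζ
  refine ⟨a, e (Fin.cast h.symm 0), ?_⟩
  simp only at he ha
  rw [he, ← ha, SubgroupClass.coe_zpow]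
  congr 1
  rw [Fintype.prod_eq_single (Fin.cast h.symm 0)]
  intro i hi
  exfalso; apply hi
  ext; have := i.2; simp; omega

theorem pow_lin {K : Type*} [Field K] [NumberField K] {n : ℕ} (F : ℤ[X]) (hm : F.Monic)
    (hi : Irreducible (F.map (Int.castRingHom ℚ))) (hd : F.natDegree = n) (θ : K) 
    (hθ : aeval θ F = 0) (hn : finrank ℚ K = n) :
    ∃ b : Basis (Fin n) ℚ K, ∀ i, b i = θ ^ (i : ℕ) := by
  have h3 : F.map (Int.castRingHom ℚ) = minpoly ℚ θ := by
    apply minpoly.eq_of_irreducible_of_monic hi _ (hm.map _)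
    exact (aeval_map_algebraMap ℚ θ F).trans hθ
  have h4 : (minpoly ℚ θ).natDegree = n := by
    rw [← h3, hm.natDegree_map, hd]
  have hl := linearIndependent_pow (K := ℚ) θ
  rw [h4] at hl
  have hn0 : Nonempty (Fin n) := ⟨⟨0, by rw [← hn]; exact finrank_pos⟩⟩
  refine ⟨basisOfLinearIndependentOfCardEqFinrank hl (by simp [hn]), fun i => ?_⟩
  simp

/-- The basic use of `HasN` in a PID. -/
theorem pid_sq {A : Type*} [CommRing A] [IsDomain A] [IsPrincipalIdealRing A] (φ : S ℤ →+* A)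
    (hφ : ∀ z, φ (star z) = φ z) {I : Ideal (S ℤ)} {e : ℤ[X]} (h : HasN I e) :
    ∃ (u : Aˣ) (g : A), φ (cc e) = u * g ^ 2 := by
  have h1 := congrArg (Ideal.map φ) h
  have h2 : (cj I).map φ = I.map φ := by
    apply le_antisymm
    · rw [Ideal.map_le_iff_le_comap]
      intro z hz
      rw [Ideal.mem_comap, ← hφ]
      exact Ideal.mem_map_of_mem _ (mem_cj.mp hz)
    · rw [Ideal.map_le_iff_le_comap]
      intro z hz
      rw [Ideal.mem_comap, ← hφ]
      refine Ideal.mem_map_of_mem _ (mem_cj.mpr ?_)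
      rwa [star_star]
  obtain ⟨g, hg⟩ := IsPrincipalIdealRing.principal (I.map φ)
  rw [Ideal.map_mul, h2, Ideal.map_span, Set.image_singleton, hg, Ideal.submodule_span_eq,
    Ideal.span_singleton_mul_span_singleton, Ideal.span_singleton_eq_span_singleton] at h1
  obtain ⟨u, hu⟩ := h1
  exact ⟨u, g, by rw [← hu]; ring⟩

end N3
end

section
open Polynomial
namespace N3
open NumberField Module

/-- integer cubic -/
noncomputable def c3 : ℤ[X] := X ^ 3 - X ^ 2 + 1

theorem c3_monic : c3.Monic := C3_monic

theorem c3_irr : Irreducible (c3.map (Int.castRingHom ℚ)) := by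
  have h2 : Irreducible (c3.map (Int.castRingHom (ZMod 2))) := by
    have hm : (c3.map (Int.castRingHom (ZMod 2))).Monic := c3_monic.map _
    have hd : (c3.map (Int.castRingHom (ZMod 2))).natDegree = 3 := by
      rw [Monic.natDegree_map c3_monic]
      unfold c3; compute_degree!
    rw [hm.irreducible_iff_roots_eq_zero_of_degree_le_three (by omega) (by omega)]
    rw [Multiset.eq_zero_iff_forall_notMem]
    intro a ha
    replace ha := (mem_roots'.mp ha).2
    simp only [c3, IsRoot.def, Polynomial.map_add, Polynomial.map_sub, Polynomial.map_pow,
      Polynomial.map_X, Polynomial.map_one, eval_add, eval_sub, eval_pow, eval_X, eval_one] at ha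
    revert ha a; decide
  have h1 : Irreducible c3 := Monic.irreducible_of_irreducible_map _ _ c3_monic h2
  exact (Monic.irreducible_iff_irreducible_map_fraction_map (K := ℚ) c3_monic).mp h1

/-- companion matrix -/
def A3 : Matrix (Fin 3) (Fin 3) ℤ := !![0, 0, -1; 1, 0, 0; 0, 1, 1]

theorem A3_det : (Matrix.of fun i j : Fin 3 => (A3 ^ ((i : ℕ) + j)).trace).det = -23 := by
  decide +kernel

theorem sq_prime {q : ℤ} (hq : Prime q) (d : ℤ) (hd : d = q ∨ d = -q) (m : ℤ) (h : m ^ 2 ∣ d) :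
    IsUnit m := by
  have h' : m ^ 2 ∣ q := by rcases hd with rfl | rfl; exacts [h, (dvd_neg.mp h)]
  exact (hq.irreducible.squarefree) m (by rwa [← pow_two])

section

theorem K_basis {K : Type*} [Field K] [NumberField K] (θ : 𝓞 K) (hθ : θ ^ 3 - θ ^ 2 + 1 = 0)
  (hn : finrank ℚ K = 3) : Submodule.span ℤ (Set.range fun i : Fin 3 => θ ^ (i : ℕ)) = ⊤ ∧
    discr K = -23 := by
  have hθ' : (θ : K) ^ 3 - (θ : K) ^ 2 + 1 = 0 := by exact_mod_cast congrArg (algebraMap (𝓞 K) K) hθ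
  obtain ⟨b, hb⟩ := pow_lin c3 c3_monic c3_irr (by unfold c3; compute_degree!) (θ : K)
    (by simpa [c3] using hθ') hn
  apply pow_basis hn θ (-23) (sq_prime (q := 23) (by norm_num) _ (Or.inr rfl))
  rw [discr_pow b θ A3 ?_, A3_det]
  intro j
  simp only [Fin.sum_univ_three, hb]
  fin_cases j
  · simp [A3]
  · simp [A3]; ring
  · simp [A3]; linear_combination hθ'

theorem K_pid {K : Type*} [Field K] [NumberField K] (θ : 𝓞 K) (hθ : θ ^ 3 - θ ^ 2 + 1 = 0)
  (hn : finrank ℚ K = 3) : IsPrincipalIdealRing (𝓞 K) ∧ Units.rank K = 1 := by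
  have hd := (K_basis θ hθ hn).2
  have hs := sign_discr K
  have hc := InfinitePlace.card_add_two_mul_card_eq_rank K
  rw [hn] at hc
  have h1 : InfinitePlace.nrComplexPlaces K = 1 := by
    have : InfinitePlace.nrComplexPlaces K ≤ 1 := by omega
    interval_cases h : InfinitePlace.nrComplexPlaces K
    · rw [hd] at hs; revert hs; decide
    · rfl
  constructor
  · apply RingOfIntegers.isPrincipalIdealRing_of_abs_discr_lt
    rw [hd, h1, hn]
    have := Real.pi_gt_three
    norm_num [Nat.factorial]
    nlinarith
  · rw [Units.rank, InfinitePlace.card_eq_nrRealPlaces_add_nrComplexPlaces]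
    omega
end

/-- class representatives -/
noncomputable def kap (i j : Bool) : ℤ[X] := (bif i then -1 else 1) * (bif j then X else 1)

theorem ps_aeval (p : ℤ[X]) : ps p = aeval GR.x p := rfl

/-- The shared endgame: a unit group of rank one, mapped to `GR`. -/
theorem unit_class {K : Type*} [Field K] [NumberField K] (hr : Units.rank K = 1)
    (ψ : 𝓞 K →+* GR) (w : (𝓞 K)ˣ) (hw : ψ w ^ 7 = GR.x ^ 7 ∨ ψ w ^ 7 = -GR.x ^ 7) (u : (𝓞 K)ˣ) :
    ∃ (i j : Bool) (s : (𝓞 K)ˣ), (u : 𝓞 K) = (bif i then -1 else 1) * (bif j then w else 1) * s ^ 2 := by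
  obtain ⟨τ, η, hg⟩ := units_gen hr
  let χ : (𝓞 K)ˣ →* GR :=
    ((powMonoidHom 7 : GR →* GR).comp (ψ : 𝓞 K →* GR)).comp (Units.coeHom (𝓞 K))
  have hχ : ∀ v, χ v = ψ v ^ 7 := fun v => rfl
  have h7 : GR.x ^ 7 ≠ 1 ∧ GR.x ^ 7 ≠ -1 := ⟨GR.x7, GR.x7'⟩
  have hsq : ∀ s, χ (s ^ 2) = 1 := by
    intro s
    rw [hχ, Units.val_pow_eq_pow_val, map_pow, ← pow_mul]
    exact GR.unit14 ((s.isUnit).map ψ)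
  have h1 : χ (-1) ≠ 1 := by
    rw [hχ]; simp only [Units.val_neg, Units.val_one, map_neg, map_one]; exact GR.m7
  have h2 : χ w ≠ 1 := by
    rw [hχ]
    rcases hw with e | e <;> rw [e]
    · exact h7.1
    · intro h; exact h7.2 (by rw [← h, neg_neg])
  have h3 : χ (-1 * w) ≠ 1 := by
    rw [hχ]
    simp only [Units.val_neg, map_neg, neg_mul, one_mul]
    rw [Odd.neg_pow (by decide)]
    rcases hw with e | e <;> rw [e]
    · intro h; exact h7.2 (by rw [← h, neg_neg])
    · rw [neg_neg]; exact h7.1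
  obtain ⟨i, j, s, h⟩ := grp_four τ η (-1) w hg χ hsq h1 h2 h3 u
  refine ⟨i, j, s, ?_⟩
  rw [h]
  cases i <;> cases j <;> simp

theorem K_out {J : Ideal (S ℤ)} {e : ℤ[X]} (hJ : HasN J e)
    (he : ¬ Rp (ZMod 2) ∣ e.map (Int.castRingHom (ZMod 2))) :
    ∃ (i j : Bool) (s : ℤ[X]), c3 ∣ e - kap i j * s ^ 2 ∧ ps e ^ 7 = ps (kap i j) ^ 7 := by
  have : Fact (Irreducible (c3.map (Int.castRingHom ℚ))) := ⟨c3_irr⟩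
  have h0 : c3.map (Int.castRingHom ℚ) ≠ 0 := c3_irr.ne_zero
  obtain ⟨K, _, _, θ0, hθ0, hn⟩ : ∃ (K : Type) (_ : Field K) (_ : NumberField K) (θ : K),
      θ ^ 3 - θ ^ 2 + 1 = 0 ∧ finrank ℚ K = 3 := by
    have hfin : finrank ℚ (AdjoinRoot (c3.map (Int.castRingHom ℚ))) = 3 := by
      rw [(AdjoinRoot.powerBasis h0).finrank, AdjoinRoot.powerBasis_dim,
        Monic.natDegree_map c3_monic]
      unfold c3; compute_degree!
    refine ⟨AdjoinRoot (c3.map (Int.castRingHom ℚ)), inferInstance, ?_,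
      AdjoinRoot.root _, ?_, hfin⟩
    · have : FiniteDimensional ℚ (AdjoinRoot (c3.map (Int.castRingHom ℚ))) :=
        FiniteDimensional.of_finrank_pos (by rw [hfin]; norm_num)
      exact ⟨⟩
    · have := AdjoinRoot.eval₂_root (c3.map (Int.castRingHom ℚ))
      rw [eval₂_map] at this
      unfold c3 at this ⊢
      simpa using this
  have hIntg : IsIntegral ℤ θ0 := ⟨c3, c3_monic, by simpa [c3] using hθ0⟩
  obtain ⟨θ, rfl⟩ : ∃ θ : 𝓞 K, (θ : K) = θ0 := ⟨⟨θ0, hIntg⟩, rfl⟩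
  have hθ : θ ^ 3 - θ ^ 2 + 1 = 0 := by
    apply RingOfIntegers.coe_injective
    push_cast; exact hθ0
  have hsurj := aeval_surj θ (K_basis θ hθ hn).1
  obtain ⟨hpid, hrank⟩ := K_pid θ hθ hn
  have hdvd : ∀ p : ℤ[X], aeval θ p = 0 → c3 ∣ p := by
    intro p hp
    apply dvd_of_aeval c3 c3_monic.isPrimitive c3_irr (θ : K) (by simpa [c3] using hθ0)
    have := congrArg (algebraMap (𝓞 K) K) hp
    rwa [← aeval_algebraMap_apply, map_zero] at this
  obtain ⟨ψ, hψ⟩ := exists_hom θ hsurj c3 hdvd GR.x (by simpa [c3] using GR.x_root)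
  let φ : S ℤ →+* 𝓞 K := evS (aeval θ : ℤ[X] →ₐ[ℤ] 𝓞 K).toRingHom (θ - θ ^ 2) (by
    simp [N3.hp, Rp, map_ofNat]
    linear_combination (-θ^4 + 2*θ^3 - 2*θ^2 + θ) * hθ)
  have hφ : ∀ z, φ z = aeval θ z.re + aeval θ z.im * (θ - θ ^ 2) := fun z => evS_apply _ _ _ _
  obtain ⟨u, g, hug⟩ := pid_sq φ (by
    intro z
    rw [hφ, hφ, st_re, st_im]
    simp [Rp, map_ofNat]
    linear_combination (-(aeval θ z.im)) * hθ) hJ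
  have hw : θ * (θ - θ ^ 2) = 1 := by linear_combination -hθ
  let w : (𝓞 K)ˣ := ⟨θ, θ - θ ^ 2, hw, by rw [mul_comm]; exact hw⟩
  have hψθ : ψ θ = GR.x := by simpa using hψ X
  obtain ⟨i, j, s, hs⟩ := unit_class hrank ψ w (Or.inl (by change ψ θ ^ 7 = _; rw [hψθ])) u
  obtain ⟨q, hq⟩ := hsurj (s * g)
  have hee : aeval θ e = aeval θ (kap i j) * (aeval θ q) ^ 2 := by
    have h1 : φ (cc e) = aeval θ e := by rw [hφ]; simp
    rw [← h1, hug, hs, hq]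
    have : aeval θ (kap i j) = (bif i then -1 else 1) * ((bif j then w else 1 : (𝓞 K)ˣ) : 𝓞 K) := by
      cases i <;> cases j <;> simp [kap, w]
    rw [this]; ring
  refine ⟨i, j, q, ?_, ?_⟩
  · apply hdvd
    rw [map_sub, map_mul, map_pow, hee, sub_self]
  · have h2 := congrArg ψ hee
    rw [map_mul, map_pow, hψ, hψ, hψ, ← ps_aeval, ← ps_aeval, ← ps_aeval] at h2
    have h14 := ps_unit e he
    have hu : IsUnit (ps q) := by
      have : IsUnit (ps e) := IsUnit.of_pow_eq_one h14 (by norm_num)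
      rw [h2] at this
      have := isUnit_of_mul_isUnit_right this
      exact (isUnit_pow_iff two_ne_zero).mp this
    rw [h2, mul_pow, ← pow_mul, GR.unit14 hu, mul_one]

end N3
end

section
open Polynomial
namespace N3
open NumberField Module

/-- integer quartic -/
noncomputable def f4 : ℤ[X] := X ^ 4 + X ^ 2 + X + 1

theorem f4_monic : f4.Monic := by unfold f4; monicity!
theorem f4_deg : f4.natDegree = 4 := by unfold f4; compute_degree!

theorem z3_lin (a : ZMod 3) (h : 0 = a ^ 4 + a ^ 2 + a + 1) : False := by
  revert a; decide

theorem z3_quad (p q r s : ZMod 3) (h3 : p + r = 0) (h2 : q + s + p * r - 1 = 0)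
    (h1 : p * s + q * r - 1 = 0) (h0 : q * s - 1 = 0) : False := by
  revert p q r s; decide +kernel

theorem f4_irr : Irreducible (f4.map (Int.castRingHom ℚ)) := by
  haveI : Fact (Nat.Prime 3) := ⟨by norm_num⟩
  have h2 : Irreducible (f4.map (Int.castRingHom (ZMod 3))) := by
    have hm : (f4.map (Int.castRingHom (ZMod 3))).Monic := f4_monic.map _
    have hd : (f4.map (Int.castRingHom (ZMod 3))).natDegree = 4 := by
      rw [Monic.natDegree_map f4_monic, f4_deg]
    have hF : f4.map (Int.castRingHom (ZMod 3)) = X ^ 4 + X ^ 2 + X + 1 := by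
      simp [f4]
    rw [hm.irreducible_iff_natDegree']
    refine ⟨fun h => by rw [h] at hd; simp at hd, fun f g hf hg hfg hmem => ?_⟩
    rw [hd, Finset.mem_Ioc] at hmem
    have hdd : f.natDegree + g.natDegree = 4 := by rw [← hf.natDegree_mul hg, hfg, hd]
    rw [hF] at hfg
    obtain h1 | h1 : g.natDegree = 1 ∨ g.natDegree = 2 := by omega
    · have e : g = X + C (g.coeff 0) := hg.eq_X_add_C h1
      have hz := congrArg (eval (-(g.coeff 0))) hfg
      have hg0 : eval (-(g.coeff 0)) g = 0 := by
        rw [congrArg (eval (-(g.coeff 0))) e]; simp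
      rw [eval_mul, hg0, mul_zero] at hz
      simp only [eval_add, eval_pow, eval_X, eval_one] at hz
      generalize -(g.coeff 0) = a at hz
      exact z3_lin a hz
    · have h2 : f.natDegree = 2 := by omega
      have quad : ∀ q : (ZMod 3)[X], q.Monic → q.natDegree = 2 →
          q = X ^ 2 + C (q.coeff 1) * X + C (q.coeff 0) := by
        intro q hq hq2
        conv_lhs => rw [q.as_sum_range' 3 (by omega)]
        have : q.coeff 2 = 1 := by rw [← hq2]; exact hq
        simp [Finset.sum_range_succ, ← C_mul_X_pow_eq_monomial, this]
        ring
      have ef := quad f hf h2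
      have eg := quad g hg h1
      generalize f.coeff 1 = p at ef
      generalize f.coeff 0 = q at ef
      generalize g.coeff 1 = r at eg
      generalize g.coeff 0 = s at eg
      have key : (C (p + r) * X ^ 3 + C (q + s + p * r - 1) * X ^ 2 + C (p * s + q * r - 1) * X +
          C (q * s - 1) : (ZMod 3)[X]) = 0 := by
        rw [ef, eg] at hfg
        simp only [C_add, C_sub, C_mul, C_1]
        linear_combination hfg
      have k0 := congrArg (fun t => coeff t 0) key
      have k1 := congrArg (fun t => coeff t 1) key
      have k2 := congrArg (fun t => coeff t 2) key
      have k3 := congrArg (fun t => coeff t 3) key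
      simp [coeff_X, coeff_C, -C_add, -C_sub, -C_mul, -map_add, -map_sub, -map_mul] at k0 k1 k2 k3
      exact z3_quad p q r s k3 k2 k1 k0
  have h1 : Irreducible f4 := Monic.irreducible_of_irreducible_map _ _ f4_monic h2
  exact (Monic.irreducible_iff_irreducible_map_fraction_map (K := ℚ) f4_monic).mp h1

/-- companion matrix -/
def A4 : Matrix (Fin 4) (Fin 4) ℤ := !![0, 0, 0, -1; 1, 0, 0, -1; 0, 1, 0, -1; 0, 0, 1, 0]

theorem A4_det : (Matrix.of fun i j : Fin 4 => (A4 ^ ((i : ℕ) + j)).trace).det = 257 := by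
  decide +kernel

section

theorem L_basis {K : Type*} [Field K] [NumberField K] (b : 𝓞 K) (hb : b ^ 4 + b ^ 2 + b + 1 = 0)
  (hn : finrank ℚ K = 4) : Submodule.span ℤ (Set.range fun i : Fin 4 => b ^ (i : ℕ)) = ⊤ ∧
    discr K = 257 := by
  have hb' : (b : K) ^ 4 + (b : K) ^ 2 + b + 1 = 0 := by
    exact_mod_cast congrArg (algebraMap (𝓞 K) K) hb
  obtain ⟨B, hB⟩ := pow_lin f4 f4_monic f4_irr f4_deg (b : K) (by simpa [f4] using hb') hn
  apply pow_basis hn b 257 (sq_prime (q := 257) (by norm_num) _ (Or.inl rfl))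
  rw [discr_pow B b A4 ?_, A4_det]
  intro j
  simp only [Fin.sum_univ_four, hB]
  fin_cases j
  · simp [A4]
  · simp [A4]; ring
  · simp [A4]; ring
  · simp [A4]; linear_combination hb'

theorem L_rho {K : Type*} [Field K] [NumberField K] (b : 𝓞 K) (hb : b ^ 4 + b ^ 2 + b + 1 = 0)
  (hn : finrank ℚ K = 4) : ∃ ρ : 𝓞 K →+* ZMod 2, (∀ p : ℤ[X], ρ (aeval b p) = aeval (1 : ZMod 2) p) ∧
    ∀ z, ρ z = 0 ↔ b + 1 ∣ z := by
  have hb' : (b : K) ^ 4 + (b : K) ^ 2 + b + 1 = 0 := by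
    exact_mod_cast congrArg (algebraMap (𝓞 K) K) hb
  have hsurj := aeval_surj b (L_basis b hb hn).1
  have hdvd : ∀ p : ℤ[X], aeval b p = 0 → f4 ∣ p := by
    intro p hp
    apply dvd_of_aeval f4 f4_monic.isPrimitive f4_irr (b : K) (by simpa [f4] using hb')
    have := congrArg (algebraMap (𝓞 K) K) hp
    rwa [← aeval_algebraMap_apply, map_zero] at this
  obtain ⟨ρ, hρ⟩ := exists_hom b hsurj f4 hdvd (1 : ZMod 2) (by
    simp [f4]; decide)
  refine ⟨ρ, hρ, fun z => ?_⟩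
  have hπ : ρ (b + 1) = 0 := by
    have := hρ (X + 1)
    simp only [map_add, aeval_X, map_one] at this
    rw [map_add, map_one, this]; decide
  constructor
  · intro hz
    obtain ⟨p, rfl⟩ := hsurj z
    obtain ⟨q, hq⟩ : (X - C (-1) : ℤ[X]) ∣ p - C (p.eval (-1)) := by
      rw [dvd_iff_isRoot]; simp
    have e : aeval b p = (b + 1) * aeval b q + ((p.eval (-1) : ℤ) : 𝓞 K) := by
      have := congrArg (aeval b) hq
      simp at this
      linear_combination this
    rw [e, map_add, map_mul, hπ, zero_mul, zero_add, map_intCast,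
      ZMod.intCast_zmod_eq_zero_iff_dvd] at hz
    obtain ⟨k, hk⟩ := hz
    refine ⟨aeval b q - (b ^ 3 - b ^ 2 + 2 * b - 1) * k, ?_⟩
    rw [e, hk]
    push_cast
    linear_combination (k : 𝓞 K) * hb
  · rintro ⟨t, rfl⟩
    rw [map_mul, hπ, zero_mul]

theorem L_prime {K : Type*} [Field K] [NumberField K] (b : 𝓞 K) (hb : b ^ 4 + b ^ 2 + b + 1 = 0)
  (hn : finrank ℚ K = 4) : Prime (b + 1) := by
  obtain ⟨ρ, -, hρ⟩ := L_rho b hb hn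
  refine ⟨?_, ?_, ?_⟩
  · intro h
    have h2 : b + 1 ∣ 2 := ⟨-(b ^ 3 - b ^ 2 + 2 * b - 1), by linear_combination hb⟩
    rw [h, zero_dvd_iff] at h2
    exact two_ne_zero h2
  · intro h
    have := (hρ 1).mpr h.dvd
    rw [map_one] at this
    exact one_ne_zero this
  · intro x y h
    rw [← hρ, map_mul, mul_eq_zero, hρ, hρ] at h
    exact h

theorem L_places {K : Type*} [Field K] [NumberField K] (b : 𝓞 K) (hb : b ^ 4 + b ^ 2 + b + 1 = 0)
  (hn : finrank ℚ K = 4) : InfinitePlace.nrComplexPlaces K = 2 := by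
  classical
  have hd := (L_basis b hb hn).2
  have hs := sign_discr K
  have hc := InfinitePlace.card_add_two_mul_card_eq_rank K
  rw [hn] at hc
  have : InfinitePlace.nrComplexPlaces K ≤ 2 := by omega
  interval_cases h : InfinitePlace.nrComplexPlaces K
  · exfalso
    have hpos : 0 < Fintype.card {w : InfinitePlace K // w.IsReal} := by
      change 0 < InfinitePlace.nrRealPlaces K; omega
    obtain ⟨w, hw⟩ := Fintype.card_pos_iff.mp hpos
    let σ := InfinitePlace.embedding_of_isReal hw
    have hb' : (b : K) ^ 4 + (b : K) ^ 2 + b + 1 = 0 := by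
      exact_mod_cast congrArg (algebraMap (𝓞 K) K) hb
    have := congrArg σ hb'
    simp only [map_add, map_pow, map_one, map_zero] at this
    nlinarith [sq_nonneg (σ b ^ 2), sq_nonneg (σ b + 1 / 2)]
  · rw [hd] at hs; revert hs; decide
  · rfl

theorem L_rank {K : Type*} [Field K] [NumberField K] (b : 𝓞 K) (hb : b ^ 4 + b ^ 2 + b + 1 = 0)
  (hn : finrank ℚ K = 4) : Units.rank K = 1 := by
  have h := L_places b hb hn
  have hc := InfinitePlace.card_add_two_mul_card_eq_rank K
  rw [Units.rank, InfinitePlace.card_eq_nrRealPlaces_add_nrComplexPlaces]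
  omega

open Real in
theorem L_pid {K : Type*} [Field K] [NumberField K] (b : 𝓞 K) (hb : b ^ 4 + b ^ 2 + b + 1 = 0)
  (hn : finrank ℚ K = 4) : IsPrincipalIdealRing (𝓞 K) := by
  apply RingOfIntegers.isPrincipalIdealRing_of_isPrincipal_of_norm_le
  intro I hI
  rw [L_places b hb hn, hn, (L_basis b hb hn).2] at hI
  have hlt : (4 / π) ^ 2 * (((4 : ℕ).factorial : ℝ) / ((4 : ℕ) : ℝ) ^ 4 * √|((257 : ℤ) : ℝ)|) < 3 := by
    have h1 : √|((257 : ℤ) : ℝ)| < 17 := by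
      rw [Real.sqrt_lt' (by norm_num)]; norm_num
    have h2 : (4 / π) ^ 2 ≤ (4 / 3) ^ 2 := by
      have := Real.pi_gt_three
      gcongr
    have h3 : 0 ≤ √|((257 : ℤ) : ℝ)| := Real.sqrt_nonneg _
    norm_num [Nat.factorial] at *
    nlinarith [sq_nonneg (4 / π)]
  have hlt2 : ((Ideal.absNorm (I : Ideal (𝓞 K)) : ℕ) : ℝ) < 3 := lt_of_le_of_lt hI (by
    simpa using hlt)
  have hle : Ideal.absNorm (I : Ideal (𝓞 K)) < 3 := by exact_mod_cast hlt2
  have hne : Ideal.absNorm (I : Ideal (𝓞 K)) ≠ 0 := Ideal.absNorm_ne_zero_of_nonZeroDivisors I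
  obtain h1 | h1 : Ideal.absNorm (I : Ideal (𝓞 K)) = 1 ∨ Ideal.absNorm (I : Ideal (𝓞 K)) = 2 := by
    omega
  · rw [Ideal.absNorm_eq_one_iff.mp h1]; exact top_isPrincipal
  · set I' : Ideal (𝓞 K) := (I : Ideal (𝓞 K))
    have h2 : (2 : 𝓞 K) ∈ I' := by
      have := Ideal.absNorm_mem I'
      rwa [h1] at this
    have hcard : Nat.card (𝓞 K ⧸ I') = 2 := h1
    have h1I : (1 : 𝓞 K) ∉ I' := by
      intro h
      rw [(Ideal.eq_top_iff_one I').mpr h, Ideal.absNorm_top] at h1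
      norm_num at h1
    have hbI : b ∉ I' := by
      intro h
      apply h1I
      have := I'.mul_mem_left (-(b ^ 3 + b + 1)) h
      rwa [show -(b ^ 3 + b + 1) * b = 1 by linear_combination -hb] at this
    obtain ⟨y, -, hy⟩ := (Nat.card_eq_two_iff' (0 : 𝓞 K ⧸ I')).mp hcard
    have e1 := hy (Ideal.Quotient.mk I' 1)
      (fun h => h1I (Ideal.Quotient.eq_zero_iff_mem.mp h))
    have e2 := hy (Ideal.Quotient.mk I' b)
      (fun h => hbI (Ideal.Quotient.eq_zero_iff_mem.mp h))
    have e3 := Ideal.Quotient.eq.mp (e2.trans e1.symm)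
    have hπ : b + 1 ∈ I' := by
      have := I'.add_mem e3 h2
      rwa [show b - 1 + 2 = b + 1 by ring] at this
    refine ⟨b + 1, ?_⟩
    obtain ⟨ρ, -, hρ⟩ := L_rho b hb hn
    apply le_antisymm
    · intro z hz
      rw [Ideal.submodule_span_eq, Ideal.mem_span_singleton, ← hρ]
      have z2 : ∀ a : ZMod 2, a = 0 ∨ a = 1 := by decide
      rcases z2 (ρ z) with h | h
      · exact h
      · exfalso
        apply h1I
        have h5 : b + 1 ∣ z - 1 := by rw [← hρ, map_sub, h, map_one, sub_self]
        have h6 := I'.sub_mem hz (Ideal.mem_of_dvd I' h5 hπ)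
        rwa [sub_sub_cancel] at h6
    · rw [Ideal.submodule_span_eq, Ideal.span_singleton_le_iff_mem]
      exact hπ
end
end N3
end

section
open Polynomial
namespace N3
open NumberField Module

theorem pi_sq {R : Type*} [CommRing R] [IsDomain R] [IsPrincipalIdealRing R] {π : R}
    (hπ : Prime π) {E γ : R} (hE : ¬ π ∣ E) (v : Rˣ) (r k : ℕ)
    (h : E * π ^ r = v * π ^ k * γ ^ 2) : ∃ δ : R, E = v * δ ^ 2 := by
  have hγ : γ ≠ 0 := by
    rintro rfl
    have : E * π ^ r = 0 := by rw [h]; ring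
    rcases mul_eq_zero.mp this with h0 | h0
    · exact hE (h0 ▸ dvd_zero π)
    · exact hπ.ne_zero (eq_zero_of_pow_eq_zero h0)
  obtain ⟨δ, hδ, hn⟩ := (FiniteMultiplicity.of_prime_left hπ hγ).exists_eq_pow_mul_and_not_dvd
  set l := multiplicity π γ
  have h2 : E * π ^ r = (v * δ ^ 2) * π ^ (k + 2 * l) := by
    rw [h, hδ]; ring
  have hn2 : ¬ π ∣ v * δ ^ 2 := by
    intro hd
    rcases hπ.dvd_or_dvd hd with h3 | h3
    · exact hπ.not_unit (isUnit_of_dvd_unit h3 v.isUnit)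
    · exact hn (hπ.dvd_of_dvd_pow h3)
  have h0 : ∀ n, π ^ n ≠ 0 := fun n => pow_ne_zero n hπ.ne_zero
  rcases lt_trichotomy r (k + 2 * l) with hlt | heq | hlt
  · exfalso
    obtain ⟨m, hm⟩ := Nat.exists_eq_add_of_lt hlt
    rw [hm] at h2
    apply hE
    refine ⟨v * δ ^ 2 * π ^ m, mul_right_cancel₀ (h0 r) ?_⟩
    rw [h2]; ring
  · rw [heq] at h2
    exact ⟨δ, mul_right_cancel₀ (h0 _) h2⟩
  · exfalso
    obtain ⟨m, hm⟩ := Nat.exists_eq_add_of_lt hlt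
    rw [hm] at h2
    apply hn2
    refine ⟨E * π ^ m, mul_right_cancel₀ (h0 (k + 2 * l)) ?_⟩
    rw [← h2]; ring

theorem away_dom {R : Type*} [CommRing R] [IsDomain R] {c : R} (hc : c ≠ 0) :
    IsDomain (Localization.Away c) :=
  IsLocalization.isDomain_localization (powers_le_nonZeroDivisors_of_noZeroDivisors hc)

theorem away_pid {R : Type*} [CommRing R] [IsPrincipalIdealRing R] (c : R) :
    IsPrincipalIdealRing (Localization.Away c) := by
  refine ⟨fun I => ?_⟩
  rw [← IsLocalization.map_comap (Submonoid.powers c) (Localization.Away c) I]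
  obtain ⟨a, ha⟩ := (IsPrincipalIdealRing.principal
    (I.comap (algebraMap R (Localization.Away c)))).principal
  rw [Ideal.submodule_span_eq] at ha
  rw [Ideal.under, ha, Ideal.map_span, Set.image_singleton]
  exact ⟨_, rfl⟩

theorem away_sq {R : Type*} [CommRing R] [IsDomain R] [IsPrincipalIdealRing R] {π c : R}
    (hπ : Prime π) (ω : Rˣ) (hc : c = ω * π ^ 2) {E : R} (hE : ¬ π ∣ E)
    (ci : Localization.Away c) (hci : algebraMap R _ c * ci = 1) (u : (Localization.Away c)ˣ)
    (g : Localization.Away c) (d : ℕ) (h : algebraMap R _ E * (-ci) ^ d = u * g ^ 2) :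
    ∃ (v : Rˣ) (δ : R), E = v * δ ^ 2 := by
  have hc0 : c ≠ 0 := by
    rw [hc]; exact mul_ne_zero ω.ne_zero (pow_ne_zero 2 hπ.ne_zero)
  have hinj : Function.Injective (algebraMap R (Localization.Away c)) :=
    IsLocalization.injective _ (powers_le_nonZeroDivisors_of_noZeroDivisors hc0)
  obtain ⟨m, α, hα⟩ := IsLocalization.Away.surj c (u : Localization.Away c)
  obtain ⟨m', α', hα'⟩ := IsLocalization.Away.surj c ((u⁻¹ : (Localization.Away c)ˣ) : Localization.Away c)
  obtain ⟨n, γ, hγ⟩ := IsLocalization.Away.surj c g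
  have e1 : α * α' = c ^ (m + m') := by
    apply hinj
    rw [map_mul, ← hα, ← hα', map_pow, pow_add]
    have : (u : Localization.Away c) * ((u⁻¹ : (Localization.Away c)ˣ) : Localization.Away c) = 1 :=
      u.mul_inv
    linear_combination (algebraMap R (Localization.Away c) c ^ m * algebraMap R _ c ^ m') * this
  have e2 : α ∣ π ^ (2 * (m + m')) := by
    have h1 : α ∣ c ^ (m + m') := ⟨α', e1.symm⟩
    rw [hc, mul_pow, ← pow_mul, ← Units.val_pow_eq_pow_val] at h1
    exact (Units.dvd_mul_left).mp h1
  obtain ⟨i, -, hi⟩ := (dvd_prime_pow hπ _).mp e2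
  obtain ⟨τ, hτ⟩ := hi.symm
  have e3 : E * ((-1) ^ d * c ^ (m + 2 * n)) = α * γ ^ 2 * c ^ d := by
    apply hinj
    simp only [map_mul, map_pow, map_neg, map_one, ← hα, ← hγ]
    have h1 : algebraMap R (Localization.Away c) c ^ d * ci ^ d = 1 := by
      rw [← mul_pow, hci, one_pow]
    rw [neg_pow] at h
    linear_combination (algebraMap R (Localization.Away c) c ^ (m + 2 * n) *
      algebraMap R (Localization.Away c) c ^ d) * h - (algebraMap R (Localization.Away c) E * (-1) ^ d
      * algebraMap R (Localization.Away c) c ^ (m + 2 * n)) * h1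
  rw [← hτ, hc] at e3
  obtain ⟨κ, h1⟩ : ∃ κ : Rˣ, (ω : R) ^ (m + 2 * n) * κ = 1 :=
    ⟨(ω ^ (m + 2 * n))⁻¹, by rw [← Units.val_pow_eq_pow_val]; exact Units.mul_inv _⟩
  obtain ⟨ε, h3⟩ : ∃ ε : Rˣ, (ε : R) = (-1) ^ d := ⟨(-1) ^ d, by simp⟩
  have h2 : ((-1 : R) ^ d) * (-1) ^ d = 1 := by rw [← mul_pow]; simp
  have e4 : E * π ^ (2 * (m + 2 * n)) =
      ((τ * ω ^ d * κ * ε : Rˣ) : R) * π ^ (i + 2 * d) * γ ^ 2 := by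
    simp only [Units.val_mul, Units.val_pow_eq_pow_val]
    rw [h3]
    linear_combination ((-1 : R) ^ d * κ) * e3
      - E * π ^ (2 * (m + 2 * n)) * ((-1) ^ d * (-1) ^ d) * h1 - E * π ^ (2 * (m + 2 * n)) * h2
  obtain ⟨δ, hδ⟩ := pi_sq hπ hE _ _ _ e4
  exact ⟨_, δ, hδ⟩

theorem aeval_rev {A : Type*} [CommRing A] (x y : A) (h : x * y = 1) (e : ℤ[X]) :
    aeval y e.reverse * x ^ e.natDegree = aeval x e := by
  letI : Invertible x := ⟨y, by rw [mul_comm]; exact h, h⟩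
  exact eval₂_reverse_mul_pow (algebraMap ℤ A) x e

theorem kap_mul (i j i' j' : Bool) :
    kap i j * kap i' j' = kap (i ^^ i') (j ^^ j') * (bif j && j' then X else 1) ^ 2 := by
  cases i <;> cases j <;> cases i' <;> cases j' <;> simp [kap, pow_two]

/-- pairs with the same square class on both sides -/
def TT {K : Type*} [Field K] (β : K) (z : K) (χ : GR) : Prop :=
  ∃ (i j : Bool) (s : K), z = aeval β (kap i j) * s ^ 2 ∧ χ = ps (kap i j) ^ 7

theorem ps_X : ps X = GR.x := by rw [ps_aeval, aeval_X]

theorem TT_mul {K : Type*} [Field K] {β z z' : K} {χ χ' : GR} (h : TT β z χ) (h' : TT β z' χ') :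
    TT β (z * z') (χ * χ') := by
  obtain ⟨i, j, s, rfl, rfl⟩ := h
  obtain ⟨i', j', s', rfl, rfl⟩ := h'
  refine ⟨i ^^ i', j ^^ j', aeval β (bif j && j' then X else 1 : ℤ[X]) * s * s', ?_, ?_⟩
  · have := congrArg (aeval β) (kap_mul i j i' j')
    rw [map_mul, map_mul, map_pow] at this
    linear_combination (s ^ 2 * s' ^ 2) * this
  · rw [← mul_pow, ← map_mul, kap_mul, map_mul, mul_pow, map_pow, ← pow_mul]
    have : ps (bif j && j' then X else 1 : ℤ[X]) ^ (2 * 7) = 1 := by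
      cases j <;> cases j' <;> simp [ps_X]
      decide
    rw [this, mul_one]

theorem TT_sq {K : Type*} [Field K] (β s : K) : TT β (s ^ 2) 1 :=
  ⟨false, false, s, by simp [kap], by simp [kap]⟩
theorem TT_neg {K : Type*} [Field K] (β : K) : TT β (-1) (-1) :=
  ⟨true, false, 1, by simp [kap], by simp [kap]; decide⟩
theorem TT_b {K : Type*} [Field K] (β : K) : TT β β (GR.x ^ 7) :=
  ⟨false, true, 1, by simp [kap], by simp [kap, ps_X]⟩
theorem TT_one {K : Type*} [Field K] (β : K) : TT β 1 1 := by simpa using TT_sq β 1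
theorem TT_pow {K : Type*} [Field K] {β z : K} {χ : GR} (h : TT β z χ) (n : ℕ) :
    TT β (z ^ n) (χ ^ n) := by
  induction n with
  | zero => simpa using TT_one β
  | succ n ih => rw [pow_succ, pow_succ]; exact TT_mul ih h

end N3
end

section
open Polynomial
namespace N3
open NumberField Module

/-- the quartic factor -/
noncomputable def g4 : ℤ[X] := 4 * X ^ 4 - 7 * X ^ 3 + 7 * X ^ 2 - 4 * X + 1

theorem g4_deg : (g4.map (Int.castRingHom ℚ)).natDegree = 4 := by
  have : g4.map (Int.castRingHom ℚ) = 4 * X ^ 4 - 7 * X ^ 3 + 7 * X ^ 2 - 4 * X + 1 := by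
    simp [g4]
  rw [this]; compute_degree!

theorem L_field : ∃ (K : Type) (_ : Field K) (_ : NumberField K) (b : 𝓞 K),
    b ^ 4 + b ^ 2 + b + 1 = 0 ∧ finrank ℚ K = 4 ∧ ∀ z : K, ∃ p : ℚ[X], aeval (b : K) p = z := by
  have : Fact (Irreducible (f4.map (Int.castRingHom ℚ))) := ⟨f4_irr⟩
  have h0 : f4.map (Int.castRingHom ℚ) ≠ 0 := f4_irr.ne_zero
  obtain ⟨K, _, _, b0, hb0, hn, hs⟩ : ∃ (K : Type) (_ : Field K) (_ : NumberField K) (θ : K),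
      θ ^ 4 + θ ^ 2 + θ + 1 = 0 ∧ finrank ℚ K = 4 ∧ ∀ z : K, ∃ p : ℚ[X], aeval θ p = z := by
    have hfin : finrank ℚ (AdjoinRoot (f4.map (Int.castRingHom ℚ))) = 4 := by
      rw [(AdjoinRoot.powerBasis h0).finrank, AdjoinRoot.powerBasis_dim,
        Monic.natDegree_map f4_monic, f4_deg]
    refine ⟨AdjoinRoot (f4.map (Int.castRingHom ℚ)), inferInstance, ?_,
      AdjoinRoot.root _, ?_, hfin, ?_⟩
    · have : FiniteDimensional ℚ (AdjoinRoot (f4.map (Int.castRingHom ℚ))) :=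
        FiniteDimensional.of_finrank_pos (by rw [hfin]; norm_num)
      exact ⟨⟩
    · have := AdjoinRoot.eval₂_root (f4.map (Int.castRingHom ℚ))
      rw [eval₂_map] at this
      unfold f4 at this ⊢
      simpa using this
    · intro z
      obtain ⟨p, rfl⟩ := AdjoinRoot.mk_surjective z
      exact ⟨p, AdjoinRoot.aeval_eq p⟩
  have hIntg : IsIntegral ℤ b0 := ⟨f4, f4_monic, by simpa [f4] using hb0⟩
  refine ⟨K, inferInstance, inferInstance, ⟨b0, hIntg⟩, ?_, hn, hs⟩
  apply RingOfIntegers.coe_injective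
  push_cast; exact hb0

/-- inverting `b-1` -/
theorem beta {K : Type} [Field K] [NumberField K] (b : K) (hb : b ^ 4 + b ^ 2 + b + 1 = 0)
    (hn : finrank ℚ K = 4) (hs : ∀ z : K, ∃ p : ℚ[X], aeval b p = z) :
    (∀ z : K, ∃ p : ℚ[X], aeval (-(b - 1)⁻¹) p = z) ∧ Irreducible (g4.map (Int.castRingHom ℚ)) ∧
    ∀ p : ℚ[X], aeval (-(b - 1)⁻¹) p = 0 → g4.map (Int.castRingHom ℚ) ∣ p := by
  have hc : b - 1 ≠ 0 := by
    intro h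
    have : b = 1 := by linear_combination h
    rw [this] at hb; norm_num at hb
  have hci : (b - 1) * (b - 1)⁻¹ = 1 := mul_inv_cancel₀ hc
  set d := (b - 1)⁻¹
  have p2 : (b - 1) ^ 2 * d ^ 2 = 1 := by rw [← mul_pow, hci, one_pow]
  have p3 : (b - 1) ^ 3 * d ^ 3 = 1 := by rw [← mul_pow, hci, one_pow]
  have p4 : (b - 1) ^ 4 * d ^ 4 = 1 := by rw [← mul_pow, hci, one_pow]
  have hG : 4 * d ^ 4 + 7 * d ^ 3 + 7 * d ^ 2 + 4 * d + 1 = 0 := by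
    linear_combination d ^ 4 * hb - p4 - 4 * d * p3 - 7 * d ^ 2 * p2 - 7 * d ^ 3 * hci
  have hbd : b = -3 - 7 * d - 7 * d ^ 2 - 4 * d ^ 3 := by
    linear_combination (b - 1) * hG - (4 * d ^ 3 + 7 * d ^ 2 + 7 * d + 4) * hci
  have hsurj : ∀ z : K, ∃ p : ℚ[X], aeval (-d) p = z := by
    intro z
    obtain ⟨p, rfl⟩ := hs z
    refine ⟨p.comp (-3 + 7 * X - 7 * X ^ 2 + 4 * X ^ 3), ?_⟩
    rw [aeval_comp]
    congr 1
    simp [map_ofNat]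
    rw [hbd]; ring
  have hroot : aeval (-d) (g4.map (Int.castRingHom ℚ)) = 0 := by
    simp [g4, map_ofNat]
    linear_combination hG
  have htop : IntermediateField.adjoin ℚ {-d} = ⊤ := by
    rw [eq_top_iff]
    intro z _
    obtain ⟨p, rfl⟩ := hsurj z
    exact IntermediateField.algebra_adjoin_le_adjoin _ _ (aeval_mem_adjoin_singleton _ _)
  have hmin := (Field.primitive_element_iff_minpoly_natDegree_eq ℚ (-d)).mp htop
  rw [hn] at hmin
  have hIntg : IsIntegral ℚ (-d) := IsIntegral.of_finite ℚ _
  have hdv := minpoly.dvd ℚ _ hroot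
  have h0 : g4.map (Int.castRingHom ℚ) ≠ 0 := by
    intro h; have := g4_deg; rw [h] at this; simp at this
  have hass : Associated (minpoly ℚ (-d)) (g4.map (Int.castRingHom ℚ)) := by
    obtain ⟨q, hq⟩ := hdv
    have hq0 : q ≠ 0 := by rintro rfl; simp [h0] at hq
    have hm0 := minpoly.ne_zero hIntg
    have := congrArg natDegree hq
    rw [natDegree_mul hm0 hq0, g4_deg, hmin] at this
    have hq1 : q.natDegree = 0 := by omega
    have : IsUnit q := by
      rw [eq_C_of_natDegree_eq_zero hq1]
      rw [isUnit_C, isUnit_iff_ne_zero]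
      intro h; apply hq0; rw [eq_C_of_natDegree_eq_zero hq1, h, C_0]
    obtain ⟨v, hv⟩ := this
    exact ⟨v, by rw [hv, hq]⟩
  refine ⟨hsurj, hass.irreducible (minpoly.irreducible hIntg), fun p hp => ?_⟩
  exact hass.symm.dvd.trans (minpoly.dvd ℚ _ hp)

theorem g4_irr : Irreducible (g4.map (Int.castRingHom ℚ)) := by
  obtain ⟨K, _, _, b, hb, hn, hs⟩ := L_field
  exact (beta (b : K) (by exact_mod_cast congrArg (algebraMap (𝓞 K) K) hb) hn hs).2.1

theorem GR_om : (2 * (1 - GR.xi) ^ 3 - (1 - GR.xi) ^ 2 + 2 * (1 - GR.xi) + 2) ^ 7 = -GR.x ^ 7 := by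
  decide

theorem GR_neg7 : (-1 : GR) ^ 7 = -1 := by decide

theorem exists_ev {R : Type} [CommRing R] (x : R) (p : ℤ[X]) :
    ∃ E : R, ∀ (A : Type) [CommRing A] (f : R →+* A), f E = aeval (f x) p := by
  refine ⟨aeval x p, fun A _ f => ?_⟩
  rw [aeval_def, hom_eval₂, aeval_def]
  congr 1
  exact RingHom.ext_int _ _

theorem L_loc {A : Type} [CommRing A] [IsDomain A] [IsPrincipalIdealRing A] (c ci : A)
    (hci : c * ci = 1) (hF : c ^ 4 + 4 * c ^ 3 + 7 * c ^ 2 + 7 * c + 4 = 0)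
    {J : Ideal (S ℤ)} {e : ℤ[X]} (hJ : HasN J e) :
    ∃ (u : Aˣ) (g : A), aeval (-c) e.reverse * (-ci) ^ e.natDegree = u * g ^ 2 := by
  have hG : 4 * ci ^ 4 + 7 * ci ^ 3 + 7 * ci ^ 2 + 4 * ci + 1 = 0 := by
    have p2 : c ^ 2 * ci ^ 2 = 1 := by rw [← mul_pow, hci, one_pow]
    have p3 : c ^ 3 * ci ^ 3 = 1 := by rw [← mul_pow, hci, one_pow]
    have p4 : c ^ 4 * ci ^ 4 = 1 := by rw [← mul_pow, hci, one_pow]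
    linear_combination ci ^ 4 * hF - p4 - 4 * ci * p3 - 7 * ci ^ 2 * p2 - 7 * ci ^ 3 * hci
  let t := ci + 3 * ci ^ 2 + 4 * ci ^ 3 + 2 * ci ^ 4
  let φ : S ℤ →+* A :=
    evS (aeval (-ci) : ℤ[X] →ₐ[ℤ] A).toRingHom t (by
      simp [N3.hp, Rp, map_ofNat, t]
      linear_combination (ci + 3 * ci ^ 2 + 4 * ci ^ 3 + 2 * ci ^ 4 - ci ^ 2 * (ci + 1) ^ 2) * hG)
  have hφ : ∀ z, φ z = aeval (-ci) z.re + aeval (-ci) z.im * t := fun z => evS_apply _ _ _ _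
  obtain ⟨u, g, hug⟩ := pid_sq φ (by
    intro z
    rw [hφ, hφ, st_re, st_im]
    simp [Rp, map_ofNat, t]
    linear_combination (-(aeval (-ci) z.im)) * hG) hJ
  have h1 : φ (cc e) = aeval (-ci) e := by rw [hφ]; simp
  refine ⟨u, g, ?_⟩
  rw [← hug, h1, ← aeval_rev (-ci) (-c) (by linear_combination hci)]

theorem L_out {J : Ideal (S ℤ)} {e : ℤ[X]} (hJ : HasN J e)
    (he : ¬ Rp (ZMod 2) ∣ e.map (Int.castRingHom (ZMod 2))) (hl : ¬ (2 : ℤ) ∣ e.leadingCoeff) :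
    ∃ (i j : Bool) (s : ℚ[X]), g4.map (Int.castRingHom ℚ) ∣
      e.map (Int.castRingHom ℚ) - (kap i j).map (Int.castRingHom ℚ) * s ^ 2 ∧
      ps e ^ 7 = ps (kap i j) ^ 7 := by
  obtain ⟨K, _, _, b, hb, hn, hs⟩ := L_field
  have hbK : (b : K) ^ 4 + (b : K) ^ 2 + b + 1 = 0 := by
    exact_mod_cast congrArg (algebraMap (𝓞 K) K) hb
  obtain ⟨hβs, -, hβd⟩ := beta (b : K) hbK hn hs
  set β : K := -((b : K) - 1)⁻¹ with hβ
  have hpid := L_pid b hb hn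
  have hsurj := aeval_surj b (L_basis b hb hn).1
  have hdvd : ∀ p : ℤ[X], aeval b p = 0 → f4 ∣ p := by
    intro p hp
    apply dvd_of_aeval f4 f4_monic.isPrimitive f4_irr (b : K) (by simpa [f4] using hbK)
    have := congrArg (algebraMap (𝓞 K) K) hp
    rwa [← aeval_algebraMap_apply, map_zero] at this
  obtain ⟨ψ, hψ⟩ := exists_hom b hsurj f4 hdvd (1 - GR.xi) (by simpa [f4] using GR.b_root)
  have hψb : ψ b = 1 - GR.xi := by simpa using hψ X
  obtain ⟨ρ, hρ, hρd⟩ := L_rho b hb hn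
  have hρb : ρ b = 1 := by simpa using hρ X
  have hπ := L_prime b hb hn
  let ω : (𝓞 K)ˣ := ⟨2 * b ^ 3 - b ^ 2 + 2 * b + 2, -b ^ 3 - b ^ 2 - b,
    by linear_combination (-1 - b - 2 * b ^ 2) * hb, by linear_combination (-1 - b - 2 * b ^ 2) * hb⟩
  have hωv : (ω : 𝓞 K) = 2 * b ^ 3 - b ^ 2 + 2 * b + 2 := rfl
  have hω : b - 1 = ω * (b + 1) ^ 2 := by
    rw [hωv]; linear_combination -(2 * b + 3) * hb
  have hc0 : b - 1 ≠ 0 := by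
    rw [hω]; exact mul_ne_zero ω.ne_zero (pow_ne_zero 2 hπ.ne_zero)
  have := away_dom hc0
  have := away_pid (b - 1)
  let al := algebraMap (𝓞 K) (Localization.Away (b - 1))
  obtain ⟨ci, hci⟩ : ∃ ci, al (b - 1) * ci = 1 := by
    obtain ⟨w, hw⟩ := IsLocalization.Away.algebraMap_isUnit (S := Localization.Away (b - 1)) (b - 1)
    exact ⟨(w⁻¹ : _ˣ), by change algebraMap _ _ _ * _ = _; rw [← hw]; exact w.mul_inv⟩
  obtain ⟨E, hE⟩ := exists_ev (-(b - 1)) e.reverse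
  obtain ⟨u, g, hug⟩ := L_loc (al (b - 1)) ci hci (by
    have hb' := congrArg al hb
    simp only [map_add, map_sub, map_pow, map_one, map_zero] at hb' ⊢
    linear_combination hb') hJ
  have hE1 : al E * (-ci) ^ e.natDegree = u * g ^ 2 := by
    rw [hE, map_neg]; exact hug
  have hρE : ¬ b + 1 ∣ E := by
    rw [← hρd]
    have : ρ E = aeval (0 : ZMod 2) e.reverse := by
      rw [hE, map_neg, map_sub, hρb, map_one, sub_self, neg_zero]
    rw [this, ← coeff_zero_eq_aeval_zero', coeff_zero_reverse]
    intro h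
    exact hl ((ZMod.intCast_zmod_eq_zero_iff_dvd _ 2).mp (by simpa using h))
  obtain ⟨v, δ, hv⟩ := away_sq hπ ω hω hρE ci hci u g _ hE1
  have hψω : ψ ω ^ 7 = -GR.x ^ 7 := by
    rw [hωv]; simp only [map_add, map_sub, map_mul, map_pow, map_ofNat, hψb]; exact GR_om
  obtain ⟨i, j, s, hvs⟩ := unit_class (L_rank b hb hn) ψ ω (Or.inr hψω) v
  have hψE : ps e = ψ E * GR.x ^ e.natDegree := by
    have h3 : ψ (-(b - 1)) = GR.xi := by rw [map_neg, map_sub, hψb, map_one]; ring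
    rw [ps_aeval, ← aeval_rev GR.x GR.xi GR.x_xi, hE, h3]
  have hc0K : (b : K) - 1 ≠ 0 := by
    intro h
    have : (b : K) = 1 := by linear_combination h
    rw [this] at hbK; norm_num at hbK
  have hβc : β * -((b : K) - 1) = 1 := by
    rw [hβ, neg_mul_neg, inv_mul_cancel₀ hc0K]
  have hEe : aeval β e = (E : K) * β ^ e.natDegree := by
    rw [← aeval_rev β (-((b : K) - 1)) hβc]
    have h3 := hE K (algebraMap (𝓞 K) K)
    rw [map_neg, map_sub, map_one] at h3
    rw [← h3]
  have huE : IsUnit (ψ E) := by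
    have : IsUnit (ps e) := IsUnit.of_pow_eq_one (ps_unit e he) (by norm_num)
    rw [hψE] at this
    exact isUnit_of_mul_isUnit_left this
  have hψE7 : ψ E ^ 7 = (bif i then -1 else 1) * (bif j then -GR.x ^ 7 else 1) := by
    have h5 := congrArg ψ hv
    rw [h5, hvs] at huE
    rw [h5, hvs]
    rw [mul_assoc, ← mul_pow, map_mul, map_pow] at huE ⊢
    have hu2 := GR.unit14 ((isUnit_pow_iff two_ne_zero).mp (isUnit_of_mul_isUnit_right huE))
    rw [mul_pow, ← pow_mul, hu2, mul_one, map_mul, mul_pow]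
    have ha : ψ (bif i then -1 else 1) ^ 7 = (bif i then -1 else 1) := by
      cases i
      · rw [cond_false, map_one, one_pow, cond_false]
      · rw [cond_true, map_neg, map_one, cond_true]; exact GR_neg7
    have hb' : ψ ((bif j then ω else 1 : (𝓞 K)ˣ) : 𝓞 K) ^ 7 = (bif j then -GR.x ^ 7 else 1) := by
      cases j
      · rw [cond_false, Units.val_one, map_one, one_pow, cond_false]
      · rw [cond_true, cond_true]; exact hψω
    rw [ha, hb']
  have hEK : (E : K) = (bif i then -1 else 1) * (bif j then ((ω : 𝓞 K) : K) else 1) *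
      (((s : 𝓞 K) : K) * (δ : K)) ^ 2 := by
    have h5 : (E : K) = ((v * δ ^ 2 : 𝓞 K) : K) := congrArg _ hv
    rw [h5, hvs]
    cases i <;> cases j <;> simp <;> ring
  have hπK : (b : K) + 1 ≠ 0 := by
    intro h
    apply hπ.ne_zero
    apply RingOfIntegers.coe_injective
    push_cast; exact h
  have hβ0 : β ≠ 0 := by
    intro h; rw [h, zero_mul] at hβc; exact zero_ne_one hβc
  have hTω : TT β ((ω : 𝓞 K) : K) (-GR.x ^ 7) := by
    have := TT_mul (TT_mul (TT_neg β) (TT_b β)) (TT_sq β ((β * ((b : K) + 1))⁻¹))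
    have e1 : ((ω : 𝓞 K) : K) = -1 * β * (β * ((b : K) + 1))⁻¹ ^ 2 := by
      have hωK : (b : K) - 1 = ((ω : 𝓞 K) : K) * ((b : K) + 1) ^ 2 := by
        exact_mod_cast congrArg (algebraMap (𝓞 K) K) hω
      have h7 : ((b : K) - 1) * β = -1 := by linear_combination -hβc
      field_simp
      linear_combination h7 - β * hωK
    rw [e1]
    simpa using this
  have hT : TT β (aeval β e) (ps e ^ 7) := by
    rw [hEe, hψE, mul_pow, hψE7, hEK, ← pow_mul, mul_comm _ 7, pow_mul]
    refine TT_mul ?_ (TT_pow (TT_b β) _)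
    rw [← mul_one ((bif i then (-1 : GR) else 1) * _)]
    refine TT_mul (TT_mul ?_ ?_) (TT_sq _ _)
    · cases i
      · exact TT_one β
      · exact TT_neg β
    · cases j
      · exact TT_one β
      · exact hTω
  obtain ⟨i', j', z, hz, hχ⟩ := hT
  obtain ⟨q, rfl⟩ := hβs z
  refine ⟨i', j', q, ?_, hχ⟩
  apply hβd
  have hm : ∀ p : ℤ[X], aeval β (p.map (Int.castRingHom ℚ)) = aeval β p := fun p =>
    aeval_map_algebraMap ℚ β p
  rw [map_sub, map_mul, map_pow, hm, hm, hz, sub_self]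

end N3
end

section
open Polynomial
namespace N3
open Module

/-- the sextic-type discriminant polynomial -/
noncomputable def fq : ℚ[X] := Rp ℚ ^ 2 + 4 * N3.hp ℚ

theorem fq_eq : fq = c3.map (Int.castRingHom ℚ) * g4.map (Int.castRingHom ℚ) := by
  simp [fq, Rp, N3.hp, c3, g4]
  ring

theorem c3_deg : (c3.map (Int.castRingHom ℚ)).natDegree = 3 := by
  rw [Monic.natDegree_map c3_monic]; unfold c3; compute_degree!

theorem fq_deg : fq.natDegree = 7 := by
  rw [fq_eq, natDegree_mul c3_irr.ne_zero g4_irr.ne_zero, c3_deg, g4_deg]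

theorem fq_ne : fq ≠ 0 := by
  rw [fq_eq]; exact mul_ne_zero c3_irr.ne_zero g4_irr.ne_zero

theorem lt_deg {p : ℚ[X]} {m : ℕ} (h : p ∈ degreeLT ℚ m) : p = 0 ∨ p.natDegree < m := by
  by_cases h0 : p = 0
  · exact Or.inl h0
  · exact Or.inr ((natDegree_lt_iff_degree_lt h0).mpr (mem_degreeLT.mp h))

theorem halve_elt {I : Ideal (S ℚ)} {U s : ℚ[X]} (hN : HasN I U) (hU : U ≠ 0) (σ : ℚ)
    (hs : fq ∣ C σ * U - s ^ 2) (hcop : IsCoprime U fq) :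
    ∃ (z : S ℚ) (b : ℚ[X]), b ≠ 0 ∧ z ∈ I ∧ nm z = C σ * U * b ^ 2 := by
  obtain ⟨hfin, hrk⟩ := codim (k := ℚ) (by norm_num) hN hU
  set d := U.natDegree with hd
  have h : ∀ m, Module.Finite ℚ (degreeLT ℚ m) := fun m =>
    Module.Finite.equiv (degreeLTEquiv ℚ m).symm
  have e : ∀ m, Module.finrank ℚ (degreeLT ℚ m) = m := fun m => by
    rw [(degreeLTEquiv ℚ m).finrank_eq]; simp
  have hfin2 : Module.Finite ℚ (AdjoinRoot fq) := (AdjoinRoot.powerBasis fq_ne).finite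
  have hrk2 : finrank ℚ (AdjoinRoot fq) = 7 := by
    rw [(AdjoinRoot.powerBasis fq_ne).finrank, AdjoinRoot.powerBasis_dim, fq_deg]
  let τ : (degreeLT ℚ ((d + 8) / 2) × degreeLT ℚ ((d + 1) / 2) × degreeLT ℚ 4) →ₗ[ℚ] S ℚ :=
    { toFun := fun v => ⟨(v.1 : ℚ[X]) + (v.2.1 : ℚ[X]) * Rp ℚ, 2 * (v.2.1 : ℚ[X])⟩
      map_add' := fun x y => by
        ext1 <;> simp <;> ring
      map_smul' := fun q x => by
        ext1 <;> simp [smul_eq_C_mul] <;> ring }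
  let τ2 : (degreeLT ℚ ((d + 8) / 2) × degreeLT ℚ ((d + 1) / 2) × degreeLT ℚ 4) →ₗ[ℚ] ℚ[X] :=
    { toFun := fun v => (v.1 : ℚ[X]) - s * (v.2.2 : ℚ[X])
      map_add' := fun x y => by simp; ring
      map_smul' := fun q x => by simp [smul_eq_C_mul]; ring }
  let Λ := ((I.restrictScalars ℚ).mkQ.comp τ).prod ((AdjoinRoot.mkₐ fq).toLinearMap.comp τ2)
  have hker : LinearMap.ker Λ ≠ ⊥ := by
    apply LinearMap.ker_ne_bot_of_finrank_lt
    rw [finrank_prod, finrank_prod, finrank_prod, hrk, hrk2, e, e, e]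
    omega
  obtain ⟨v, hv, hv0⟩ := Submodule.exists_mem_ne_zero_of_ne_bot hker
  obtain ⟨⟨a, ha⟩, ⟨c, hc⟩, ⟨b, hb⟩⟩ := v
  rw [LinearMap.mem_ker] at hv
  have hv1 : τ (⟨a, ha⟩, ⟨c, hc⟩, ⟨b, hb⟩) ∈ I := by
    have := congrArg Prod.fst hv
    exact (Submodule.Quotient.mk_eq_zero (I.restrictScalars ℚ)).mp this
  have hv2 : fq ∣ a - s * b := by
    have := congrArg Prod.snd hv
    exact AdjoinRoot.mk_eq_zero.mp this
  change (⟨a + c * Rp ℚ, 2 * c⟩ : S ℚ) ∈ I at hv1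
  have hnm : nm (⟨a + c * Rp ℚ, 2 * c⟩ : S ℚ) = a ^ 2 - c ^ 2 * fq := by
    rw [nm_def, fq]; ring
  have hE : nm (⟨a + c * Rp ℚ, 2 * c⟩ : S ℚ) = C σ * U * b ^ 2 := by
    have hdv : U * fq ∣ a ^ 2 - c ^ 2 * fq - C σ * U * b ^ 2 := by
      apply hcop.mul_dvd
      · rw [← hnm]
        exact dvd_sub (hN.nm_dvd hv1) ⟨C σ * b ^ 2, by ring⟩
      · have e1 : a ^ 2 - c ^ 2 * fq - C σ * U * b ^ 2 =
            (a - s * b) * (a + s * b) - (C σ * U - s ^ 2) * b ^ 2 - fq * c ^ 2 := by ring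
        rw [e1]
        exact dvd_sub (dvd_sub (hv2.mul_right _) (hs.mul_right _)) (dvd_mul_right _ _)
    have hdeg : (a ^ 2 - c ^ 2 * fq - C σ * U * b ^ 2).natDegree < (U * fq).natDegree := by
      rw [natDegree_mul hU fq_ne, fq_deg, ← hd]
      have d1 : (a ^ 2).natDegree ≤ d + 6 := by
        rcases lt_deg ha with rfl | h1
        · simp
        · rw [natDegree_pow]; omega
      have d2 : (c ^ 2 * fq).natDegree ≤ d + 6 := by
        rcases lt_deg hc with rfl | h1
        · simp
        · refine natDegree_mul_le.trans ?_
          rw [natDegree_pow, fq_deg]; omega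
      have d3 : (C σ * U * b ^ 2).natDegree ≤ d + 6 := by
        rcases lt_deg hb with rfl | h1
        · simp
        · rw [mul_assoc]
          refine (natDegree_C_mul_le _ _).trans (natDegree_mul_le.trans ?_)
          rw [natDegree_pow]; omega
      have := natDegree_sub_le (a ^ 2 - c ^ 2 * fq) (C σ * U * b ^ 2)
      have := natDegree_sub_le (a ^ 2) (c ^ 2 * fq)
      omega
    have := eq_zero_of_dvd_of_natDegree_lt hdv hdeg
    rw [hnm]; linear_combination this
  refine ⟨_, b, ?_, hv1, hE⟩
  rintro rfl
  apply hv0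
  rw [zero_pow two_ne_zero, mul_zero, nm_eq_zero] at hE
  have him := congrArg QuadraticAlgebra.im hE
  have hre := congrArg QuadraticAlgebra.re hE
  simp at him hre
  subst him
  simp at hre
  subst hre
  rfl

theorem cc_cancel {U : ℚ[X]} (hU : U ≠ 0) {I J : Ideal (S ℚ)}
    (h : Ideal.span {(cc U : S ℚ)} * I = Ideal.span {cc U} * J) : I = J :=
  (hasN_span (cc U)).cancel (by rw [nm_cc]; exact pow_ne_zero 2 hU) h

theorem halve_ideal {I : Ideal (S ℚ)} {U b : ℚ[X]} (hN : HasN I U) (hU : U ≠ 0) {σ : ℚ}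
    (hσ : σ ≠ 0) {z : S ℚ} (hb : b ≠ 0) (hz : z ∈ I) (hnz : nm z = C σ * U * b ^ 2) :
    ∃ (G : Ideal (S ℤ)) (_ : G ∈ GM ℤ) (γ : S ℚ), γ ≠ 0 ∧
      (G.map iQ) ^ 2 * I = Ideal.span {γ} := by
  obtain ⟨J, hJ, hJN⟩ := div_ideal (e := C σ * b ^ 2) hN hU hz (by rw [hnz]; ring)
  have hJb : J * cj J = Ideal.span {cc b} * Ideal.span {cc b} := by
    rw [hJN, map_mul, map_pow, Ideal.span_singleton_mul_span_singleton, ← pow_two]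
    rw [Ideal.span_singleton_mul_left_unit]
    have : IsUnit (C σ : ℚ[X]) := isUnit_C.mpr (isUnit_iff_ne_zero.mpr hσ)
    exact this.map cc
  set B : Ideal (S ℚ) := Ideal.span {cc b} with hB
  have hBc : cj B = B := by rw [hB, cj_span, st_cc]
  set g := J ⊔ B with hg
  have hg0 : g ≠ ⊥ := by
    intro h
    have : (cc b : S ℚ) ∈ g := Ideal.mem_sup_right (Ideal.mem_span_singleton_self _)
    rw [h, Ideal.mem_bot] at this
    exact hb (by simpa using congrArg QuadraticAlgebra.re this)
  obtain ⟨W, hW, hGW⟩ := closure_hasN g hg0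
  have hgW := hGW.map (Int.castRingHom ℚ)
  rw [map_comap_iQ] at hgW
  set w := W.map (Int.castRingHom ℚ)
  have hw0 : w ≠ 0 := by
    rw [Polynomial.map_ne_zero_iff (RingHom.injective_int _)]
    exact hW.ne_zero
  -- the two computations
  have k1 : g * cj g = B * (J ⊔ cj J ⊔ B) := by
    rw [hg, cj_sup, hBc, Ideal.sup_mul, Ideal.mul_sup, Ideal.mul_sup, Ideal.mul_sup, Ideal.mul_sup,
      hJb, mul_comm J B]
    apply le_antisymm
    · refine sup_le (sup_le ?_ ?_) (sup_le ?_ ?_)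
      · exact le_sup_right
      · exact le_sup_left.trans le_sup_left
      · exact le_sup_right.trans le_sup_left
      · exact le_sup_right
    · refine sup_le (sup_le ?_ ?_) ?_
      · exact le_sup_right.trans le_sup_left
      · exact le_sup_left.trans le_sup_right
      · exact le_sup_left.trans le_sup_left
  have k2 : g ^ 2 = J * (J ⊔ cj J ⊔ B) := by
    rw [hg, pow_two, Ideal.sup_mul, Ideal.mul_sup, Ideal.mul_sup, Ideal.mul_sup, Ideal.mul_sup,
      hJb, mul_comm B J]
    apply le_antisymm
    · refine sup_le (sup_le ?_ ?_) (sup_le ?_ ?_)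
      · exact le_sup_left.trans le_sup_left
      · exact le_sup_right
      · exact le_sup_right
      · exact le_sup_right.trans le_sup_left
    · refine sup_le (sup_le ?_ ?_) ?_
      · exact le_sup_left.trans le_sup_left
      · exact le_sup_right.trans le_sup_right
      · exact le_sup_right.trans le_sup_left
  have k3 : Ideal.span {cc U} * (B * (g ^ 2 * I)) =
      Ideal.span {cc U} * Ideal.span {cc w * z} := by
    have hI : cj I * I = Ideal.span {cc U} := by rw [mul_comm]; exact hN
    calc Ideal.span {cc U} * (B * (g ^ 2 * I))
        = (Ideal.span {cc U} * J) * (B * (J ⊔ cj J ⊔ B)) * I := by rw [k2]; ring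
      _ = Ideal.span {z} * (cj I * I) * Ideal.span {cc w} := by
          rw [hJ, ← k1, show g * cj g = Ideal.span {cc w} from hgW]; ring
      _ = _ := by
          rw [hI, ← Ideal.span_singleton_mul_span_singleton (cc w) z]; ring
  have hccne : ∀ {p : ℚ[X]}, p ≠ 0 → (cc p : S ℚ) ≠ 0 := by
    intro p hp h
    exact hp (by simpa using congrArg QuadraticAlgebra.re h)
  have k4 : B * (g ^ 2 * I) = Ideal.span {cc w * z} := cc_cancel hU k3
  have hdv : (cc b : S ℚ) ∣ cc w * z := by
    rw [← Ideal.mem_span_singleton]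
    have : cc w * z ∈ B * (g ^ 2 * I) := by rw [k4]; exact Ideal.mem_span_singleton_self _
    have hle : B * (g ^ 2 * I) ≤ B := Ideal.mul_le_left
    exact hle this
  obtain ⟨γ, hγ⟩ := hdv
  have hz0 : z ≠ 0 := by
    rintro rfl
    rw [nm_zero] at hnz
    exact (mul_ne_zero (mul_ne_zero (C_ne_zero.mpr hσ) hU) (pow_ne_zero 2 hb)) hnz.symm
  refine ⟨g.comap iQ, ⟨W, hW, hGW⟩, γ, ?_, ?_⟩
  · rintro rfl
    rw [mul_zero] at hγ
    exact mul_ne_zero (hccne hw0) hz0 hγ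
  · rw [map_comap_iQ]
    rw [hγ, ← Ideal.span_singleton_mul_span_singleton] at k4
    exact cc_cancel hb k4

end N3
end

section
open Polynomial
namespace N3

theorem ps_c3 : ps c3 = 0 := by
  rw [ps_aeval]; simpa [c3] using GR.x_root

theorem ps_g4 : ps g4 = 0 := by
  rw [ps_aeval]; simp [g4, map_ofNat]; decide

theorem g4_prim : g4.IsPrimitive := by
  intro r hr
  rw [C_dvd_iff_dvd_coeff] at hr
  have := hr 0
  simp [g4] at this
  exact isUnit_of_dvd_one (by simpa using this)

theorem not_dvd_of_ps {F U : ℤ[X]} (hF : F.IsPrimitive) (hz : ps F = 0) (h14 : ps U ^ 14 = 1) :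
    ¬ F.map (Int.castRingHom ℚ) ∣ U.map (Int.castRingHom ℚ) := by
  intro h
  obtain ⟨q, hq⟩ := IsPrimitive.dvd_of_fraction_map_dvd_fraction_map (K := ℚ) hF h
  rw [hq, map_mul, hz, zero_mul] at h14
  revert h14; decide

theorem ps_kap_inj : ∀ i j i' j' : Bool, ps (kap i j) ^ 7 = ps (kap i' j') ^ 7 → i = i' ∧ j = j' := by
  have hk : ∀ i j, ps (kap i j) = (bif i then -1 else 1) * (bif j then GR.x else 1) := by
    intro i j
    cases i <;> cases j <;> simp [kap, ps_X]
  intro i j i' j'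
  rw [hk, hk]
  revert i j i' j'
  decide

theorem cop : IsCoprime (c3.map (Int.castRingHom ℚ)) (g4.map (Int.castRingHom ℚ)) := by
  rw [c3_irr.coprime_iff_not_dvd]
  rintro ⟨q, hq⟩
  rcases g4_irr.isUnit_or_isUnit hq with h | h
  · exact c3_irr.not_isUnit h
  · have := congrArg natDegree hq
    rw [natDegree_mul c3_irr.ne_zero h.ne_zero, natDegree_eq_zero_of_isUnit h, c3_deg, g4_deg] at this
    omega

theorem crt {a s t : ℚ[X]} (h1 : c3.map (Int.castRingHom ℚ) ∣ a - s ^ 2)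
    (h2 : g4.map (Int.castRingHom ℚ) ∣ a - t ^ 2) : ∃ r, fq ∣ a - r ^ 2 := by
  obtain ⟨u, v, huv⟩ := cop
  set A := c3.map (Int.castRingHom ℚ)
  set B := g4.map (Int.castRingHom ℚ)
  obtain ⟨p, hp⟩ := h1
  obtain ⟨q, hq⟩ := h2
  refine ⟨s * v * B + t * u * A, ?_⟩
  rw [fq_eq]
  apply (show IsCoprime A B from ⟨u, v, huv⟩).mul_dvd
  · refine ⟨p + (s - t) * u * (s + (s * v * B + t * u * A)), ?_⟩
    linear_combination hp - (s + (s * v * B + t * u * A)) * s * huv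
  · refine ⟨q + (t - s) * v * (t + (s * v * B + t * u * A)), ?_⟩
    linear_combination hq - (t + (s * v * B + t * u * A)) * t * huv

theorem two_div (D : Cl ℤ) : ∃ (k : ℕ) (E : Cl ℤ), D = P0 ℤ ^ k * E ^ 2 := by
  obtain ⟨J, hJ, e, hN, hprim, -, hl, he, rfl⟩ := good_rep D
  obtain ⟨i, j, s, h1, h2⟩ := K_out hN he
  obtain ⟨i', j', t, h3, h4⟩ := L_out hN he hl
  obtain ⟨rfl, rfl⟩ := ps_kap_inj i j i' j' (h2.symm.trans h4)
  have h14 := ps_unit e he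
  let P : ℤ[X] := bif j then X else 1
  let I0 : Ideal (S ℤ) := bif j then p0 ℤ else 1
  have hI0N : HasN I0 P := by cases j; exacts [hasN_one, p0_hasN]
  obtain ⟨k, hI0G, hk⟩ : ∃ (k : ℕ) (h : I0 ∈ GM ℤ), cls I0 h = P0 ℤ ^ k := by
    cases j
    · exact ⟨0, (GM ℤ).one_mem, cls_one⟩
    · exact ⟨1, p0_GM, (pow_one _).symm⟩
  let ι : ℤ := bif i then -1 else 1
  have hkap : kap i j = C ι * P := by
    cases i <;> cases j <;> simp [kap, ι, P]
  have hι : ι * ι = 1 := by cases i <;> simp [ι]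
  have hUN := (hN.mul hI0N).map (Int.castRingHom ℚ)
  have hPs : ps P ^ 14 = 1 := by
    cases j
    · simp [P]
    · simp only [P, cond_true, ps_X]; decide
  have hU14 : ps (e * P) ^ 14 = 1 := by rw [map_mul, mul_pow, h14, hPs, one_mul]
  set U := (e * P).map (Int.castRingHom ℚ) with hUdef
  have n1 := not_dvd_of_ps c3_monic.isPrimitive ps_c3 hU14
  have n2 := not_dvd_of_ps g4_prim ps_g4 hU14
  have hU0 : U ≠ 0 := fun h => n1 (by rw [← hUdef, h]; exact dvd_zero _)
  have hcop : IsCoprime U fq := by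
    rw [fq_eq]
    exact ((c3_irr.coprime_iff_not_dvd.mpr n1).symm).mul_right
      ((g4_irr.coprime_iff_not_dvd.mpr n2).symm)
  have hιQ : (C (ι : ℚ) * C (ι : ℚ) : ℚ[X]) = 1 := by
    rw [← C_mul, ← Int.cast_mul, hι]; simp
  have hkQ : (kap i j).map (Int.castRingHom ℚ) = C (ι : ℚ) * P.map (Int.castRingHom ℚ) := by
    rw [hkap]; simp
  have key : ∀ (F r : ℚ[X]), F ∣ e.map (Int.castRingHom ℚ) - (kap i j).map (Int.castRingHom ℚ) * r ^ 2 →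
      F ∣ C (ι : ℚ) * U - (P.map (Int.castRingHom ℚ) * r) ^ 2 := by
    intro F r h
    have : C (ι : ℚ) * U - (P.map (Int.castRingHom ℚ) * r) ^ 2 =
        (e.map (Int.castRingHom ℚ) - (kap i j).map (Int.castRingHom ℚ) * r ^ 2) *
          (C (ι : ℚ) * P.map (Int.castRingHom ℚ)) := by
      rw [hkQ, hUdef, Polynomial.map_mul]
      linear_combination (P.map (Int.castRingHom ℚ) ^ 2 * r ^ 2) * hιQ
    rw [this]; exact h.mul_right _
  have h1' : c3.map (Int.castRingHom ℚ) ∣ e.map (Int.castRingHom ℚ) -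
      (kap i j).map (Int.castRingHom ℚ) * (s.map (Int.castRingHom ℚ)) ^ 2 := by
    have := Polynomial.map_dvd (Int.castRingHom ℚ) h1
    simpa only [Polynomial.map_sub, Polynomial.map_mul, Polynomial.map_pow] using this
  obtain ⟨r, hr⟩ := crt (key _ _ h1') (key _ _ h3)
  obtain ⟨z, b, hb, hz, hnz⟩ := halve_elt hUN hU0 (ι : ℚ) hr hcop
  have hι0 : (ι : ℚ) ≠ 0 := by
    intro h; rw [h] at hιQ; simp at hιQ
  obtain ⟨G, hG, γ, hγ, hp⟩ := halve_ideal hUN hU0 hι0 hb hz hnz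
  have hGM := (GM ℤ).mul_mem ((GM ℤ).pow_mem hG 2) ((GM ℤ).mul_mem hJ hI0G)
  have hone := principal_of_rat hGM hγ (by rw [Ideal.map_mul, Ideal.map_pow]; exact hp)
  rw [← cls_mul ((GM ℤ).pow_mem hG 2) ((GM ℤ).mul_mem hJ hI0G), ← cls_pow hG, ← cls_mul hJ hI0G, hk]
    at hone
  refine ⟨k, (cls G hG)⁻¹ * (P0 ℤ ^ k)⁻¹, ?_⟩
  have h5 : cls J hJ = (cls G hG ^ 2)⁻¹ * (P0 ℤ ^ k)⁻¹ := by
    rw [eq_mul_inv_iff_mul_eq]; exact eq_inv_of_mul_eq_one_right hone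
  rw [h5, mul_pow, inv_pow, inv_pow]
  generalize P0 ℤ ^ k = q
  rw [mul_left_comm, pow_two q, mul_inv, mul_inv_cancel_left]

theorem curve_points (x y : ℚ) (h : y ^ 2 + (x ^ 3 + x ^ 2 - 2 * x + 1) * y = x ^ 4 * (x - 1) ^ 3) :
    x = 0 ∨ x = 1 :=
  points (fun _ hD => red_inj two_div hD) x y h

theorem main_pts (b w : ℚ) (h : b * w ^ 2 - (b ^ 4 - 2 * b ^ 3 + b ^ 2 + b - 1) * w + b ^ 4
    - 2 * b ^ 3 + 2 * b ^ 2 - b = 0) : w = 0 ∧ (b = 0 ∨ b = 1) := by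
  by_cases h1 : b = 1
  · subst h1
    refine ⟨?_, Or.inr rfl⟩
    have : w * w = 0 := by linarith
    exact mul_self_eq_zero.mp this
  have hc : b - 1 ≠ 0 := sub_ne_zero.mpr h1
  have hx := curve_points (-(b - 1)⁻¹) (((b - 1)⁻¹ ^ 4 * (2 * b * w - (b - 1) * (b ^ 3 - b ^ 2 + 1)) -
      ((-(b - 1)⁻¹) ^ 3 + (-(b - 1)⁻¹) ^ 2 - 2 * (-(b - 1)⁻¹) + 1)) / 2) (by
    field_simp
    linear_combination (4 : ℚ) * b * h)
  rcases hx with hx | hx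
  · exfalso
    rw [neg_eq_zero, inv_eq_zero] at hx
    exact hc hx
  · have hb : b = 0 := by
      have : (b - 1) * (b - 1)⁻¹ = 1 := mul_inv_cancel₀ hc
      have h3 : (b - 1)⁻¹ = -1 := by linarith
      rw [h3] at this; linarith
    subst hb
    exact ⟨by linarith, Or.inl rfl⟩

theorem stmt_12x : {p : ℚ × ℚ | p.1 * p.2 ^ 2 - (p.1 ^ 4 - 2 * p.1 ^ 3 + p.1 ^ 2 + p.1 - 1) * p.2 + p.1 ^ 4 - 2 * p.1 ^ 3 + 2 * p.1 ^ 2 - p.1 = 0} = ({(0, 0), (1, 0)} : Set (ℚ × ℚ)) := by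
  ext ⟨b, w⟩
  simp only [Set.mem_setOf_eq, Set.mem_insert_iff, Set.mem_singleton_iff, Prod.mk.injEq]
  constructor
  · intro h
    obtain ⟨rfl, rfl | rfl⟩ := main_pts b w h
    · exact Or.inl ⟨rfl, rfl⟩
    · exact Or.inr ⟨rfl, rfl⟩
  · rintro (⟨rfl, rfl⟩ | ⟨rfl, rfl⟩) <;> norm_num

end N3
end

/-- The only rational points on
`b·w² - (b⁴ - 2b³ + b² + b - 1)w + b⁴ - 2b³ + 2b² - b = 0` are
`(0, 0)` and `(1, 0)` (graph N3H1). -/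
theorem stmt_12 :
    {p : ℚ × ℚ |
        p.1 * p.2 ^ 2 -
          (p.1 ^ 4 - 2 * p.1 ^ 3 + p.1 ^ 2 + p.1 - 1) * p.2 +
          p.1 ^ 4 - 2 * p.1 ^ 3 + 2 * p.1 ^ 2 - p.1 = 0} =
      ({(0, 0), (1, 0)} : Set (ℚ × ℚ)) := by
  exact N3.stmt_12x
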